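/- arXiv:1805.09079 — 2 statements merged into one kernel-verified Lean document; each statement's English description precedes it below -/
import Mathlib

section
/- Let $M$ be an $n\times n$ random matrix whose entries are i.i.d., each taking the value $0$ with probability $1/2$ and each of the values $1$ and $-1$ with probability $1/4$. Fix $1\le j_{1}<j_{2}\le n$ and let $d_{1},d_{2}$ be the determinants of the $(n-1)\times(n-1)$ minors of $M$ obtained by deleting the first row and the $j_{1}$-th (respectively $j_{2}$-th) column, and let $\tau_{1},\tau_{2}\in\{1,-1,2,-2\}$. Then there exist absolute constants $C,c>0$ such that for every prime $p$ and every $n$, $\mathbb{P}\big(p\mid\tau_{1}d_{1}+\tau_{2}d_{2}\big)\le\frac{C}{p}+Ce^{-cn}$. -/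
open MeasureTheory

/-- The law of a single entry: `0` with probability `1/2`, `1` and `-1` with
probability `1/4` each. -/
noncomputable def entryMeasure : Measure ℤ :=
  (1/2 : ENNReal) • Measure.dirac 0 + (1/4 : ENNReal) • Measure.dirac 1 +
    (1/4 : ENNReal) • Measure.dirac (-1)

instance : IsProbabilityMeasure entryMeasure := by
  constructor
  simp only [entryMeasure, Measure.add_apply, Measure.smul_apply, measure_univ, smul_eq_mul,
    mul_one, one_div]
  have h4 : (4⁻¹ + 4⁻¹ : ENNReal) = 2⁻¹ := by
    rw [← two_mul, show (4 : ENNReal) = 2 * 2 by norm_num,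
      ENNReal.mul_inv (by norm_num) (by norm_num), ← mul_assoc,
      ENNReal.mul_inv_cancel (by norm_num) (by norm_num), one_mul]
  rw [add_assoc, h4, ENNReal.inv_two_add_inv_two]

/-- The joint law of `n` i.i.d. entries. -/
noncomputable def vecMeasure (n : ℕ) : Measure (Fin n → ℤ) :=
  Measure.pi fun _ => entryMeasure

instance (n : ℕ) : IsProbabilityMeasure (vecMeasure n) := by
  unfold vecMeasure; infer_instance

/-- The law of an `n × n` random matrix (given as a function of its rows) with
i.i.d. entries distributed according to `entryMeasure`. -/
noncomputable def matMeasure (n : ℕ) : Measure (Fin n → Fin n → ℤ) :=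
  Measure.pi fun _ => vecMeasure n

instance (n : ℕ) : IsProbabilityMeasure (matMeasure n) := by
  unfold matMeasure; infer_instance

/-- The inclusion `Fin (n-1) → Fin n` skipping index `0` (deleting the first
row). -/
def delFirstRow (n : ℕ) : Fin (n - 1) → Fin n :=
  fun i => ⟨(i : ℕ) + 1, by have := i.isLt; omega⟩

/-- The inclusion `Fin (n-1) → Fin n` skipping index `j` (deleting the `j`-th
column). -/
def skipCol (n : ℕ) (j : Fin n) : Fin (n - 1) → Fin n :=
  fun i => if (i : ℕ) < (j : ℕ) then ⟨(i : ℕ), by have := i.isLt; omega⟩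
    else ⟨(i : ℕ) + 1, by have := i.isLt; omega⟩

/-- The determinant of the `(n-1) × (n-1)` first-row minor of `M` obtained by
deleting the first row and the `j`-th column. -/
def minorDet {n : ℕ} (M : Fin n → Fin n → ℤ) (j : Fin n) : ℤ :=
  ((Matrix.of M).submatrix (delFirstRow n) (skipCol n j)).det

section Chain

open Module

variable {F E : Type*} [Field F] [AddCommGroup E] [Module F E] [Fintype E]

/-- The averaging operator of the chain of subspaces `U ↦ U ⊔ span {x}`, where `x` is drawn with
weight `a`. -/
noncomputable def spanStep (F : Type*) {E : Type*} [Field F] [AddCommGroup E] [Module F E]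
    [Fintype E] (a : E → ℝ) : Module.End ℝ (Submodule F E → ℝ) where
  toFun h U := ∑ x, a x * h (U ⊔ Submodule.span F {x})
  map_add' h₁ h₂ := by ext U; simp [mul_add, Finset.sum_add_distrib]
  map_smul' c h := by
    ext U; simp only [Pi.smul_apply, smul_eq_mul, RingHom.id_apply, Finset.mul_sum]
    exact Finset.sum_congr rfl fun x _ => by ring

open Classical in
/-- The total weight of a subspace. -/
noncomputable def mass (a : E → ℝ) (V : Submodule F E) : ℝ := ∑ x, if x ∈ V then a x else 0

open Classical in
/-- The indicator function of a set of subspaces. -/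
noncomputable def subInd (P : Submodule F E → Prop) (U : Submodule F E) : ℝ := if P U then 1 else 0

omit [Fintype E] in
theorem subInd_nonneg (P : Submodule F E → Prop) (U : Submodule F E) : 0 ≤ subInd P U := by
  unfold subInd; split_ifs <;> norm_num

theorem spanStep_apply (a : E → ℝ) (h : Submodule F E → ℝ) (U : Submodule F E) :
    spanStep F a h U = ∑ x, a x * h (U ⊔ Submodule.span F {x}) := rfl

theorem spanStep_pow_succ_apply (a : E → ℝ) (K : ℕ) (h : Submodule F E → ℝ) (U : Submodule F E) :
    (spanStep F a ^ (K + 1)) h U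
      = ∑ x, a x * (spanStep F a ^ K) h (U ⊔ Submodule.span F {x}) := by
  rw [pow_succ', Module.End.mul_apply, spanStep_apply]

theorem spanStep_pow_mono {a : E → ℝ} (ha : ∀ x, 0 ≤ a x) (K : ℕ) {h₁ h₂ : Submodule F E → ℝ}
    (h : ∀ U, h₁ U ≤ h₂ U) (U : Submodule F E) :
    (spanStep F a ^ K) h₁ U ≤ (spanStep F a ^ K) h₂ U := by
  induction K generalizing U with
  | zero => simpa using h U
  | succ K ih =>
    simp only [spanStep_pow_succ_apply]
    exact Finset.sum_le_sum fun x _ => mul_le_mul_of_nonneg_left (ih _) (ha x)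

theorem spanStep_pow_nonneg {a : E → ℝ} (ha : ∀ x, 0 ≤ a x) (K : ℕ) {h : Submodule F E → ℝ}
    (hh : ∀ U, 0 ≤ h U) (U : Submodule F E) : 0 ≤ (spanStep F a ^ K) h U := by
  have := spanStep_pow_mono ha K (h₁ := 0) hh U
  simpa using this

theorem spanStep_pow_const {a : E → ℝ} (ha : ∑ x, a x = 1) (K : ℕ) (c : ℝ) (U : Submodule F E) :
    (spanStep F a ^ K) (fun _ => c) U = c := by
  induction K generalizing U with
  | zero => simp
  | succ K ih => simp [spanStep_pow_succ_apply, ih, ← Finset.sum_mul, ha]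

/-- The chain started from `U` only sees subspaces containing `U`. -/
theorem spanStep_pow_eq_zero (a : E → ℝ) (K : ℕ) {h : Submodule F E → ℝ} {U : Submodule F E}
    (hh : ∀ U', U ≤ U' → h U' = 0) : (spanStep F a ^ K) h U = 0 := by
  induction K generalizing U with
  | zero => simpa using hh U le_rfl
  | succ K ih =>
    rw [spanStep_pow_succ_apply]
    refine Finset.sum_eq_zero fun x _ => ?_
    rw [ih fun U' hU' => hh U' (le_sup_left.trans hU'), mul_zero]

theorem spanStep_pow_le_of_le {a : E → ℝ} (ha : ∀ x, 0 ≤ a x) {φ : Submodule F E → ℝ} {l : ℝ}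
    (hl : 0 ≤ l) (hφ : ∀ U, spanStep F a φ U ≤ l * φ U) (K : ℕ) (U : Submodule F E) :
    (spanStep F a ^ K) φ U ≤ l ^ K * φ U := by
  induction K generalizing U with
  | zero => simp
  | succ K ih =>
    rw [pow_succ, Module.End.mul_apply]
    calc (spanStep F a ^ K) (spanStep F a φ) U
        ≤ (spanStep F a ^ K) (l • φ) U := spanStep_pow_mono ha K hφ U
      _ = l * (spanStep F a ^ K) φ U := by simp
      _ ≤ l * (l ^ K * φ U) := mul_le_mul_of_nonneg_left (ih U) hl
      _ = l ^ (K + 1) * φ U := by ring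

theorem sum_prod_mul_eq_spanStep_pow (a : E → ℝ) (K : ℕ) (h : Submodule F E → ℝ)
    (U : Submodule F E) :
    ∑ M : Fin K → E, (∏ i, a (M i)) * h (U ⊔ Submodule.span F (Set.range M))
      = (spanStep F a ^ K) h U := by
  induction K generalizing U with
  | zero => simp
  | succ K ih =>
    rw [spanStep_pow_succ_apply, ← (Fin.consEquiv fun _ => E).sum_comp, Fintype.sum_prod_type]
    refine Finset.sum_congr rfl fun x _ => ?_
    rw [← ih, Finset.mul_sum]
    refine Finset.sum_congr rfl fun M _ => ?_
    simp only [Fin.consEquiv, Equiv.coe_fn_mk, Fin.prod_univ_succ, Fin.cons_zero, Fin.cons_succ]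
    rw [Fin.range_cons, Submodule.span_insert, sup_assoc, mul_assoc]

theorem mass_nonneg {a : E → ℝ} (ha : ∀ x, 0 ≤ a x) (V : Submodule F E) : 0 ≤ mass a V :=
  Finset.sum_nonneg fun x _ => by split_ifs; exacts [ha x, le_rfl]

theorem mass_le_one {a : E → ℝ} (ha : ∀ x, 0 ≤ a x) (ha1 : ∑ x, a x = 1) (V : Submodule F E) :
    mass a V ≤ 1 :=
  ha1 ▸ Finset.sum_le_sum fun x _ => by split_ifs; exacts [le_rfl, ha x]

/-- Exchange inequality with a single law: superfluous steps must land in `V`. -/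
theorem spanStep_pow_add_le {a : E → ℝ} (ha : ∀ x, 0 ≤ a x) (V : Submodule F E) (s : ℕ) :
    ∀ (r m : ℕ) (U : Submodule F E), r + m = s → U ≤ V → finrank F V = finrank F U + r →
    (spanStep F a ^ s) (subInd (· = V)) U
      ≤ 2 ^ s * mass a V ^ m * (spanStep F a ^ r) (subInd (· = V)) U := by
  classical
  have : Module.Finite F E := Module.Finite.of_finite
  have hQ : ∀ K U, 0 ≤ (spanStep F a ^ K) (subInd (· = V)) U := fun K U =>
    spanStep_pow_nonneg ha K (subInd_nonneg _) U
  have hf := mass_nonneg ha V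
  induction s with
  | zero =>
    intro r m U h _ _
    obtain ⟨rfl, rfl⟩ : r = 0 ∧ m = 0 := by omega
    simp
  | succ s ih =>
    intro r m U h hUV hr
    rcases m with _ | m
    · obtain rfl : r = s + 1 := by omega
      rw [pow_zero, mul_one]
      exact le_mul_of_one_le_left (hQ _ _) (one_le_pow₀ (by norm_num))
    · have key : ∀ x, a x * (spanStep F a ^ s) (subInd (· = V)) (U ⊔ Submodule.span F {x}) ≤
          2 ^ s * mass a V ^ m * (spanStep F a ^ r) (subInd (· = V)) U *
            (if x ∈ V then a x else 0) +
          (if x ∈ V ∧ x ∉ U then 2 ^ s * mass a V ^ (m + 1) *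
            (a x * (spanStep F a ^ (r - 1)) (subInd (· = V)) (U ⊔ Submodule.span F {x})) else 0) := by
        intro x
        by_cases hxV : x ∈ V
        · by_cases hxU : x ∈ U
          · have : U ⊔ Submodule.span F {x} = U := by simpa using hxU
            rw [this]
            simp only [hxV, hxU, not_true_eq_false, and_false, if_true, if_false, add_zero]
            rw [mul_comm]
            exact mul_le_mul_of_nonneg_right (ih r m U (by omega) hUV hr) (ha x)
          · have h1 := Submodule.finrank_sup_span_singleton (K := F) hxU
            have h2 : U ⊔ Submodule.span F {x} ≤ V := sup_le hUV (by simpa using hxV)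
            have h3 := Submodule.finrank_mono h2
            have h4 := ih (r - 1) (m + 1) _ (by omega) h2 (by omega)
            simp only [hxV, hxU, not_false_eq_true, and_true, if_true]
            have h5 := mul_le_mul_of_nonneg_left h4 (ha x)
            have h6 : 0 ≤ 2 ^ s * mass a V ^ m * (spanStep F a ^ r) (subInd (· = V)) U * a x :=
              mul_nonneg (mul_nonneg (by positivity) (hQ _ _)) (ha x)
            linarith
        · rw [spanStep_pow_eq_zero]
          · simp [hxV]
          · intro U' hU'
            have : U' ≠ V := by
              rintro rfl
              exact hxV (hU' (Submodule.mem_sup_right (Submodule.mem_span_singleton_self x)))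
            simp [subInd, this]
      rw [spanStep_pow_succ_apply]
      refine (Finset.sum_le_sum fun x _ => key x).trans ?_
      rw [Finset.sum_add_distrib, ← Finset.mul_sum]
      have h2 : ∑ x, (if x ∈ V ∧ x ∉ U then 2 ^ s * mass a V ^ (m + 1) *
            (a x * (spanStep F a ^ (r - 1)) (subInd (· = V)) (U ⊔ Submodule.span F {x})) else 0)
          ≤ 2 ^ s * mass a V ^ (m + 1) * (spanStep F a ^ r) (subInd (· = V)) U := by
        rcases r with _ | r
        · have : U = V := Submodule.eq_of_le_of_finrank_eq hUV (by omega)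
          subst this
          rw [Finset.sum_eq_zero]
          · exact mul_nonneg (by positivity) (hQ _ _)
          · intro x _; simp
        · rw [spanStep_pow_succ_apply, Finset.mul_sum]
          refine Finset.sum_le_sum fun x _ => ?_
          have : 0 ≤ 2 ^ s * mass a V ^ (m + 1) *
            (a x * (spanStep F a ^ r) (subInd (· = V)) (U ⊔ Submodule.span F {x})) :=
              mul_nonneg (by positivity) (mul_nonneg (ha x) (hQ _ _))
          split_ifs
          · simp
          · exact this
      have h3 : 2 ^ s * mass a V ^ m * (spanStep F a ^ r) (subInd (· = V)) U *
          (∑ x, if x ∈ V then a x else 0)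
          = 2 ^ s * mass a V ^ (m + 1) * (spanStep F a ^ r) (subInd (· = V)) U := by
        rw [← mass]; ring
      rw [h3, pow_succ 2 s]
      linarith

theorem spanStep_pow_subInd_mono {a : E → ℝ} (ha : ∀ x, 0 ≤ a x) (V : Submodule F E) (K : ℕ) :
    ∀ U U' : Submodule F E, U ≤ U' → U' ≤ V →
    (spanStep F a ^ K) (subInd (· = V)) U ≤ (spanStep F a ^ K) (subInd (· = V)) U' := by
  induction K with
  | zero =>
    intro U U' h h'
    by_cases hU : U = V
    · have : U' = V := le_antisymm h' (hU ▸ h)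
      simp [hU, this]
    · simpa [subInd, hU] using subInd_nonneg (· = V) U'
  | succ K ih =>
    intro U U' h h'
    simp only [spanStep_pow_succ_apply]
    refine Finset.sum_le_sum fun x _ => mul_le_mul_of_nonneg_left ?_ (ha x)
    by_cases hxV : x ∈ V
    · exact ih _ _ (sup_le_sup_right h _) (sup_le h' (by simpa using hxV))
    · rw [spanStep_pow_eq_zero]
      · exact spanStep_pow_nonneg ha K (subInd_nonneg _) _
      · intro U' hU'
        have : U' ≠ V := by
          rintro rfl
          exact hxV (hU' (Submodule.mem_sup_right (Submodule.mem_span_singleton_self x)))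
        simp [subInd, this]

/-- Exchange inequality: steps with law `a` are replaced by steps with law `b`. -/
theorem spanStep_pow_exchange {a b : E → ℝ} (ha : ∀ x, 0 ≤ a x) (hb : ∀ x, 0 ≤ b x)
    (V : Submodule F E) (r m : ℕ)
    (hV : ∀ U : Submodule F E, U ≤ V → finrank F U + r < finrank F V →
      mass b U ≤ mass b V / 2) (j : ℕ) :
    ∀ U : Submodule F E, U ≤ V → finrank F V = finrank F U + (r + j) →
    (spanStep F a ^ (r + m)) (subInd (· = V)) U * (mass b V / 2) ^ j
      ≤ 2 ^ (r + m) * mass a V ^ m *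
        (spanStep F b ^ j) ((spanStep F a ^ r) (subInd (· = V))) U := by
  classical
  have : Module.Finite F E := Module.Finite.of_finite
  have hQ : ∀ K U, 0 ≤ (spanStep F a ^ K) (subInd (· = V)) U := fun K U =>
    spanStep_pow_nonneg ha K (subInd_nonneg _) U
  have hQ' : ∀ j U, 0 ≤ (spanStep F b ^ j) ((spanStep F a ^ r) (subInd (· = V))) U := fun j U =>
    spanStep_pow_nonneg hb j (hQ r) U
  have hf := mass_nonneg ha V
  have hg := mass_nonneg hb V
  induction j with
  | zero =>
    intro U hU hr
    simpa using spanStep_pow_add_le ha V _ r m U rfl hU (by omega)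
  | succ j ih =>
    intro U hU hr
    have hgU := hV U hU (by omega)
    set Q := (spanStep F a ^ (r + m)) (subInd (· = V)) with hQdef
    have key : ∀ x, Q U * (mass b V / 2) ^ j *
        ((if x ∈ V then b x else 0) - (if x ∈ U then b x else 0)) ≤
        2 ^ (r + m) * mass a V ^ m * (b x *
          (spanStep F b ^ j) ((spanStep F a ^ r) (subInd (· = V))) (U ⊔ Submodule.span F {x})) := by
      intro x
      have hpos : 0 ≤ 2 ^ (r + m) * mass a V ^ m * (b x *
          (spanStep F b ^ j) ((spanStep F a ^ r) (subInd (· = V))) (U ⊔ Submodule.span F {x})) :=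
        mul_nonneg (by positivity) (mul_nonneg (hb x) (hQ' _ _))
      by_cases hxV : x ∈ V
      · by_cases hxU : x ∈ U
        · simpa [hxU, hxV] using hpos
        · have h1 := Submodule.finrank_sup_span_singleton (K := F) hxU
          have h2 : U ⊔ Submodule.span F {x} ≤ V := sup_le hU (by simpa using hxV)
          have h4 := ih _ h2 (by omega)
          have h5 := spanStep_pow_subInd_mono ha V (r + m) U _ le_sup_left h2
          simp only [hxV, hxU, if_true, if_false, sub_zero]
          calc Q U * (mass b V / 2) ^ j * b x
              ≤ Q (U ⊔ Submodule.span F {x}) * (mass b V / 2) ^ j * b x := by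
                have := hb x
                gcongr
            _ ≤ _ * b x := mul_le_mul_of_nonneg_right h4 (hb x)
            _ = _ := by ring
      · have hxU : x ∉ U := fun h => hxV (hU h)
        simpa [hxU, hxV] using hpos
    have hsum := Finset.sum_le_sum fun x (_ : x ∈ Finset.univ) => key x
    rw [← Finset.mul_sum, ← Finset.mul_sum, ← spanStep_pow_succ_apply, Finset.sum_sub_distrib]
      at hsum
    refine le_trans ?_ hsum
    rw [pow_succ, ← mul_assoc]
    refine mul_le_mul_of_nonneg_left ?_ (mul_nonneg (hQ _ _) (by positivity))
    change _ ≤ mass b V - mass b U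
    linarith

end Chain

section ChainBounds

open Module

variable {F E : Type*} [Field F] [AddCommGroup E] [Module F E] [Fintype E]

theorem spanStep_pow_sup_ne_top_le {a : E → ℝ} (ha : ∀ x, 0 ≤ a x) (ha1 : ∑ x, a x = 1)
    (hprop : ∀ V : Submodule F E, V ≠ ⊤ → mass a V ≤ 1 / 2) (A : Submodule F E) (K : ℕ)
    (U : Submodule F E) :
    (spanStep F a ^ K) (subInd (fun U => U ⊔ A ≠ ⊤)) U
      ≤ (2 / 3) ^ K * 3 ^ (finrank F E - finrank F A) := by
  classical
  have : Module.Finite F E := Module.Finite.of_finite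
  set φ : Submodule F E → ℝ := fun U =>
    if U ⊔ A = ⊤ then 0 else 3 ^ (finrank F E - finrank F ↥(U ⊔ A)) with hφ
  have hφ0 : ∀ U, 0 ≤ φ U := fun U => by simp only [hφ]; split_ifs <;> positivity
  have hstep : ∀ U, spanStep F a φ U ≤ 2 / 3 * φ U := by
    intro U
    have key : ∀ x, a x * φ (U ⊔ Submodule.span F {x}) ≤
        φ U / 3 * a x + 2 / 3 * φ U * (if x ∈ U ⊔ A then a x else 0) := by
      intro x
      have hcomm : U ⊔ Submodule.span F {x} ⊔ A = (U ⊔ A) ⊔ Submodule.span F {x} := sup_right_comm ..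
      by_cases hx : x ∈ U ⊔ A
      · have : φ (U ⊔ Submodule.span F {x}) = φ U := by
          have h : (U ⊔ A) ⊔ Submodule.span F {x} = U ⊔ A := by simpa using hx
          simp only [hφ]
          rw [hcomm, h]
        rw [this]
        simp only [hx, if_true]
        linarith
      · have h1 := Submodule.finrank_sup_span_singleton (K := F) hx
        have hU : U ⊔ A ≠ ⊤ := fun h => hx (h ▸ Submodule.mem_top)
        have h2 := Submodule.finrank_lt hU
        have : φ (U ⊔ Submodule.span F {x}) ≤ φ U / 3 := by
          simp only [hφ]
          rw [hcomm, h1, if_neg hU]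
          split_ifs
          · positivity
          · rw [show finrank F E - finrank F ↥(U ⊔ A)
              = (finrank F E - (finrank F ↥(U ⊔ A) + 1)) + 1 by omega, pow_succ]
            simp
        have := mul_le_mul_of_nonneg_left this (ha x)
        simp only [hx, if_false]
        linarith
    rw [spanStep_apply]
    refine (Finset.sum_le_sum fun x _ => key x).trans ?_
    rw [Finset.sum_add_distrib, ← Finset.mul_sum, ← Finset.mul_sum, ha1]
    change _ + 2 / 3 * φ U * mass a (U ⊔ A) ≤ _
    by_cases hU : U ⊔ A = ⊤
    · simp [hφ, hU]
    · have h1 := hprop _ hU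
      have := mul_le_mul_of_nonneg_left h1 (hφ0 U)
      linarith
  calc (spanStep F a ^ K) (subInd (fun U => U ⊔ A ≠ ⊤)) U
      ≤ (spanStep F a ^ K) φ U := by
        refine spanStep_pow_mono ha K (fun U => ?_) U
        by_cases hU : U ⊔ A = ⊤
        · simp [subInd, hφ, hU]
        · simpa [subInd, hφ, hU] using one_le_pow₀ (by norm_num : (1 : ℝ) ≤ 3)
    _ ≤ (2 / 3) ^ K * φ U := spanStep_pow_le_of_le ha (by norm_num) hstep K U
    _ ≤ _ := by
        gcongr
        simp only [hφ]
        split_ifs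
        · positivity
        · gcongr
          · norm_num
          · exact Submodule.finrank_mono le_sup_right

theorem one_sub_spanStep_pow_finrank_le {a : E → ℝ} (ha : ∀ x, 0 ≤ a x) (ha1 : ∑ x, a x = 1)
    (U₀ : Submodule F E) (K : ℕ) :
    1 - (spanStep F a ^ K) (subInd fun U => finrank F U = K + finrank F U₀) U₀ ≤
      ∑ k ∈ Finset.range K, (spanStep F a ^ k)
        (fun U => subInd (fun U => finrank F U = k + finrank F U₀) U * mass a U) U₀ := by
  classical
  have : Module.Finite F E := Module.Finite.of_finite
  induction K with
  | zero => simp [subInd]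
  | succ K ih =>
    rw [Finset.sum_range_succ]
    have key : ∀ U : Submodule F E,
        (subInd (fun U => finrank F U = K + finrank F U₀) -
          fun U => subInd (fun U => finrank F U = K + finrank F U₀) U * mass a U :
            Submodule F E → ℝ) U ≤
        spanStep F a (subInd fun U => finrank F U = K + 1 + finrank F U₀) U := by
      intro U
      have hnn : ∀ x, 0 ≤ a x * subInd (fun U => finrank F U = K + 1 + finrank F U₀)
          (U ⊔ Submodule.span F {x}) := fun x => mul_nonneg (ha x) (subInd_nonneg _ _)
      by_cases hU : finrank F U = K + finrank F U₀
      · have h1 : ((subInd (fun U => finrank F U = K + finrank F U₀) -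
          fun U => subInd (fun U => finrank F U = K + finrank F U₀) U * mass a U :
            Submodule F E → ℝ) U) = ∑ x, a x - mass a U := by
          simp [subInd, hU, ha1]
        rw [h1, mass, ← Finset.sum_sub_distrib]
        refine Finset.sum_le_sum fun x _ => ?_
        by_cases hx : x ∈ U
        · simpa [hx] using hnn x
        · have h1 := Submodule.finrank_sup_span_singleton (K := F) hx
          simp [subInd, hx, h1, hU, add_right_comm]
      · have h1 : ((subInd (fun U => finrank F U = K + finrank F U₀) -
          fun U => subInd (fun U => finrank F U = K + finrank F U₀) U * mass a U :
            Submodule F E → ℝ) U) = 0 := by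
          simp [subInd, hU]
        rw [h1]
        exact Finset.sum_nonneg fun x _ => hnn x
    have h := spanStep_pow_mono ha K key U₀
    rw [map_sub, Pi.sub_apply, ← Module.End.mul_apply, ← pow_succ] at h
    linarith

theorem spanStep_pow_subInd_le {a b : E → ℝ} (ha : ∀ x, 0 ≤ a x)
    (ha1 : ∑ x, a x = 1) (hb : ∀ x, 0 ≤ b x) (hb1 : ∑ x, b x = 1) {U₀ : Submodule F E}
    {P : Submodule F E → Prop} {C : ℝ} (hC : 0 ≤ C) {K j r : ℕ}
    (h : ∀ V, P V → U₀ ≤ V → (spanStep F a ^ K) (subInd (· = V)) U₀ ≤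
      C * (spanStep F b ^ j) ((spanStep F a ^ r) (subInd (· = V))) U₀) :
    (spanStep F a ^ K) (subInd P) U₀ ≤ C := by
  classical
  have := Fintype.ofFinite (Submodule F E)
  have hP : subInd P = ∑ V : Submodule F E, (if P V then 1 else 0 : ℝ) • subInd (· = V) := by
    ext U
    rw [Finset.sum_apply, Finset.sum_eq_single U]
    · simp [subInd]
    · intro V _ hV
      simp [subInd, hV.symm]
    · simp
  have h1 : ∑ V : Submodule F E, subInd (· = V) = fun _ => (1 : ℝ) := by
    ext U
    rw [Finset.sum_apply, Finset.sum_eq_single U]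
    · simp [subInd]
    · intro V _ hV
      simp [subInd, hV.symm]
    · simp
  rw [hP, map_sum, Finset.sum_apply]
  calc _ ≤ ∑ V, C * (spanStep F b ^ j) ((spanStep F a ^ r) (subInd (· = V))) U₀ := by
        refine Finset.sum_le_sum fun V _ => ?_
        have hpos : 0 ≤ C * (spanStep F b ^ j) ((spanStep F a ^ r) (subInd (· = V))) U₀ :=
          mul_nonneg hC (spanStep_pow_nonneg hb _ (fun U => spanStep_pow_nonneg ha _
            (subInd_nonneg _) _) _)
        rw [map_smul, Pi.smul_apply, smul_eq_mul]
        by_cases hPV : P V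
        · by_cases hV : U₀ ≤ V
          · simpa [hPV] using h V hPV hV
          · rw [spanStep_pow_eq_zero]
            · simpa using hpos
            · intro U' hU'
              have : U' ≠ V := by rintro rfl; exact hV hU'
              simp [subInd, this]
        · simpa [hPV] using hpos
    _ = C := by
        rw [← Finset.mul_sum, ← Finset.sum_apply, ← map_sum, ← map_sum, h1]
        have : (spanStep F a ^ r) (fun _ => (1 : ℝ)) = fun _ => (1 : ℝ) := by
          ext U; exact spanStep_pow_const ha1 r 1 U
        rw [this, spanStep_pow_const hb1, mul_one]

end ChainBounds

section ProductWeight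

open Module

theorem Submodule.exists_subset_sup_span_image_eq {F E ι : Type*} [Field F] [AddCommGroup E]
    [Module F E] [Module.Finite F E] [DecidableEq ι] (V : Submodule F E) (e : ι → E)
    (T : Finset ι) :
    ∃ J ⊆ T, V ⊔ Submodule.span F (e '' J) = V ⊔ Submodule.span F (e '' T) ∧
      finrank F V + J.card = finrank F ↥(V ⊔ Submodule.span F (e '' J)) := by
  induction T using Finset.induction_on with
  | empty =>
    exact ⟨∅, le_rfl, rfl, by
      rw [Finset.coe_empty, Set.image_empty, Submodule.span_empty, sup_bot_eq]; simp⟩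
  | insert i T _ ih =>
    obtain ⟨J, hJT, hJ, hc⟩ := ih
    have hins : ∀ S : Finset ι, V ⊔ Submodule.span F (e '' ↑(insert i S)) =
        (V ⊔ Submodule.span F (e '' S)) ⊔ Submodule.span F {e i} := by
      intro S
      rw [Finset.coe_insert, Set.image_insert_eq, Submodule.span_insert, sup_assoc,
        sup_comm (Submodule.span F {e i})]
    by_cases hi : e i ∈ V ⊔ Submodule.span F (e '' J)
    · refine ⟨J, hJT.trans (Finset.subset_insert _ _), ?_, hc⟩
      rw [hins, ← hJ]
      exact (sup_eq_left.2 (by simpa using hi)).symm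
    · have hiJ : i ∉ J := fun h => hi (Submodule.mem_sup_right
        (Submodule.subset_span (Set.mem_image_of_mem e h)))
      refine ⟨insert i J, Finset.insert_subset_insert _ hJT, ?_, ?_⟩
      · rw [hins, hins, hJ]
      · rw [hins, Submodule.finrank_sup_span_singleton hi, ← hc, Finset.card_insert_of_notMem hiJ,
          add_assoc]

variable {F : Type*} [Field F] [Fintype F] {n : ℕ}

theorem sum_prod_apply_eq_one {ι F : Type*} [Fintype ι] [DecidableEq ι] [Fintype F] {q : F → ℝ}
    (hq1 : ∑ t, q t = 1) : ∑ x : ι → F, ∏ i, q (x i) = 1 := by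
  have := (Finset.prod_univ_sum (fun _ : ι => (Finset.univ : Finset F)) fun _ t => q t).symm
  simpa [hq1, Fintype.piFinset_univ] using this

theorem mass_prod_le {q : F → ℝ} (hq : ∀ t, 0 ≤ q t) (hq1 : ∑ t, q t = 1) {ρ : ℝ}
    (hρ : ∀ t, q t ≤ ρ) (V : Submodule F (Fin n → F)) :
    mass (fun x => ∏ i, q (x i)) V ≤ ρ ^ (n - finrank F V) := by
  classical
  obtain ⟨J, -, hJ, hc⟩ := V.exists_subset_sup_span_image_eq
    (fun i : Fin n => (Pi.single i 1 : Fin n → F)) Finset.univ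
  have hspan : V ⊔ Submodule.span F ((fun i : Fin n => (Pi.single i 1 : Fin n → F)) '' J) = ⊤ := by
    rw [hJ, Finset.coe_univ, Set.image_univ]
    have := (Pi.basisFun F (Fin n)).span_eq
    rw [eq_top_iff, ← this]
    refine le_sup_right.trans' (le_of_eq ?_)
    congr 2
    ext; simp
  rw [hspan, finrank_top, finrank_fin_fun] at hc
  have hdisj : V ⊓ Submodule.span F
      ((fun i : Fin n => (Pi.single i 1 : Fin n → F)) '' J) = ⊥ := by
    have h1 := Submodule.finrank_sup_add_finrank_inf_eq V
      (Submodule.span F ((fun i : Fin n => (Pi.single i 1 : Fin n → F)) '' J))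
    have h2 : finrank F (Submodule.span F
        ((fun i : Fin n => (Pi.single i 1 : Fin n → F)) '' J)) ≤ J.card := by
      rw [← Finset.coe_image]
      exact (finrank_span_finset_le_card _).trans Finset.card_image_le
    rw [hspan, finrank_top, finrank_fin_fun] at h1
    exact Submodule.finrank_eq_zero.1 (by omega)
  have hcard : n - finrank F V = J.card := by omega
  rw [hcard]
  set res : (Fin n → F) → ({i // i ∉ J} → F) := fun x i => x i with hres
  have hinj : Set.InjOn res ((Finset.univ.filter (· ∈ V) : Finset (Fin n → F)) : Set _) := by
    intro x hx y hy hxy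
    simp only [Finset.coe_filter, Finset.mem_univ, true_and, Set.mem_ofPred_eq] at hx hy
    have hmem : x - y ∈ V ⊓ Submodule.span F
        ((fun i : Fin n => (Pi.single i 1 : Fin n → F)) '' J) := by
      refine ⟨V.sub_mem hx hy, ?_⟩
      rw [pi_eq_sum_univ' (x - y)]
      refine Submodule.sum_mem _ fun i _ => ?_
      by_cases hi : i ∈ J
      · refine Submodule.smul_mem _ _ (Submodule.subset_span ⟨i, hi, ?_⟩)
        ext j; simp [Pi.single_apply, eq_comm]
      · have : x i = y i := congr_fun hxy ⟨i, hi⟩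
        simp [this]
    rw [hdisj, Submodule.mem_bot] at hmem
    exact sub_eq_zero.1 hmem
  have hρ0 : 0 ≤ ρ := (hq 0).trans (hρ 0)
  calc mass (fun x => ∏ i, q (x i)) V
      = ∑ x : Fin n → F with x ∈ V, ∏ i, q (x i) := by rw [mass, Finset.sum_filter]
    _ ≤ ∑ x : Fin n → F with x ∈ V, ρ ^ J.card * ∏ i, q (res x i) := by
        refine Finset.sum_le_sum fun x _ => ?_
        rw [← Fintype.prod_subtype_mul_prod_subtype (fun i => i ∈ J)]
        refine mul_le_mul_of_nonneg_right ?_ (Finset.prod_nonneg fun i _ => hq _)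
        refine (Finset.prod_le_prod (fun i _ => hq _) fun i _ => hρ _).trans_eq ?_
        simp
    _ = ρ ^ J.card * ∑ y ∈ (Finset.univ.filter (· ∈ V)).image res, ∏ i, q (y i) := by
        rw [← Finset.mul_sum, Finset.sum_image hinj]
    _ ≤ ρ ^ J.card * ∑ y : {i // i ∉ J} → F, ∏ i, q (y i) := by
        refine mul_le_mul_of_nonneg_left ?_ (pow_nonneg hρ0 _)
        exact Finset.sum_le_sum_of_subset_of_nonneg (Finset.subset_univ _)
          fun y _ _ => Finset.prod_nonneg fun i _ => hq _
    _ = ρ ^ J.card := by rw [sum_prod_apply_eq_one hq1, mul_one]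

end ProductWeight

section ExpSums

theorem sum_exp_layers_le (y : ℝ) (J : ℕ) :
    (y ≤ J → ∑ j ∈ Finset.range J,
      (if y ≤ j then Real.exp (-j) - Real.exp (-(j + 1)) else 0)
        ≤ Real.exp (-y) - Real.exp (-J)) ∧
    (J < y → ∑ j ∈ Finset.range J,
      (if y ≤ j then Real.exp (-j) - Real.exp (-(j + 1)) else 0) = 0) := by
  induction J with
  | zero =>
    refine ⟨fun h => ?_, fun _ => by simp⟩
    have : Real.exp (-((0 : ℕ) : ℝ)) ≤ Real.exp (-y) := Real.exp_le_exp.2 (by linarith)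
    simpa using this
  | succ J ih =>
    rw [Finset.sum_range_succ, Nat.cast_add, Nat.cast_one]
    refine ⟨fun h => ?_, fun h => ?_⟩
    · rcases le_or_gt y J with hy | hy
      · have := ih.1 hy
        rw [if_pos hy]
        linarith
      · rw [ih.2 hy, if_neg hy.not_ge]
        have : Real.exp (-(J + 1 : ℝ)) ≤ Real.exp (-y) := Real.exp_le_exp.2 (by linarith)
        linarith
    · rw [ih.2 (by linarith), if_neg (by linarith), add_zero]

theorem sum_exp_layers_le_exp (y : ℝ) (J : ℕ) :
    ∑ j ∈ Finset.range J, (if y ≤ j then Real.exp (-j) - Real.exp (-(j + 1)) else 0)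
      ≤ Real.exp (-y) := by
  rcases le_or_gt y J with h | h
  · linarith [(sum_exp_layers_le y J).1 h, Real.exp_pos (-(J : ℝ))]
  · rw [(sum_exp_layers_le y J).2 h]
    positivity

theorem exp_sub_exp_succ_nonneg (j : ℝ) : 0 ≤ Real.exp (-j) - Real.exp (-(j + 1)) :=
  sub_nonneg.2 (Real.exp_le_exp.2 (by linarith))

theorem exp_le_sum_exp_layers {y : ℝ} (hy : 0 ≤ y) (J : ℕ) :
    Real.exp (-y) ≤ Real.exp 1 * Real.exp (-J) + Real.exp 1 * ∑ j ∈ Finset.range J,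
      (if y ≤ j then Real.exp (-j) - Real.exp (-(j + 1)) else 0) := by
  induction J with
  | zero =>
    have : Real.exp (-y) ≤ Real.exp 1 := Real.exp_le_exp.2 (by linarith)
    simpa using this
  | succ J ih =>
    rw [Finset.sum_range_succ, Nat.cast_add, Nat.cast_one]
    split_ifs with h
    · linarith
    · have h1 : Real.exp (-y) ≤ Real.exp 1 * Real.exp (-(J + 1 : ℝ)) := by
        rw [← Real.exp_add]; exact Real.exp_le_exp.2 (by linarith)
      have h2 : 0 ≤ ∑ j ∈ Finset.range J,
          (if y ≤ j then Real.exp (-j) - Real.exp (-(j + 1)) else 0) :=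
        Finset.sum_nonneg fun j _ => by
          split_ifs; exacts [exp_sub_exp_succ_nonneg _, le_rfl]
      have := mul_nonneg (Real.exp_pos 1).le h2
      linarith

open Finset Pointwise in
theorem two_mul_card_level_le {p : ℕ} [Fact p.Prime] {S : ZMod p → ℝ} (hS0 : S 0 = 0)
    (hS2 : ∀ a b, S (a + b) ≤ 2 * S a + 2 * S b) {D : ℝ} (hD : ∑ a, S a = p * D) {t : ℝ}
    (ht0 : 0 ≤ t) (ht : 4 * t < D) :
    2 * #{a | a ≠ 0 ∧ S a ≤ t} ≤ #{a | a ≠ 0 ∧ S a ≤ 4 * t} := by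
  classical
  have hcard : ∀ u : ℝ, 0 ≤ u → #{a | S a ≤ u} = #{a | a ≠ 0 ∧ S a ≤ u} + 1 := by
    intro u hu
    have : ({a | a ≠ 0 ∧ S a ≤ u} : Finset (ZMod p)) = ({a | S a ≤ u} : Finset _).erase 0 := by
      ext a; simp
    rw [this, card_erase_add_one]
    simpa [hS0] using hu
  have hne : ({a | S a ≤ t} : Finset (ZMod p)).Nonempty := ⟨0, by simpa [hS0] using ht0⟩
  have h1 := ZMod.cauchy_davenport Fact.out hne hne
  have h2 : ({a | S a ≤ t} : Finset (ZMod p)) + ({a | S a ≤ t} : Finset (ZMod p)) ⊆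
      ({a | S a ≤ 4 * t} : Finset (ZMod p)) := by
    intro c hc
    obtain ⟨a, ha, b, hb, rfl⟩ := mem_add.1 hc
    simp only [mem_filter, mem_univ, true_and] at ha hb ⊢
    linarith [hS2 a b]
  have h3 := card_le_card h2
  have h4 : #{a | S a ≤ 4 * t} < p := by
    by_contra! h
    have h5 : ({a | S a ≤ 4 * t} : Finset (ZMod p)) = univ :=
      eq_univ_of_card _ (le_antisymm (card_le_univ _) (by rwa [ZMod.card]))
    have h6 : ∑ a, S a ≤ ∑ _a : ZMod p, 4 * t := sum_le_sum fun a _ => by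
      have : a ∈ ({a | S a ≤ 4 * t} : Finset (ZMod p)) := by
        rw [h5]; exact mem_univ a
      simpa using this
    rw [hD, sum_const, card_univ, ZMod.card, nsmul_eq_mul] at h6
    have hp : (0 : ℝ) < p := by exact_mod_cast (Fact.out : p.Prime).pos
    have := le_of_mul_le_mul_left h6 hp
    linarith
  have h7 := hcard t ht0
  have h8 := hcard (4 * t) (by linarith)
  omega

open Finset in
theorem two_pow_mul_card_level_le {p : ℕ} [Fact p.Prime] {S : ZMod p → ℝ} (hS0 : S 0 = 0)
    (hS2 : ∀ a b, S (a + b) ≤ 2 * S a + 2 * S b) {D : ℝ} (hD : ∑ a, S a = p * D) (r : ℕ) {t : ℝ}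
    (ht0 : 0 ≤ t) (ht : 4 ^ r * t < D) :
    2 ^ r * #{a | a ≠ 0 ∧ S a ≤ t} ≤ #{a | a ≠ 0 ∧ S a ≤ 4 ^ r * t} := by
  induction r with
  | zero => simp
  | succ r ih =>
    have h4 : (4 : ℝ) ^ (r + 1) * t = 4 * (4 ^ r * t) := by ring
    have hpos : 0 ≤ 4 ^ r * t := by positivity
    rw [h4] at ht ⊢
    have h1 := ih (by linarith)
    have h2 := two_mul_card_level_le hS0 hS2 hD hpos ht
    rw [pow_succ]
    linarith

open Finset in
theorem sum_exp_neg_le {p : ℕ} [Fact p.Prime] {S : ZMod p → ℝ} (hS : ∀ a, 0 ≤ S a) (hS0 : S 0 = 0)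
    (hS2 : ∀ a b, S (a + b) ≤ 2 * S a + 2 * S b) {D : ℝ} (hD : ∑ a, S a = p * D) (r J : ℕ)
    (hJ : 4 ^ r * J < D) :
    ∑ a : ZMod p with a ≠ 0, Real.exp (-S a) ≤
      3 / 2 ^ r * ∑ a : ZMod p with a ≠ 0, Real.exp (-(S a / 4 ^ r))
        + 3 * (p - 1) * Real.exp (-J) := by
  classical
  set d : ℕ → ℝ := fun j => Real.exp (-j) - Real.exp (-(j + 1)) with hd
  have hd0 : ∀ j, 0 ≤ d j := fun j => exp_sub_exp_succ_nonneg _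
  have he : Real.exp 1 ≤ 3 := Real.exp_one_lt_d9.le.trans (by norm_num)
  have hcount : (#{a : ZMod p | a ≠ 0} : ℝ) = p - 1 := by
    rw [filter_ne', card_erase_of_mem (mem_univ _), card_univ, ZMod.card,
      Nat.cast_sub (Fact.out : p.Prime).one_le, Nat.cast_one]
  have hlayer : ∀ u : ℕ → ℝ, ∑ a : ZMod p with a ≠ 0, ∑ j ∈ range J, (if S a ≤ u j then d j else 0)
      = ∑ j ∈ range J, d j * #{a | a ≠ 0 ∧ S a ≤ u j} := by
    intro u
    rw [sum_comm]
    refine sum_congr rfl fun j _ => ?_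
    rw [← sum_filter, filter_filter, sum_const, nsmul_eq_mul, mul_comm]
  have h2r : (0 : ℝ) < 2 ^ r := by positivity
  have h4r : (0 : ℝ) < 4 ^ r := by positivity
  have hmain : ∑ j ∈ range J, d j * #{a | a ≠ 0 ∧ S a ≤ j} ≤
      1 / 2 ^ r * ∑ a : ZMod p with a ≠ 0, Real.exp (-(S a / 4 ^ r)) := by
    calc ∑ j ∈ range J, d j * #{a | a ≠ 0 ∧ S a ≤ j}
        ≤ ∑ j ∈ range J, 1 / 2 ^ r * (d j * #{a | a ≠ 0 ∧ S a ≤ 4 ^ r * j}) := by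
          refine sum_le_sum fun j hj => ?_
          have hjJ : (j : ℝ) ≤ J := by exact_mod_cast (mem_range.1 hj).le
          have h := two_pow_mul_card_level_le hS0 hS2 hD r (t := j) (by positivity)
            (lt_of_le_of_lt (by gcongr) hJ)
          have h' : (2 : ℝ) ^ r * #{a | a ≠ 0 ∧ S a ≤ j} ≤ #{a | a ≠ 0 ∧ S a ≤ 4 ^ r * j} := by
            exact_mod_cast h
          rw [mul_left_comm]
          refine mul_le_mul_of_nonneg_left ?_ (hd0 j)
          rw [one_div, ← div_eq_inv_mul, le_div_iff₀ h2r]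
          linarith
      _ = 1 / 2 ^ r * ∑ a : ZMod p with a ≠ 0, ∑ j ∈ range J,
            (if S a / 4 ^ r ≤ j then d j else 0) := by
          rw [← mul_sum, ← hlayer]
          simp only [div_le_iff₀' h4r]
      _ ≤ _ := by
          gcongr with a
          exact sum_exp_layers_le_exp _ _
  calc ∑ a : ZMod p with a ≠ 0, Real.exp (-S a)
      ≤ ∑ a : ZMod p with a ≠ 0, (Real.exp 1 * Real.exp (-J) +
          Real.exp 1 * ∑ j ∈ range J, (if S a ≤ j then d j else 0)) :=
        sum_le_sum fun a _ => exp_le_sum_exp_layers (hS a) J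
    _ = Real.exp 1 * ((p - 1) * Real.exp (-J)) +
          Real.exp 1 * ∑ j ∈ range J, d j * #{a | a ≠ 0 ∧ S a ≤ j} := by
        rw [sum_add_distrib, ← mul_sum, ← mul_sum, hlayer (fun j => (j : ℝ)), sum_const,
          nsmul_eq_mul, hcount]
    _ ≤ 3 * ((p - 1) * Real.exp (-J)) +
          3 * (1 / 2 ^ r * ∑ a : ZMod p with a ≠ 0, Real.exp (-(S a / 4 ^ r))) := by
        have h1 : (0 : ℝ) ≤ p - 1 := by
          have : (1 : ℝ) ≤ p := by exact_mod_cast (Fact.out : p.Prime).one_le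
          linarith
        have h2 : 0 ≤ ∑ j ∈ range J, d j * #{a | a ≠ 0 ∧ S a ≤ j} :=
          sum_nonneg fun j _ => mul_nonneg (hd0 j) (by positivity)
        gcongr
    _ = _ := by ring

end ExpSums

section CosChar

variable {p : ℕ} [Fact p.Prime] {n : ℕ}

/-- The function `a ↦ cos (2 π a / p)` on `ZMod p`. -/
noncomputable def cosChar (a : ZMod p) : ℝ := (ZMod.stdAddChar a).re

/-- The function `a ↦ sin (π a / p) ^ 2` on `ZMod p`. -/
noncomputable def sinSq (a : ZMod p) : ℝ := (1 - cosChar a) / 2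

theorem norm_stdAddChar (a : ZMod p) : ‖ZMod.stdAddChar a‖ = 1 := by
  rw [ZMod.stdAddChar_apply, Circle.norm_coe]

theorem four_mul_sinSq (a : ZMod p) : 4 * sinSq a = ‖1 - ZMod.stdAddChar a‖ ^ 2 := by
  have h := norm_stdAddChar a
  have h1 : (ZMod.stdAddChar a).re ^ 2 + (ZMod.stdAddChar a).im ^ 2 = 1 := by
    have := Complex.sq_norm (ZMod.stdAddChar a)
    rw [h, Complex.normSq_apply] at this
    linarith
  rw [Complex.sq_norm, Complex.normSq_apply, sinSq, cosChar]
  simp only [Complex.sub_re, Complex.one_re, Complex.sub_im, Complex.one_im]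
  linarith

theorem sinSq_nonneg (a : ZMod p) : 0 ≤ sinSq a := by
  have := four_mul_sinSq a
  have := sq_nonneg ‖1 - ZMod.stdAddChar a‖
  linarith

theorem sinSq_zero : sinSq (0 : ZMod p) = 0 := by simp [sinSq, cosChar]

theorem sinSq_le_one (a : ZMod p) : sinSq a ≤ 1 := by
  have := (abs_le.1 ((Complex.abs_re_le_norm _).trans (norm_stdAddChar a).le)).1
  rw [sinSq, cosChar]
  linarith

theorem sinSq_add_le (a b : ZMod p) : sinSq (a + b) ≤ 2 * sinSq a + 2 * sinSq b := by
  have h : ‖1 - ZMod.stdAddChar (a + b)‖ ≤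
      ‖1 - ZMod.stdAddChar a‖ + ‖1 - ZMod.stdAddChar b‖ := by
    have : 1 - ZMod.stdAddChar (a + b) =
        (1 - ZMod.stdAddChar a) + ZMod.stdAddChar a * (1 - ZMod.stdAddChar b) := by
      rw [AddChar.map_add_eq_mul]; ring
    rw [this]
    refine (norm_add_le _ _).trans ?_
    rw [norm_mul, norm_stdAddChar, one_mul]
  have h1 := four_mul_sinSq a
  have h2 := four_mul_sinSq b
  have h3 := four_mul_sinSq (a + b)
  have h4 := pow_le_pow_left₀ (norm_nonneg _) h 2
  nlinarith [sq_nonneg (‖1 - ZMod.stdAddChar a‖ - ‖1 - ZMod.stdAddChar b‖)]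

theorem sum_sinSq_mul {b : ZMod p} (hb : b ≠ 0) : ∑ a : ZMod p, sinSq (a * b) = p / 2 := by
  have h := AddChar.sum_mulShift b (ZMod.isPrimitive_stdAddChar p)
  rw [if_neg hb] at h
  have h1 : ∑ a : ZMod p, cosChar (a * b) = 0 := by
    have := congr_arg Complex.re h
    simpa [cosChar] using this
  simp only [sinSq, ← Finset.sum_div, Finset.sum_sub_distrib, h1]
  simp

/-- The characteristic function of a vector with independent lazy sign entries. -/
noncomputable def charProd (ν : ℝ) (w : Fin n → ZMod p) : ℝ := ∏ i, (1 - ν + ν * cosChar (w i))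

open Finset in
theorem sum_charProd_smul_le (w : Fin n → ZMod p) (r J : ℕ)
    (hJ : 2 * 4 ^ r * J < #{i | w i ≠ 0}) :
    ∑ a : ZMod p with a ≠ 0, charProd (1 / 2) (a • w) ≤
      3 / 2 ^ r * ∑ a : ZMod p with a ≠ 0, charProd (1 / 4 ^ (r + 1)) (a • w)
        + 3 * (p - 1) * Real.exp (-J) := by
  set S : ZMod p → ℝ := fun a => ∑ i, sinSq (a * w i) with hS
  have hJ' : (4 : ℝ) ^ r * J < #{i | w i ≠ 0} / 2 := by
    have : (2 * 4 ^ r * J : ℝ) < #{i | w i ≠ 0} := by exact_mod_cast hJ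
    linarith
  have hsum : ∑ a, S a = p * (#{i | w i ≠ 0} / 2) := by
    simp only [hS]
    rw [sum_comm]
    have : ∀ i, ∑ a : ZMod p, sinSq (a * w i) = if w i ≠ 0 then (p / 2 : ℝ) else 0 := by
      intro i
      split_ifs with h
      · exact sum_sinSq_mul h
      · rw [not_not] at h
        simp [h, sinSq_zero]
    simp only [this]
    rw [← sum_filter, sum_const, nsmul_eq_mul]
    ring
  have hmain := sum_exp_neg_le (S := S) (fun a => sum_nonneg fun i _ => sinSq_nonneg _)
    (by simp [hS, sinSq_zero])
    (fun a b => by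
      simp only [hS, mul_sum, ← sum_add_distrib, add_mul]
      exact sum_le_sum fun i _ => sinSq_add_le _ _) hsum r J hJ'
  have hup : ∀ a, charProd (1 / 2) (a • w) ≤ Real.exp (-S a) := by
    intro a
    rw [charProd, hS, ← sum_neg_distrib, Real.exp_sum]
    refine prod_le_prod (fun i _ => ?_) fun i _ => ?_
    · have := sinSq_le_one (a * w i)
      simp only [sinSq] at this
      simp only [Pi.smul_apply, smul_eq_mul]
      linarith
    · have := Real.add_one_le_exp (-sinSq (a * w i))
      simp only [Pi.smul_apply, smul_eq_mul]
      refine le_trans (le_of_eq ?_) this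
      rw [sinSq]; ring
  have hlow : ∀ a, Real.exp (-(S a / 4 ^ r)) ≤ charProd (1 / 4 ^ (r + 1)) (a • w) := by
    intro a
    rw [charProd, hS, sum_div, ← sum_neg_distrib, Real.exp_sum]
    refine prod_le_prod (fun i _ => (Real.exp_pos _).le) fun i _ => ?_
    simp only [Pi.smul_apply, smul_eq_mul]
    set y := sinSq (a * w i) / (2 * 4 ^ r) with hy
    have h4 : (1 : ℝ) ≤ 4 ^ r := one_le_pow₀ (by norm_num)
    have hy0 : 0 ≤ y := div_nonneg (sinSq_nonneg _) (by positivity)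
    have hy1 : y ≤ 1 / 2 := by
      rw [hy, div_le_iff₀ (by positivity)]
      linarith [sinSq_le_one (a * w i)]
    have h1 : sinSq (a * w i) / 4 ^ r = 2 * y := by rw [hy]; field_simp
    have h2 : 1 - 1 / 4 ^ (r + 1) + 1 / 4 ^ (r + 1) * cosChar (a * w i) = 1 - y := by
      rw [hy, sinSq, pow_succ]; field_simp; ring
    rw [h1, h2, Real.exp_neg, inv_le_comm₀ (Real.exp_pos _) (by linarith)]
    refine le_trans ?_ (Real.add_one_le_exp (2 * y))
    rw [inv_le_iff_one_le_mul₀ (by linarith)]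
    nlinarith
  calc _ ≤ ∑ a : ZMod p with a ≠ 0, Real.exp (-S a) := sum_le_sum fun a _ => hup a
    _ ≤ _ := hmain
    _ ≤ _ := by
      gcongr with a
      exact hlow a

end CosChar

section Perp

variable {F : Type*} [Field F] {n : ℕ}

/-- The orthogonal complement of a subspace of `Fⁿ` for the dot product. -/
def perp (V : Submodule F (Fin n → F)) : Submodule F (Fin n → F) :=
  V.dualAnnihilator.map (dotProductEquiv F (Fin n)).symm.toLinearMap

theorem mem_perp {V : Submodule F (Fin n → F)} {w : Fin n → F} :
    w ∈ perp V ↔ ∀ x ∈ V, w ⬝ᵥ x = 0 := by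
  rw [perp, Submodule.mem_map_equiv, Submodule.mem_dualAnnihilator]
  rfl

theorem finrank_perp (V : Submodule F (Fin n → F)) :
    Module.finrank F (perp V) = n - Module.finrank F V := by
  have h := Subspace.finrank_add_finrank_dualAnnihilator_eq V
  rw [Module.finrank_fin_fun] at h
  rw [perp, LinearEquiv.finrank_map_eq]
  omega

theorem exists_mem_perp_dotProduct_ne_zero {V : Submodule F (Fin n → F)} {x : Fin n → F}
    (hx : x ∉ V) : ∃ w ∈ perp V, w ⬝ᵥ x ≠ 0 := by
  by_contra! h
  refine hx ((Subspace.forall_mem_dualAnnihilator_apply_eq_zero_iff V x).1 fun φ hφ => ?_)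
  have := h ((dotProductEquiv F (Fin n)).symm φ) (Submodule.mem_map_of_mem hφ)
  rw [← dotProductEquiv_apply_apply, LinearEquiv.apply_symm_apply] at this
  exact this

end Perp

section Fourier

variable {p : ℕ} [Fact p.Prime] {n : ℕ}

/-- The law of a random sign modulo `p` that is nonzero with probability `ν`. -/
noncomputable def lazyWeight (ν : ℝ) (t : ZMod p) : ℝ :=
  (if t = 0 then 1 - ν else 0) + (if t = 1 then ν / 2 else 0) + (if t = -1 then ν / 2 else 0)

theorem lazyWeight_nonneg {ν : ℝ} (h0 : 0 ≤ ν) (h1 : ν ≤ 1) (t : ZMod p) : 0 ≤ lazyWeight ν t := by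
  unfold lazyWeight
  split_ifs <;> linarith

theorem lazyWeight_le {ν : ℝ} (h1 : ν ≤ 1 / 2) (t : ZMod p) :
    lazyWeight ν t ≤ 1 - ν := by
  have h : (1 : ZMod p) ≠ 0 := one_ne_zero
  unfold lazyWeight
  rcases eq_or_ne t 0 with rfl | ht
  · simp [h.symm]
  · rw [if_neg ht]
    split_ifs <;> linarith

theorem sum_lazyWeight_mul (ν : ℝ) (f : ZMod p → ℂ) :
    ∑ t : ZMod p, (lazyWeight ν t : ℂ) * f t = (1 - ν) * f 0 + ν / 2 * f 1 + ν / 2 * f (-1) := by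
  have : ∀ t : ZMod p, (lazyWeight ν t : ℂ) * f t = (if t = 0 then (1 - ν : ℂ) * f t else 0) +
      (if t = 1 then (ν / 2 : ℂ) * f t else 0) + (if t = -1 then (ν / 2 : ℂ) * f t else 0) := by
    intro t
    unfold lazyWeight
    push_cast
    split_ifs <;> push_cast <;> ring
  simp only [this, Finset.sum_add_distrib, Finset.sum_ite_eq', Finset.mem_univ, if_true]

theorem sum_lazyWeight (ν : ℝ) : ∑ t : ZMod p, lazyWeight ν t = 1 := by
  have h := sum_lazyWeight_mul (p := p) ν fun _ => 1
  have : ((∑ t : ZMod p, lazyWeight ν t : ℝ) : ℂ) = 1 := by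
    push_cast
    simp only [mul_one] at h
    rw [h]; ring
  exact_mod_cast this

theorem sum_lazyWeight_mul_stdAddChar (ν : ℝ) (a : ZMod p) :
    ∑ t : ZMod p, (lazyWeight ν t : ℂ) * ZMod.stdAddChar (a * t) =
      (1 - ν + ν * cosChar a : ℝ) := by
  rw [sum_lazyWeight_mul]
  have h : ZMod.stdAddChar (-a) = starRingEnd ℂ (ZMod.stdAddChar a) := AddChar.map_neg_eq_conj _ _
  have h2 := Complex.add_conj (ZMod.stdAddChar a)
  simp only [mul_zero, mul_one, mul_neg, AddChar.map_zero_eq_one, h]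
  rw [cosChar]
  push_cast
  push_cast at h2
  linear_combination (ν / 2 : ℂ) * h2

/-- The law of a random vector with independent lazy sign entries modulo `p`. -/
noncomputable def lazyVec (ν : ℝ) (x : Fin n → ZMod p) : ℝ := ∏ i, lazyWeight ν (x i)

theorem lazyVec_nonneg {ν : ℝ} (h0 : 0 ≤ ν) (h1 : ν ≤ 1) (x : Fin n → ZMod p) : 0 ≤ lazyVec ν x :=
  Finset.prod_nonneg fun _ _ => lazyWeight_nonneg h0 h1 _

theorem sum_lazyVec (ν : ℝ) : ∑ x : Fin n → ZMod p, lazyVec ν x = 1 :=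
  sum_prod_apply_eq_one (sum_lazyWeight ν)

theorem mass_lazyVec_le {ν : ℝ} (h0 : 0 ≤ ν) (h1 : ν ≤ 1 / 2)
    (V : Submodule (ZMod p) (Fin n → ZMod p)) :
    mass (lazyVec ν) V ≤ (1 - ν) ^ (n - Module.finrank (ZMod p) V) :=
  mass_prod_le (fun _ => lazyWeight_nonneg h0 (by linarith) _) (sum_lazyWeight ν)
    (lazyWeight_le h1) V

theorem sum_lazyVec_mul_stdAddChar (ν : ℝ) (w : Fin n → ZMod p) :
    ∑ x : Fin n → ZMod p, (lazyVec ν x : ℂ) * ZMod.stdAddChar (w ⬝ᵥ x) = (charProd ν w : ℝ) := by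
  have : ∀ x : Fin n → ZMod p, (lazyVec ν x : ℂ) * ZMod.stdAddChar (w ⬝ᵥ x) =
      ∏ i, ((lazyWeight ν (x i) : ℂ) * ZMod.stdAddChar (w i * x i)) := by
    intro x
    have h : ZMod.stdAddChar (w ⬝ᵥ x) = ∏ i, ZMod.stdAddChar (w i * x i) :=
      map_prod (ZMod.stdAddChar (N := p)).toMonoidHom
        (fun i => Multiplicative.ofAdd (w i * x i)) Finset.univ
    rw [lazyVec, h, Finset.prod_mul_distrib]
    push_cast
    rfl
  simp only [this]
  rw [← Fintype.prod_sum fun i t => (lazyWeight ν t : ℂ) * ZMod.stdAddChar (w i * t), charProd]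
  simp only [sum_lazyWeight_mul_stdAddChar]
  push_cast
  rfl

open Classical in
theorem sum_perp_stdAddChar (V : Submodule (ZMod p) (Fin n → ZMod p)) (x : Fin n → ZMod p) :
    ∑ w : perp V, ZMod.stdAddChar ((w : Fin n → ZMod p) ⬝ᵥ x) =
      if x ∈ V then (Fintype.card (perp V) : ℂ) else 0 := by
  let g : perp V →+ ZMod p :=
    { toFun := fun w => (w : Fin n → ZMod p) ⬝ᵥ x
      map_zero' := by simp
      map_add' := fun a b => by simp [add_dotProduct] }
  have hg := AddChar.sum_eq_ite ((ZMod.stdAddChar (N := p)).compAddMonoidHom g)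
  have hiff : (ZMod.stdAddChar (N := p)).compAddMonoidHom g = 0 ↔ x ∈ V := by
    constructor
    · intro h
      by_contra hx
      obtain ⟨w, hw, hwx⟩ := exists_mem_perp_dotProduct_ne_zero hx
      have h1 := DFunLike.congr_fun h ⟨w, hw⟩
      have h2 : ZMod.stdAddChar (w ⬝ᵥ x) = ZMod.stdAddChar (0 : ZMod p) := by
        rw [AddChar.map_zero_eq_one]; exact h1
      exact hwx (ZMod.injective_stdAddChar h2)
    · intro hx
      ext w
      have : g w = 0 := mem_perp.1 w.2 x hx
      simp [AddChar.compAddMonoidHom_apply, this]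
  simp only [hiff] at hg
  exact hg

open Classical in
theorem card_perp_mul_mass (ν : ℝ) (V : Submodule (ZMod p) (Fin n → ZMod p)) :
    Fintype.card (perp V) * mass (lazyVec ν) V = ∑ w : perp V, charProd ν (w : Fin n → ZMod p) := by
  have h : ((Fintype.card (perp V) * mass (lazyVec ν) V : ℝ) : ℂ) =
      ((∑ w : perp V, charProd ν (w : Fin n → ZMod p) : ℝ) : ℂ) := by
    push_cast
    simp only [← sum_lazyVec_mul_stdAddChar]
    rw [Finset.sum_comm]
    simp only [← Finset.mul_sum, sum_perp_stdAddChar, mass]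
    push_cast
    rw [Finset.mul_sum]
    refine Finset.sum_congr rfl fun x _ => ?_
    split_ifs <;> simp [mul_comm]
  exact_mod_cast h

theorem charProd_zero (ν : ℝ) : charProd ν (0 : Fin n → ZMod p) = 1 := by
  simp [charProd, cosChar]

open Classical in
theorem sum_sum_smul {V : Submodule (ZMod p) (Fin n → ZMod p)} (f : (Fin n → ZMod p) → ℝ) :
    ∑ w : V with w ≠ 0, ∑ a : ZMod p with a ≠ 0, f (a • (w : Fin n → ZMod p)) =
      (p - 1) * ∑ w : V with w ≠ 0, f w := by
  rw [Finset.sum_comm]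
  have hcount : (Finset.card {a : ZMod p | a ≠ 0} : ℝ) = p - 1 := by
    rw [Finset.filter_ne', Finset.card_erase_of_mem (Finset.mem_univ _), Finset.card_univ,
      ZMod.card, Nat.cast_sub (Fact.out : p.Prime).one_le, Nat.cast_one]
  rw [← hcount, ← nsmul_eq_mul, ← Finset.sum_const]
  refine Finset.sum_congr rfl fun a ha => ?_
  have ha0 : a ≠ 0 := (Finset.mem_filter.1 ha).2
  rw [Finset.sum_filter, Finset.sum_filter]
  rw [← Equiv.sum_comp (LinearEquiv.smulOfNeZero (ZMod p) V a ha0).toEquiv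
    fun w => if w ≠ 0 then f w else 0]
  refine Finset.sum_congr rfl fun w _ => ?_
  simp [ha0]

open Classical in
theorem mass_half_le (V : Submodule (ZMod p) (Fin n → ZMod p)) (r J : ℕ)
    (h : ∀ w ∈ perp V, w ≠ 0 → 2 * 4 ^ r * J < Finset.card {i | w i ≠ 0}) :
    mass (lazyVec (1 / 2)) V ≤ 1 / p ^ (n - Module.finrank (ZMod p) V) +
      3 / 2 ^ r * mass (lazyVec (1 / 4 ^ (r + 1))) V + 3 * Real.exp (-J) := by
  set N : ℝ := (Fintype.card (perp V) : ℝ) with hN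
  have hNp : N = p ^ (n - Module.finrank (ZMod p) V) := by
    rw [hN, ← Nat.card_eq_fintype_card, Module.natCard_eq_pow_finrank (K := ZMod p), finrank_perp]
    simp
  have hp1 : (1 : ℝ) < p := by exact_mod_cast (Fact.out : p.Prime).one_lt
  have hN0 : 0 < N := by rw [hNp]; positivity
  have hsplit : ∀ ν : ℝ, N * mass (lazyVec ν) V =
      1 + ∑ w : perp V with w ≠ 0, charProd ν (w : Fin n → ZMod p) := by
    intro ν
    rw [hN, card_perp_mul_mass, ← Finset.sum_filter_add_sum_filter_not _ (fun w => w = 0)]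
    congr 1
    rw [Finset.filter_eq' _ (0 : perp V), if_pos (Finset.mem_univ _), Finset.sum_singleton]
    exact charProd_zero ν
  have hcountN : (Finset.card {w : perp V | w ≠ 0} : ℝ) ≤ N := by
    rw [hN]
    exact_mod_cast Finset.card_le_univ _
  have hmain : (p - 1 : ℝ) * ∑ w : perp V with w ≠ 0, charProd (1 / 2) (w : Fin n → ZMod p) ≤
      (p - 1) * (3 / 2 ^ r * ∑ w : perp V with w ≠ 0,
        charProd (1 / 4 ^ (r + 1)) (w : Fin n → ZMod p) + 3 * Real.exp (-J) * N) := by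
    calc _ ≤ ∑ w : perp V with w ≠ 0, (3 / 2 ^ r * ∑ a : ZMod p with a ≠ 0,
            charProd (1 / 4 ^ (r + 1)) (a • (w : Fin n → ZMod p)) +
            3 * (p - 1) * Real.exp (-J)) := by
          rw [← sum_sum_smul]
          refine Finset.sum_le_sum fun w hw => ?_
          refine sum_charProd_smul_le _ r J (h _ w.2 ?_)
          simpa using (Finset.mem_filter.1 hw).2
      _ = (p - 1) * (3 / 2 ^ r * ∑ w : perp V with w ≠ 0,
            charProd (1 / 4 ^ (r + 1)) (w : Fin n → ZMod p)) +
            Finset.card {w : perp V | w ≠ 0} * (3 * (p - 1) * Real.exp (-J)) := by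
          rw [Finset.sum_add_distrib, ← Finset.mul_sum, sum_sum_smul, Finset.sum_const,
            nsmul_eq_mul]
          ring
      _ ≤ (p - 1) * (3 / 2 ^ r * ∑ w : perp V with w ≠ 0,
            charProd (1 / 4 ^ (r + 1)) (w : Fin n → ZMod p)) +
            N * (3 * (p - 1) * Real.exp (-J)) := by
          have : (0 : ℝ) ≤ 3 * (p - 1) * Real.exp (-J) := by
            have : (0 : ℝ) ≤ p - 1 := by linarith
            positivity
          gcongr
      _ = _ := by ring
  have hmain' := le_of_mul_le_mul_left hmain (by linarith)
  have hr0 : (0 : ℝ) ≤ 3 / 2 ^ r := by positivity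
  have h1 := hsplit (1 / 2)
  have h2 := hsplit (1 / 4 ^ (r + 1))
  have h3 : N * mass (lazyVec (1 / 2)) V ≤ N * (1 / N +
      3 / 2 ^ r * mass (lazyVec (1 / 4 ^ (r + 1))) V + 3 * Real.exp (-J)) := by
    have : N * (1 / N + 3 / 2 ^ r * mass (lazyVec (1 / 4 ^ (r + 1))) V + 3 * Real.exp (-J)) =
        1 + 3 / 2 ^ r * (N * mass (lazyVec (1 / 4 ^ (r + 1))) V) + 3 * Real.exp (-J) * N := by
      field_simp
    rw [this, h1, h2]
    linarith
  have h4 := le_of_mul_le_mul_left h3 hN0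
  rwa [hNp] at h4

end Fourier

section Chain

open Module

variable {p : ℕ} [Fact p.Prime] {n : ℕ}

theorem lazyVec_half_nonneg (x : Fin n → ZMod p) : 0 ≤ lazyVec (1 / 2) x :=
  lazyVec_nonneg (by norm_num) (by norm_num) x

theorem mass_lazyVec_half_le_half {V : Submodule (ZMod p) (Fin n → ZMod p)} (hV : V ≠ ⊤) :
    mass (lazyVec (1 / 2)) V ≤ 1 / 2 := by
  have h := Submodule.finrank_lt hV
  rw [finrank_fin_fun] at h
  refine (mass_lazyVec_le (by norm_num) (by norm_num) V).trans ?_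
  calc (1 - 1 / 2 : ℝ) ^ (n - finrank (ZMod p) V) ≤ (1 - 1 / 2) ^ 1 :=
        pow_le_pow_of_le_one (by norm_num) (by norm_num) (by omega)
    _ = 1 / 2 := by norm_num

theorem le_card_add_finrank_ker_funLeft {F : Type*} [Field F] (S : Finset (Fin n)) :
    n ≤ S.card + finrank F (LinearMap.ker (LinearMap.funLeft F F (Subtype.val : S → Fin n))) := by
  have h := (LinearMap.funLeft F F (Subtype.val : S → Fin n)).finrank_range_add_finrank_ker
  have h2 := Submodule.finrank_le (LinearMap.range (LinearMap.funLeft F F (Subtype.val : S → Fin n)))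
  rw [finrank_fin_fun] at h
  rw [finrank_fintype_fun_eq_card, Fintype.card_coe] at h2
  omega

theorem sum_three_pow_card_le (n s : ℕ) :
    ∑ S : Finset (Fin n) with S.card ≤ s, (3 : ℝ) ^ S.card ≤ 30 ^ s * (11 / 10) ^ n := by
  have h := Fin.sum_pow_mul_eq_add_pow (n := n) (1 / 10 : ℝ) 1
  simp only [one_pow, mul_one] at h
  rw [show (11 / 10 : ℝ) = 1 / 10 + 1 by norm_num, ← h, Finset.mul_sum, Finset.sum_filter]
  refine Finset.sum_le_sum fun S _ => ?_
  split_ifs with hS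
  · calc (3 : ℝ) ^ S.card = 30 ^ S.card * (1 / 10) ^ S.card := by rw [← mul_pow]; norm_num
      _ ≤ 30 ^ s * (1 / 10) ^ S.card := by gcongr; norm_num
  · positivity

/-- Sparse normal vectors are unlikely. -/
theorem spanStep_pow_sparse_le (s k : ℕ) (U₀ : Submodule (ZMod p) (Fin n → ZMod p)) :
    (spanStep (ZMod p) (lazyVec (1 / 2)) ^ k) (subInd fun U =>
      ∃ w ∈ perp U, w ≠ 0 ∧ Finset.card {i | w i ≠ 0} ≤ s) U₀ ≤
        30 ^ s * (11 / 10) ^ n * (2 / 3) ^ k := by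
  classical
  set A : Finset (Fin n) → Submodule (ZMod p) (Fin n → ZMod p) := fun S =>
    LinearMap.ker (LinearMap.funLeft (ZMod p) (ZMod p) (Subtype.val : S → Fin n))
  have hle : ∀ U : Submodule (ZMod p) (Fin n → ZMod p),
      subInd (fun U => ∃ w ∈ perp U, w ≠ 0 ∧ Finset.card {i | w i ≠ 0} ≤ s) U ≤
      (∑ S : Finset (Fin n) with S.card ≤ s, subInd (fun U => U ⊔ A S ≠ ⊤)) U := by
    intro U
    rw [Finset.sum_apply]
    by_cases h : ∃ w ∈ perp U, w ≠ 0 ∧ Finset.card {i | w i ≠ 0} ≤ s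
    · obtain ⟨w, hw, hw0, hws⟩ := h
      have hnt : U ⊔ A {i | w i ≠ 0} ≠ ⊤ := by
        intro htop
        refine hw0 (dotProduct_eq_zero w fun x => ?_)
        obtain ⟨u, hu, v, hv, rfl⟩ := Submodule.mem_sup.1 (htop ▸ Submodule.mem_top : x ∈ _)
        rw [dotProduct_add, mem_perp.1 hw u hu, zero_add]
        refine Finset.sum_eq_zero fun i _ => ?_
        by_cases hi : w i = 0
        · rw [hi, zero_mul]
        · have := congr_fun (LinearMap.mem_ker.1 hv) ⟨i, by simpa using hi⟩
          rw [LinearMap.funLeft_apply] at this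
          simp only [Pi.zero_apply] at this
          rw [this, mul_zero]
      calc subInd (fun U => ∃ w ∈ perp U, w ≠ 0 ∧ Finset.card {i | w i ≠ 0} ≤ s) U
          ≤ subInd (fun U => U ⊔ A {i | w i ≠ 0} ≠ ⊤) U := by
            unfold subInd
            rw [if_pos hnt]
            split_ifs <;> norm_num
        _ ≤ _ := Finset.single_le_sum
            (f := fun S : Finset (Fin n) => subInd (fun U => U ⊔ A S ≠ ⊤) U)
            (fun S _ => subInd_nonneg _ _) (by simpa using hws)
    · rw [subInd, if_neg h]
      exact Finset.sum_nonneg fun S _ => subInd_nonneg _ _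
  calc _ ≤ _ := spanStep_pow_mono lazyVec_half_nonneg k hle U₀
    _ = ∑ S : Finset (Fin n) with S.card ≤ s, (spanStep (ZMod p) (lazyVec (1 / 2)) ^ k)
          (subInd (fun U => U ⊔ A S ≠ ⊤)) U₀ := by
        rw [map_sum, Finset.sum_apply]
    _ ≤ ∑ S : Finset (Fin n) with S.card ≤ s, (2 / 3) ^ k * 3 ^ S.card := by
        refine Finset.sum_le_sum fun S _ => ?_
        refine (spanStep_pow_sup_ne_top_le lazyVec_half_nonneg (sum_lazyVec _)
          (fun V => mass_lazyVec_half_le_half) (A S) k U₀).trans ?_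
        have : n ≤ S.card + finrank (ZMod p) (A S) := le_card_add_finrank_ker_funLeft S
        rw [finrank_fin_fun]
        gcongr
        · norm_num
        · omega
    _ ≤ _ := by
        rw [← Finset.mul_sum, mul_comm]
        gcongr
        exact sum_three_pow_card_le n s

/-- Subspaces whose mass under the lazy law is comparable to the mass under a lazier law are
unlikely to be spanned. -/
theorem spanStep_pow_structured_le {ν κ θ : ℝ} (hν0 : 0 ≤ ν) (hν : ν ≤ 1 / 2) (hκ : 0 ≤ κ)
    (hθ : 0 < θ) {r m : ℕ} (hκθ : 2 * κ * (1 - ν) ^ (n - m) ≤ θ)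
    {U₀ : Submodule (ZMod p) (Fin n → ZMod p)} (hU₀ : finrank (ZMod p) U₀ = 1) :
    (spanStep (ZMod p) (lazyVec (1 / 2)) ^ (r + m)) (subInd fun V =>
      finrank (ZMod p) V = r + m + 1 ∧ θ ≤ mass (lazyVec (1 / 2)) V ∧
        mass (lazyVec (1 / 2)) V ≤ κ * mass (lazyVec ν) V) U₀ ≤ 2 ^ (r + m) * (2 * κ) ^ m := by
  have hb := lazyVec_nonneg (p := p) (n := n) hν0 (by linarith)
  refine spanStep_pow_subInd_le (b := lazyVec ν) (j := m) (r := r) lazyVec_half_nonneg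
    (sum_lazyVec _) hb (sum_lazyVec _) (by positivity) ?_
  rintro V ⟨hV, hf, hfg⟩ hUV
  set f := mass (lazyVec (1 / 2)) V
  set g := mass (lazyVec ν) V
  have hκ0 : 0 < κ := by
    rcases hκ.eq_or_lt with h | h
    · rw [← h, zero_mul] at hfg; linarith
    · exact h
  have hg : 0 < g := by
    by_contra! h
    nlinarith
  have hex := spanStep_pow_exchange (a := lazyVec (1 / 2)) (b := lazyVec ν) lazyVec_half_nonneg hb
    V r m (fun U hU hrk => by
      refine (mass_lazyVec_le hν0 hν U).trans ?_
      have h1 : (1 - ν) ^ (n - finrank (ZMod p) U) ≤ (1 - ν) ^ (n - m) :=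
        pow_le_pow_of_le_one (by linarith) (by linarith) (by omega)
      refine h1.trans (le_of_mul_le_mul_left ?_ (mul_pos two_pos hκ0))
      linarith) m U₀ hUV (by omega)
  have hR : 0 ≤ (spanStep (ZMod p) (lazyVec ν) ^ m)
      ((spanStep (ZMod p) (lazyVec (1 / 2)) ^ r) (subInd (· = V))) U₀ :=
    spanStep_pow_nonneg hb _ (fun U => spanStep_pow_nonneg lazyVec_half_nonneg _
      (subInd_nonneg _) U) U₀
  refine le_of_mul_le_mul_right (hex.trans ?_) (by positivity : 0 < (g / 2) ^ m)
  have hfm : f ^ m ≤ (2 * κ) ^ m * (g / 2) ^ m := by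
    rw [← mul_pow]
    exact pow_le_pow_left₀ (hθ.le.trans hf) (by linarith) m
  calc _ ≤ 2 ^ (r + m) * ((2 * κ) ^ m * (g / 2) ^ m) * _ := by gcongr
    _ = _ := by ring

end Chain

section Layer

open Module

variable {p : ℕ} [Fact p.Prime] {n : ℕ}

theorem spanStep_pow_layer_le_sum {s r J m k : ℕ} {ν : ℝ} (hν : ν = 1 / 4 ^ (r + 1)) (hm : m ≤ k)
    (hJ : 2 * 4 ^ r * J ≤ s) (hθ : 2 * (9 / 2 ^ r) * (1 - ν) ^ (n - m) ≤ 9 * Real.exp (-J))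
    {U₀ : Submodule (ZMod p) (Fin n → ZMod p)} (hU₀ : finrank (ZMod p) U₀ = 1) :
    (spanStep (ZMod p) (lazyVec (1 / 2)) ^ k) (fun U =>
      subInd (fun U => finrank (ZMod p) U = k + 1) U * mass (lazyVec (1 / 2)) U) U₀ ≤
      30 ^ s * (11 / 10) ^ n * (2 / 3) ^ k + 2 ^ k * (2 * (9 / 2 ^ r)) ^ m +
        (3 / p ^ (n - (k + 1)) + 9 * Real.exp (-J)) := by
  have h4r : (4 : ℝ) ≤ 4 ^ (r + 1) := by
    rw [pow_succ]; nlinarith [one_le_pow₀ (n := r) (show (1 : ℝ) ≤ 4 by norm_num)]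
  have hν0 : 0 ≤ ν := by rw [hν]; positivity
  have hν1 : ν ≤ 1 / 2 := by
    rw [hν]; exact one_div_le_one_div_of_le two_pos (by linarith)
  set P₁ : Submodule (ZMod p) (Fin n → ZMod p) → Prop := fun U =>
    ∃ w ∈ perp U, w ≠ 0 ∧ Finset.card {i | w i ≠ 0} ≤ s with hP₁
  set P₂ : Submodule (ZMod p) (Fin n → ZMod p) → Prop := fun V =>
    finrank (ZMod p) V = k + 1 ∧ 9 * Real.exp (-J) ≤ mass (lazyVec (1 / 2)) V ∧
      mass (lazyVec (1 / 2)) V ≤ 9 / 2 ^ r * mass (lazyVec ν) V with hP₂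
  set e : ℝ := 3 / p ^ (n - (k + 1)) + 9 * Real.exp (-J) with he
  have he0 : 0 ≤ e := by positivity
  have hpt : ∀ U : Submodule (ZMod p) (Fin n → ZMod p),
      subInd (fun U => finrank (ZMod p) U = k + 1) U * mass (lazyVec (1 / 2)) U ≤
        (subInd P₁ + subInd P₂ + fun _ => e : Submodule (ZMod p) (Fin n → ZMod p) → ℝ) U := by
    intro U
    have h1 := subInd_nonneg P₁ U
    have h2 := subInd_nonneg P₂ U
    have hle1 : mass (lazyVec (1 / 2)) U ≤ 1 := mass_le_one lazyVec_half_nonneg (sum_lazyVec _) U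
    simp only [Pi.add_apply]
    by_cases hU : finrank (ZMod p) U = k + 1
    swap
    · rw [subInd, if_neg hU, zero_mul]
      positivity
    rw [show subInd (fun U => finrank (ZMod p) U = k + 1) U = 1 from if_pos hU, one_mul]
    by_cases hs : P₁ U
    · rw [show subInd P₁ U = 1 from if_pos hs]
      linarith
    by_cases ht : P₂ U
    · rw [show subInd P₂ U = 1 from if_pos ht]
      linarith
    have hhalf := mass_half_le U r J fun w hw hw0 => by
      by_contra! hc
      exact hs ⟨w, hw, hw0, by convert hc.trans hJ⟩
    rw [hU, ← hν] at hhalf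
    have hexp := Real.exp_pos (-(J : ℝ))
    have hdiv : (3 : ℝ) / p ^ (n - (k + 1)) = 3 * (1 / p ^ (n - (k + 1))) := by ring
    have hdiv0 : (0 : ℝ) ≤ 1 / p ^ (n - (k + 1)) := by positivity
    have h9 : (9 : ℝ) / 2 ^ r = 3 * (3 / 2 ^ r) := by ring
    simp only [hP₂, hU, true_and, not_and, not_le, h9] at ht
    by_contra! hc
    have := ht (by linarith)
    linarith
  have h3 := spanStep_pow_structured_le (p := p) (n := n) (κ := 9 / 2 ^ r) (r := k - m) hν0 hν1
    (by positivity) (by positivity) hθ hU₀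
  rw [Nat.sub_add_cancel hm] at h3
  calc _ ≤ _ := spanStep_pow_mono lazyVec_half_nonneg k hpt U₀
    _ = (spanStep (ZMod p) (lazyVec (1 / 2)) ^ k) (subInd P₁) U₀ +
        (spanStep (ZMod p) (lazyVec (1 / 2)) ^ k) (subInd P₂) U₀ + e := by
      rw [map_add, map_add, Pi.add_apply, Pi.add_apply, spanStep_pow_const (sum_lazyVec _)]
    _ ≤ _ := by
      gcongr
      exact spanStep_pow_sparse_le s k U₀

/-- The exponential decay rate obtained for the probability of singularity. -/
noncomputable def decayRate : ℝ := 1 / (200 * 4 ^ 25)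

theorem thirty_pow_mul_le {s k : ℕ} (hs : 100 * s ≤ n) (hk : 9 * n ≤ 10 * (k + 1)) :
    (30 : ℝ) ^ s * (11 / 10) ^ n * (2 / 3) ^ k ≤ 2 * Real.exp (-(n / 10)) := by
  have h30 : (30 : ℝ) ≤ Real.exp 4 := by
    have h := Real.exp_one_gt_d9
    have h4 : Real.exp 4 = Real.exp 1 ^ 4 := by rw [← Real.exp_nat_mul]; norm_num
    rw [h4]
    calc (30 : ℝ) ≤ 2.7 ^ 4 := by norm_num
      _ ≤ _ := by gcongr; linarith
  have h11 : (11 / 10 : ℝ) ≤ Real.exp (1 / 10) := by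
    have := Real.add_one_le_exp (1 / 10 : ℝ); linarith
  have h23 : (2 / 3 : ℝ) ≤ Real.exp (-(1 / 3)) := by
    have := Real.add_one_le_exp (-(1 / 3) : ℝ); linarith
  have hs' : (100 * s : ℝ) ≤ n := by exact_mod_cast hs
  have hk' : (9 * n : ℝ) ≤ 10 * (k + 1) := by exact_mod_cast hk
  have hn0 : (0 : ℝ) ≤ n := by positivity
  calc (30 : ℝ) ^ s * (11 / 10) ^ n * (2 / 3) ^ k
      = 3 / 2 * (30 ^ s * (11 / 10) ^ n * (2 / 3) ^ (k + 1)) := by ring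
    _ ≤ 3 / 2 * (Real.exp 4 ^ s * Real.exp (1 / 10) ^ n * Real.exp (-(1 / 3)) ^ (k + 1)) := by
        gcongr
    _ = 3 / 2 * Real.exp (s * 4 + n * (1 / 10) + (k + 1 : ℕ) * -(1 / 3)) := by
        rw [Real.exp_add, Real.exp_add, Real.exp_nat_mul, Real.exp_nat_mul, Real.exp_nat_mul]
    _ ≤ 2 * Real.exp (-(n / 10)) := by
        gcongr
        · norm_num
        · push_cast; linarith

theorem two_pow_mul_small_pow_le {k m : ℕ} (hk : k ≤ n) (hm : n ≤ 10 * m + 9) :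
    (2 : ℝ) ^ k * (2 * (9 / 2 ^ 25)) ^ m ≤ 1536 * Real.exp (-(n / 10)) := by
  have hb : (2 : ℝ) ^ 10 * (2 * (9 / 2 ^ 25)) ≤ Real.exp (-1) := by
    have h := Real.exp_one_lt_d9
    rw [Real.exp_neg, le_inv_comm₀ (by norm_num) (Real.exp_pos 1)]
    refine h.le.trans (by norm_num)
  have hm' : (n : ℝ) ≤ 10 * m + 9 := by exact_mod_cast hm
  have he : Real.exp 1 ≤ 3 := Real.exp_one_lt_d9.le.trans (by norm_num)
  calc (2 : ℝ) ^ k * (2 * (9 / 2 ^ 25)) ^ m ≤ 2 ^ (9 + 10 * m) * (2 * (9 / 2 ^ 25)) ^ m := by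
        gcongr
        · norm_num
        · omega
    _ = 512 * (2 ^ 10 * (2 * (9 / 2 ^ 25))) ^ m := by
        rw [pow_add, pow_mul, mul_assoc, ← mul_pow]; norm_num
    _ ≤ 512 * Real.exp (-1) ^ m := by gcongr
    _ = 512 * Real.exp (m * -1) := by rw [Real.exp_nat_mul]
    _ ≤ 512 * Real.exp (1 + -(n / 10)) := by gcongr; linarith
    _ = 512 * (Real.exp 1 * Real.exp (-(n / 10))) := by rw [Real.exp_add]
    _ ≤ 512 * (3 * Real.exp (-(n / 10))) := by gcongr
    _ = _ := by ring

theorem spanStep_pow_layer_le {k : ℕ} (hk : k + 1 < n)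
    {U₀ : Submodule (ZMod p) (Fin n → ZMod p)} (hU₀ : finrank (ZMod p) U₀ = 1) :
    (spanStep (ZMod p) (lazyVec (1 / 2)) ^ k) (fun U =>
      subInd (fun U => finrank (ZMod p) U = k + 1) U * mass (lazyVec (1 / 2)) U) U₀ ≤
      3 / p ^ (n - (k + 1)) + 2000 * Real.exp (-decayRate * n) := by
  have hn0 : (0 : ℝ) ≤ n := by positivity
  have hc0 : 0 < decayRate := by unfold decayRate; positivity
  have hc1 : decayRate ≤ 1 / 20 := by unfold decayRate; norm_num
  have hc2 : decayRate * n ≤ 1 / 20 * n := by gcongr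
  rcases lt_or_ge n (10 * (n - (k + 1))) with hd | hd
  · have hd' : (n : ℝ) ≤ 10 * (n - (k + 1) : ℕ) := by exact_mod_cast hd.le
    have h12 : (1 / 2 : ℝ) ≤ Real.exp (-(1 / 2)) := by
      have := Real.add_one_le_exp (-(1 / 2) : ℝ); linarith
    have hpt : ∀ U : Submodule (ZMod p) (Fin n → ZMod p),
        subInd (fun U => finrank (ZMod p) U = k + 1) U * mass (lazyVec (1 / 2)) U ≤
          Real.exp (-decayRate * n) := by
      intro U
      by_cases hU : finrank (ZMod p) U = k + 1
      · rw [show subInd (fun U => finrank (ZMod p) U = k + 1) U = 1 from if_pos hU, one_mul]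
        refine (mass_lazyVec_le (by norm_num) le_rfl U).trans ?_
        rw [hU]
        calc (1 - 1 / 2 : ℝ) ^ (n - (k + 1)) = (1 / 2) ^ (n - (k + 1)) := by norm_num
          _ ≤ Real.exp (-(1 / 2)) ^ (n - (k + 1)) := by gcongr
          _ = Real.exp ((n - (k + 1) : ℕ) * -(1 / 2)) := by rw [Real.exp_nat_mul]
          _ ≤ _ := Real.exp_le_exp.2 (by linarith)
      · rw [subInd, if_neg hU, zero_mul]
        positivity
    refine (spanStep_pow_mono lazyVec_half_nonneg k hpt U₀).trans ?_
    rw [spanStep_pow_const (sum_lazyVec _)]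
    have : (0 : ℝ) ≤ 3 / p ^ (n - (k + 1)) := by positivity
    linarith [Real.exp_pos (-decayRate * n)]
  · set J : ℕ := n / (200 * 4 ^ 25) with hJ
    have hJ1 : J * (200 * 4 ^ 25) ≤ n := Nat.div_mul_le_self _ _
    have hJ2 : n < J * (200 * 4 ^ 25) + 200 * 4 ^ 25 := Nat.lt_div_mul_add (by positivity)
    have hJ1' : (J * (200 * 4 ^ 25) : ℝ) ≤ n := by exact_mod_cast hJ1
    have hJ2' : (n : ℝ) < J * (200 * 4 ^ 25) + 200 * 4 ^ 25 := by exact_mod_cast hJ2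
    have hJn : decayRate * n - 1 ≤ J := by
      unfold decayRate; norm_num at hJ2' ⊢; linarith
    have hθ : 2 * (9 / 2 ^ 25) * (1 - 1 / 4 ^ (25 + 1) : ℝ) ^ (n - n / 10) ≤
        9 * Real.exp (-J) := by
      have hnm : 9 * n ≤ 10 * (n - n / 10) := by omega
      have hnm' : (9 * n : ℝ) ≤ 10 * (n - n / 10 : ℕ) := by exact_mod_cast hnm
      have h1 : (1 - 1 / 4 ^ (25 + 1) : ℝ) ≤ Real.exp (-(1 / 4 ^ (25 + 1))) := by
        have := Real.add_one_le_exp (-(1 / 4 ^ (25 + 1)) : ℝ); linarith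
      calc 2 * (9 / 2 ^ 25) * (1 - 1 / 4 ^ (25 + 1) : ℝ) ^ (n - n / 10)
          ≤ 9 * Real.exp (-(1 / 4 ^ (25 + 1))) ^ (n - n / 10) := by
            gcongr
            norm_num
        _ = 9 * Real.exp ((n - n / 10 : ℕ) * -(1 / 4 ^ (25 + 1))) := by rw [Real.exp_nat_mul]
        _ ≤ 9 * Real.exp (-J) := by
            gcongr
            norm_num at hJ1' hnm' ⊢
            linarith
    have hmain := spanStep_pow_layer_le_sum (s := n / 100) (r := 25) (J := J) (m := n / 10) (k := k)
      rfl (by omega) (by omega) hθ hU₀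
    have h1 := thirty_pow_mul_le (n := n) (s := n / 100) (k := k) (by omega) (by omega)
    have h2 := two_pow_mul_small_pow_le (n := n) (k := k) (m := n / 10) (by omega) (by omega)
    have h3 : Real.exp (-(n / 10)) ≤ Real.exp (-decayRate * n) :=
      Real.exp_le_exp.2 (by linarith)
    have h4 : Real.exp (-J) ≤ 3 * Real.exp (-decayRate * n) := by
      have he : Real.exp 1 ≤ 3 := Real.exp_one_lt_d9.le.trans (by norm_num)
      calc Real.exp (-J) ≤ Real.exp (1 + -decayRate * n) := Real.exp_le_exp.2 (by linarith)
        _ = Real.exp 1 * Real.exp (-decayRate * n) := Real.exp_add _ _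
        _ ≤ _ := by gcongr
    linarith [Real.exp_pos (-decayRate * n)]

theorem sum_three_div_pow_le (p : ℕ) [hp : Fact p.Prime] (n : ℕ) :
    ∑ k ∈ Finset.range n, (3 : ℝ) / p ^ (n - k) ≤ 6 / p := by
  have hp' : (2 : ℝ) ≤ p := by exact_mod_cast hp.out.two_le
  have h : ∀ n : ℕ, ∑ k ∈ Finset.range n, (3 : ℝ) / p ^ (k + 1) ≤ 6 / p * (1 - 1 / 2 ^ n) := by
    intro n
    induction n with
    | zero => simp
    | succ n ih =>
      rw [Finset.sum_range_succ]
      have : (3 : ℝ) / p ^ (n + 1) ≤ 3 / p * (1 / 2 ^ n) := by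
        rw [pow_succ, div_mul_div_comm, mul_one, mul_comm (p : ℝ)]
        gcongr
      have h2 : (1 : ℝ) / 2 ^ n = 2 * (1 / 2 ^ (n + 1)) := by rw [pow_succ]; field_simp
      rw [h2] at ih this
      have h3 : 6 / (p : ℝ) = 2 * (3 / p) := by ring
      rw [h3] at ih ⊢
      linarith
  rw [← Finset.sum_range_reflect]
  refine le_trans (le_of_eq (Finset.sum_congr rfl fun k hk => ?_)) ((h n).trans ?_)
  · have := Finset.mem_range.1 hk
    rw [show n - (n - 1 - k) = k + 1 by omega]
  · have : (0 : ℝ) ≤ 6 / p * (1 / 2 ^ n) := by positivity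
    linarith

/-- A line together with `n - 1` independent lazy random vectors spans `(ℤ/p)ⁿ` with high
probability. -/
theorem one_sub_spanStep_pow_finrank_eq_le {U₀ : Submodule (ZMod p) (Fin (n + 1) → ZMod p)}
    (hU₀ : finrank (ZMod p) U₀ = 1) :
    1 - (spanStep (ZMod p) (lazyVec (1 / 2)) ^ n) (subInd fun U => finrank (ZMod p) U = n + 1) U₀ ≤
      6 / p + 4000 / decayRate * Real.exp (-(decayRate / 2) * (n + 1 : ℕ)) := by
  have hc0 : 0 < decayRate := by unfold decayRate; positivity
  have h := one_sub_spanStep_pow_finrank_le (lazyVec_half_nonneg (p := p) (n := n + 1))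
    (sum_lazyVec _) U₀ n
  rw [hU₀] at h
  refine h.trans ?_
  have hexp : (n : ℝ) * Real.exp (-decayRate * (n + 1 : ℕ)) ≤
      2 / decayRate * Real.exp (-(decayRate / 2) * (n + 1 : ℕ)) := by
    have h1 : (n : ℝ) ≤ 2 / decayRate * Real.exp (decayRate / 2 * (n + 1 : ℕ)) := by
      have h2 := Real.add_one_le_exp (decayRate / 2 * (n + 1 : ℕ))
      have h3 : (n : ℝ) = 2 / decayRate * (decayRate / 2 * n) := by field_simp
      rw [h3]
      gcongr
      push_cast at h2 ⊢
      nlinarith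
    calc (n : ℝ) * Real.exp (-decayRate * (n + 1 : ℕ))
        ≤ 2 / decayRate * Real.exp (decayRate / 2 * (n + 1 : ℕ)) *
          Real.exp (-decayRate * (n + 1 : ℕ)) := by gcongr
      _ = _ := by
        rw [mul_assoc, ← Real.exp_add]
        congr 2
        ring
  calc _ ≤ ∑ k ∈ Finset.range n,
        ((3 : ℝ) / p ^ (n - k) + 2000 * Real.exp (-decayRate * (n + 1 : ℕ))) := by
        refine Finset.sum_le_sum fun k hk => ?_
        have := spanStep_pow_layer_le (k := k) (n := n + 1)
          (by have := Finset.mem_range.1 hk; omega) hU₀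
        rwa [Nat.add_sub_add_right] at this
    _ = ∑ k ∈ Finset.range n, (3 : ℝ) / p ^ (n - k) +
        2000 * (n * Real.exp (-decayRate * (n + 1 : ℕ))) := by
        rw [Finset.sum_add_distrib, Finset.sum_const, Finset.card_range, nsmul_eq_mul]
        ring
    _ ≤ 6 / p + 2000 * (2 / decayRate * Real.exp (-(decayRate / 2) * (n + 1 : ℕ))) := by
        gcongr
        exact sum_three_div_pow_le p n
    _ = _ := by ring

end Layer

section Link

variable {p : ℕ} [Fact p.Prime] {n : ℕ}

theorem entryMeasure_real_preimage_cast [MeasurableSpace (ZMod p)] (t : ZMod p) :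
    entryMeasure.real ((fun z : ℤ => (z : ZMod p)) ⁻¹' {t}) = lazyWeight (1 / 2) t := by
  have h2 : (1 / 2 : ENNReal).toReal = 1 / 2 := by simp
  have h4 : (1 / 4 : ENNReal).toReal = 1 / 4 := by simp
  have hreal : ∀ (c : ENNReal) (z : ℤ) (S : Set ℤ),
      (c • Measure.dirac z).real S = c.toReal * S.indicator 1 z := fun c z S => by
    by_cases hz : z ∈ S <;> simp [hz, measureReal_def]
  have hfin₂ : ∀ z : ℤ, IsFiniteMeasure ((1 / 2 : ENNReal) • Measure.dirac z) := fun z => ⟨by simp⟩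
  have hfin₄ : ∀ z : ℤ, IsFiniteMeasure ((1 / 4 : ENNReal) • Measure.dirac z) := fun z => ⟨by simp⟩
  rw [entryMeasure, measureReal_add_apply, measureReal_add_apply, hreal, hreal, hreal, h2, h4]
  simp only [lazyWeight, Set.indicator, Set.mem_preimage, Set.mem_singleton_iff, Int.cast_zero,
    Int.cast_one, Int.cast_neg, Pi.one_apply, eq_comm (b := t)]
  split_ifs <;> norm_num

theorem measurePreserving_pi_tail {α : Type*} [MeasurableSpace α] (μ : Measure α)
    [IsProbabilityMeasure μ] (n : ℕ) :
    MeasurePreserving (fun (M : Fin (n + 1) → α) (i : Fin n) => M i.succ)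
      (Measure.pi fun _ => μ) (Measure.pi fun _ => μ) :=
  (measurePreserving_snd (μ := μ) (ν := Measure.pi fun _ : Fin n => μ)).comp
    (measurePreserving_piFinSuccAbove (fun _ : Fin (n + 1) => μ) 0)

open Classical in
theorem matMeasure_real_tail_cast (Q : (Fin n → Fin (n + 1) → ZMod p) → Prop) :
    (matMeasure (n + 1)).real {M | Q fun i j => (M i.succ j : ZMod p)} =
      ∑ N : Fin n → Fin (n + 1) → ZMod p, (∏ i, lazyVec (1 / 2) (N i)) * if Q N then 1 else 0 := by
  let _ : MeasurableSpace (ZMod p) := ⊤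
  have hc : Measurable fun z : ℤ => (z : ZMod p) := measurable_from_top
  set μ : Measure (ZMod p) := entryMeasure.map fun z : ℤ => (z : ZMod p) with hμ
  have : IsProbabilityMeasure μ := Measure.isProbabilityMeasure_map hc.aemeasurable
  have hvec : MeasurePreserving (fun (x : Fin (n + 1) → ℤ) j => (x j : ZMod p))
      (vecMeasure (n + 1)) (Measure.pi fun _ => μ) :=
    measurePreserving_pi _ _ fun _ => ⟨hc, rfl⟩
  have hmat : MeasurePreserving
      (fun (M : Fin n → Fin (n + 1) → ℤ) i j => (M i j : ZMod p))
      (Measure.pi fun _ => vecMeasure (n + 1)) (Measure.pi fun _ => Measure.pi fun _ => μ) :=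
    measurePreserving_pi _ _ fun _ => hvec
  have htail : MeasurePreserving (fun (M : Fin (n + 1) → Fin (n + 1) → ℤ) (i : Fin n) => M i.succ)
      (matMeasure (n + 1)) (Measure.pi fun _ => vecMeasure (n + 1)) :=
    measurePreserving_pi_tail _ n
  have hall := hmat.comp htail
  have h1 := hall.measureReal_preimage (s := {N | Q N}) (Set.toFinite _).measurableSet.nullMeasurableSet
  refine h1.trans ?_
  have h2 : {N | Q N} = ((Finset.univ.filter Q : Finset (Fin n → Fin (n + 1) → ZMod p)) : Set _) := by
    ext; simp
  rw [h2, ← sum_measureReal_singleton, Finset.sum_filter]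
  refine Finset.sum_congr rfl fun N _ => ?_
  have h3 : (Measure.pi fun _ : Fin n => Measure.pi fun _ : Fin (n + 1) => μ).real {N} =
      ∏ i, lazyVec (1 / 2) (N i) := by
    simp only [measureReal_def, Measure.pi_singleton, ENNReal.toReal_prod, lazyVec]
    refine Finset.prod_congr rfl fun i _ => Finset.prod_congr rfl fun j _ => ?_
    rw [← entryMeasure_real_preimage_cast, measureReal_def, hμ,
      Measure.map_apply hc (measurableSet_singleton _)]
  rw [h3]
  split_ifs <;> simp

theorem minorDet_succ (M : Fin (n + 1) → Fin (n + 1) → ℤ) (j : Fin (n + 1)) :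
    minorDet M j = ((Matrix.of M).submatrix Fin.succ j.succAbove).det := by
  have h : skipCol (n + 1) j = j.succAbove := by
    funext i
    ext
    simp only [skipCol, Fin.succAbove, Fin.lt_def, Fin.val_castSucc]
    split_ifs <;> rfl
  rw [minorDet, h]
  rfl

theorem det_cons_eq_comb (M : Fin (n + 1) → Fin (n + 1) → ℤ) (j₁ j₂ : Fin (n + 1)) (τ₁ τ₂ : ℤ) :
    (Matrix.of (Fin.cons (Pi.single j₁ ((-1) ^ (j₁ : ℕ) * (τ₁ : ZMod p)) +
      Pi.single j₂ ((-1) ^ (j₂ : ℕ) * (τ₂ : ZMod p))) fun i j => (M i.succ j : ZMod p) :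
        Fin (n + 1) → Fin (n + 1) → ZMod p)).det =
      ((τ₁ * minorDet M j₁ + τ₂ * minorDet M j₂ : ℤ) : ZMod p) := by
  have hminor : ∀ j : Fin (n + 1), ((minorDet M j : ℤ) : ZMod p) =
      (Matrix.of fun (i : Fin n) k => (M i.succ (j.succAbove k) : ZMod p)).det := by
    intro j
    rw [minorDet_succ, Int.cast_det]
    rfl
  have hsq : ∀ k : ℕ, ((-1) ^ k * (-1) ^ k : ZMod p) = 1 := fun k => by
    rw [← mul_pow]; simp
  rw [Matrix.det_succ_row_zero]
  have hterm : ∀ j : Fin (n + 1), ((Matrix.of (Fin.cons (Pi.single j₁ ((-1) ^ (j₁ : ℕ) * (τ₁ : ZMod p)) +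
      Pi.single j₂ ((-1) ^ (j₂ : ℕ) * (τ₂ : ZMod p))) fun i j => (M i.succ j : ZMod p) :
        Fin (n + 1) → Fin (n + 1) → ZMod p)).submatrix Fin.succ j.succAbove).det =
        ((minorDet M j : ℤ) : ZMod p) := fun j => (hminor j).symm
  simp only [hterm, Matrix.of_apply, Fin.cons_zero, Pi.add_apply, mul_add, add_mul,
    Finset.sum_add_distrib, Pi.single_apply, mul_ite, ite_mul, mul_zero, zero_mul,
    Finset.sum_ite_eq', Finset.mem_univ, if_true]
  push_cast
  linear_combination τ₁ * (minorDet M j₁ : ZMod p) * hsq j₁ + τ₂ * (minorDet M j₂ : ZMod p) * hsq j₂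

theorem finrank_ne_of_det_cons_eq_zero {F : Type*} [Field F] (v : Fin (n + 1) → F)
    (N : Fin n → Fin (n + 1) → F)
    (h : (Matrix.of (Fin.cons v N : Fin (n + 1) → Fin (n + 1) → F)).det = 0) :
    Module.finrank F ↥(Submodule.span F {v} ⊔ Submodule.span F (Set.range N)) ≠ n + 1 := by
  intro hr
  rw [← Submodule.span_union, ← Set.insert_eq, ← Fin.range_cons] at hr
  have hli : LinearIndependent F (Fin.cons v N : Fin (n + 1) → Fin (n + 1) → F) := by
    rw [linearIndependent_iff_card_eq_finrank_span, Fintype.card_fin]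
    exact hr.symm
  have := (Matrix.isUnit_iff_isUnit_det _).1 (Matrix.linearIndependent_rows_iff_isUnit.1
    (show LinearIndependent F (Matrix.of (Fin.cons v N : Fin (n + 1) → Fin (n + 1) → F)).row
      from hli))
  rw [h] at this
  exact not_isUnit_zero this

theorem intCast_ne_zero_of_mem (hp : 2 < p) {τ : ℤ} (hτ : τ ∈ ({1, -1, 2, -2} : Set ℤ)) :
    (τ : ZMod p) ≠ 0 := by
  rw [Ne, ZMod.intCast_zmod_eq_zero_iff_dvd]
  intro h
  have h2 : (p : ℤ) ∣ 2 := by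
    rcases hτ with rfl | rfl | rfl | rfl
    · exact h.mul_left 2 |>.trans (by norm_num)
    · exact (h.mul_left (-2)).trans (by norm_num)
    · exact h
    · exact (dvd_neg.2 h).trans (by norm_num)
  have := Int.le_of_dvd two_pos h2
  omega

theorem matMeasure_real_dvd_le (hp : 2 < p) {j₁ j₂ : Fin (n + 1)} (hj : j₁ < j₂) {τ₁ τ₂ : ℤ}
    (hτ₁ : τ₁ ∈ ({1, -1, 2, -2} : Set ℤ)) :
    (matMeasure (n + 1)).real {M | (p : ℤ) ∣ τ₁ * minorDet M j₁ + τ₂ * minorDet M j₂} ≤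
      6 / p + 4000 / decayRate * Real.exp (-(decayRate / 2) * (n + 1 : ℕ)) := by
  classical
  set v : Fin (n + 1) → ZMod p := Pi.single j₁ ((-1) ^ (j₁ : ℕ) * (τ₁ : ZMod p)) +
    Pi.single j₂ ((-1) ^ (j₂ : ℕ) * (τ₂ : ZMod p)) with hv
  have hv0 : v ≠ 0 := by
    intro h
    have h1 := congr_fun h j₁
    rw [hv, Pi.add_apply, Pi.single_eq_same, Pi.single_eq_of_ne hj.ne, add_zero, Pi.zero_apply] at h1
    exact mul_ne_zero (pow_ne_zero _ (neg_ne_zero.2 one_ne_zero)) (intCast_ne_zero_of_mem hp hτ₁) h1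
  set U₀ := Submodule.span (ZMod p) {v}
  have hU₀ : Module.finrank (ZMod p) U₀ = 1 := finrank_span_singleton hv0
  have hset : {M | (p : ℤ) ∣ τ₁ * minorDet M j₁ + τ₂ * minorDet M j₂} =
      {M | (Matrix.of (Fin.cons v (fun i j => (M i.succ j : ZMod p)) :
        Fin (n + 1) → Fin (n + 1) → ZMod p)).det = 0} := by
    ext M
    rw [Set.mem_ofPred_eq, Set.mem_ofPred_eq, det_cons_eq_comb,
      ZMod.intCast_zmod_eq_zero_iff_dvd]
  rw [hset]
  refine (matMeasure_real_tail_cast fun N => (Matrix.of (Fin.cons v N :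
    Fin (n + 1) → Fin (n + 1) → ZMod p)).det = 0).trans_le ?_
  refine le_trans ?_ (one_sub_spanStep_pow_finrank_eq_le hU₀)
  have hone : ∀ x : ℝ, 1 - x = (spanStep (ZMod p) (lazyVec (1 / 2)) ^ n) (fun _ => 1) U₀ - x :=
    fun x => by rw [spanStep_pow_const (sum_lazyVec _)]
  rw [hone, ← sum_prod_mul_eq_spanStep_pow, ← sum_prod_mul_eq_spanStep_pow, ← Finset.sum_sub_distrib]
  refine Finset.sum_le_sum fun N _ => ?_
  rw [← mul_sub]
  refine mul_le_mul_of_nonneg_left ?_ (Finset.prod_nonneg fun i _ => lazyVec_half_nonneg _)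
  split_ifs with h
  · rw [subInd, if_neg (finrank_ne_of_det_cons_eq_zero v N h), sub_zero]
  · unfold subInd
    split_ifs <;> norm_num

end Link

/-- Let `d₁, d₂` be determinants of two different first-row minors of a random
`{0, ±1}` matrix, and `τ₁, τ₂ ∈ {±1, ±2}`.  There are absolute constants
`C, c > 0` such that for every prime `p` and every `n`,
`ℙ(p ∣ τ₁ d₁ + τ₂ d₂) ≤ C / p + C * exp (-c n)`. -/
theorem prob_prime_dvd_minor_comb_le :
    ∃ C : ℝ, 0 < C ∧ ∃ c : ℝ, 0 < c ∧ ∀ p : ℕ, p.Prime → ∀ n : ℕ,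
      ∀ j₁ j₂ : Fin n, j₁ < j₂ →
      ∀ τ₁ τ₂ : ℤ, τ₁ ∈ ({1, -1, 2, -2} : Set ℤ) → τ₂ ∈ ({1, -1, 2, -2} : Set ℤ) →
      (matMeasure n
          {M | (p : ℤ) ∣ τ₁ * minorDet M j₁ + τ₂ * minorDet M j₂}).toReal ≤
        C / p + C * Real.exp (-c * n) := by
  have hc0 : 0 < decayRate := by unfold decayRate; positivity
  have hC : 0 < 4000 / decayRate := by positivity
  refine ⟨6 + 4000 / decayRate, by positivity, decayRate / 2, by positivity, ?_⟩
  intro p hp n j₁ j₂ hj τ₁ τ₂ hτ₁ _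
  have : Fact p.Prime := ⟨hp⟩
  have hp0 : (0 : ℝ) < p := by exact_mod_cast hp.pos
  have hexp := Real.exp_pos (-(decayRate / 2) * n)
  rcases hp.two_le.eq_or_lt with rfl | hp2
  · refine (measureReal_le_one (μ := matMeasure n)).trans ?_
    have : 0 ≤ (6 + 4000 / decayRate) * Real.exp (-(decayRate / 2) * n) := by positivity
    push_cast
    linarith
  · obtain _ | n := n
    · exact j₁.elim0
    refine (matMeasure_real_dvd_le hp2 hj hτ₁).trans ?_
    gcongr <;> linarith
end

section
/- Let $M$ be an $n\times n$ random matrix whose entries are i.i.d., each taking the value $0$ with probability $1/2$ and each of the values $1$ and $-1$ with probability $1/4$. Then there exists an absolute constant $C>0$ such that for all $n\ge 2$, the expected number of distinct primes dividing $\det M$, counted as $0$ on the event $\det M=0$, is at most $C\log n$; that is, $\mathbb{E}\big[\#\{p\text{ prime}: p\mid\det M\}\cdot\mathbf{1}_{\det M\ne 0}\big]\le C\log n$. -/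
open MeasureTheory

namespace UniformMatrix

open Finset
open scoped BigOperators Pointwise

section Uniform

variable {Ω Ω' : Type*} [Fintype Ω] [Fintype Ω']

open Classical in
/-- The probability of an event under the uniform law on a finite type. -/
noncomputable def unifProb (A : Ω → Prop) : ℝ := 𝔼 ω, if A ω then 1 else 0

open Classical in
lemma unifProb_def (A : Ω → Prop) : unifProb A = 𝔼 ω, if A ω then (1 : ℝ) else 0 := rfl

lemma unifProb_nonneg (A : Ω → Prop) : 0 ≤ unifProb A := by
  classical
  exact expect_nonneg fun ω _ => by split_ifs <;> norm_num

lemma unifProb_mono {A B : Ω → Prop} (h : ∀ ω, A ω → B ω) : unifProb A ≤ unifProb B := by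
  classical
  refine expect_le_expect fun ω _ => ?_
  by_cases hA : A ω
  · simp [hA, h ω hA]
  · simp only [hA, if_false]; split_ifs <;> norm_num

lemma unifProb_le_one (A : Ω → Prop) : unifProb A ≤ 1 := by
  classical
  cases isEmpty_or_nonempty Ω
  · simp [unifProb]
  · exact expect_le univ_nonempty fun ω _ => by split_ifs <;> norm_num

lemma unifProb_true [Nonempty Ω] {A : Ω → Prop} (h : ∀ ω, A ω) : unifProb A = 1 := by
  classical
  simp [unifProb, h]

lemma unifProb_exists_le {ι : Type*} (s : Finset ι) (A : ι → Ω → Prop) :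
    unifProb (fun ω => ∃ i ∈ s, A i ω) ≤ ∑ i ∈ s, unifProb (A i) := by
  classical
  simp only [unifProb]
  rw [← expect_sum_comm]
  refine expect_le_expect fun ω _ => ?_
  split_ifs with h
  · obtain ⟨i, hi, hA⟩ := h
    refine le_trans ?_ (single_le_sum (f := fun i => if A i ω then (1 : ℝ) else 0)
      (fun j _ => by split_ifs <;> norm_num) hi)
    simp [hA]
  · exact sum_nonneg fun j _ => by split_ifs <;> norm_num

lemma unifProb_or_le (A B : Ω → Prop) :
    unifProb (fun ω => A ω ∨ B ω) ≤ unifProb A + unifProb B := by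
  classical
  simp only [unifProb]
  rw [← expect_add_distrib]
  refine expect_le_expect fun ω _ => ?_
  by_cases hA : A ω <;> by_cases hB : B ω <;> simp [hA, hB]

lemma unifProb_not [Nonempty Ω] (A : Ω → Prop) :
    unifProb (fun ω => ¬ A ω) = 1 - unifProb A := by
  classical
  rw [eq_sub_iff_add_eq]
  simp only [unifProb]
  rw [← expect_add_distrib]
  refine (expect_congr rfl fun ω _ => ?_).trans Fintype.expect_one
  by_cases hA : A ω <;> simp [hA]

/-- Values taken by a random object are disjoint events. -/
lemma sum_unifProb_eq_le {ι : Type*} (s : Finset ι) (X : Ω → ι) :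
    ∑ i ∈ s, unifProb (fun ω => X ω = i) ≤ 1 := by
  classical
  simp only [unifProb]
  rw [← expect_sum_comm]
  cases isEmpty_or_nonempty Ω
  · simp
  refine expect_le univ_nonempty fun ω _ => ?_
  rw [sum_ite_eq]
  split_ifs <;> norm_num

lemma unifProb_equiv (e : Ω ≃ Ω') (A : Ω → Prop) (B : Ω' → Prop)
    (h : ∀ ω, A ω ↔ B (e ω)) : unifProb A = unifProb B := by
  classical
  exact Fintype.expect_equiv e _ _ fun ω => by simp [h]

lemma expect_prod_univ (f : Ω × Ω' → ℝ) : 𝔼 z, f z = 𝔼 x, 𝔼 y, f (x, y) := by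
  rw [← univ_product_univ, expect_product]

lemma unifProb_prod (A : Ω × Ω' → Prop) :
    unifProb A = 𝔼 x, unifProb fun y => A (x, y) := by
  classical
  exact expect_prod_univ _

lemma unifProb_and_prod (A : Ω → Prop) (B : Ω' → Prop) :
    unifProb (fun z : Ω × Ω' => A z.1 ∧ B z.2) = unifProb A * unifProb B := by
  classical
  rw [unifProb_prod, unifProb_def A, expect_mul]
  refine expect_congr rfl fun x _ => ?_
  by_cases h : A x
  · simp [h]
  · simp [h, unifProb]

lemma expect_finCons {S : Type*} [Fintype S] {n : ℕ} (f : (Fin (n + 1) → S) → ℝ) :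
    𝔼 x, f x = 𝔼 x : Fin n → S, 𝔼 s, f (Fin.cons s x) := by
  rw [expect_comm, ← expect_prod_univ (fun z : S × (Fin n → S) => f (Fin.cons z.1 z.2))]
  exact (Fintype.expect_equiv (Fin.consEquiv fun _ => S) _ _ fun z => rfl).symm

lemma unifProb_finCons {S : Type*} [Fintype S] {n : ℕ} (A : (Fin (n + 1) → S) → Prop) :
    unifProb A = 𝔼 x : Fin n → S, unifProb fun s => A (Fin.cons s x) := by
  classical
  exact expect_finCons _

open Classical in
lemma unifProb_eq_card_div (A : Ω → Prop) :
    unifProb A = (#(univ.filter A) : ℝ) / Fintype.card Ω := by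
  rw [unifProb, Fintype.expect_eq_sum_div_card, sum_boole]

lemma unifProb_forall {S ι : Type*} [Fintype S] [Fintype ι] [DecidableEq ι] (A : S → Prop) :
    unifProb (fun x : ι → S => ∀ i, A (x i)) = unifProb A ^ Fintype.card ι := by
  classical
  have h : ((#(univ.filter fun x : ι → S => ∀ i, A (x i)) : ℕ) : ℝ) =
      (#(univ.filter A) : ℝ) ^ Fintype.card ι := by
    have : (univ.filter fun x : ι → S => ∀ i, A (x i)) =
        Fintype.piFinset fun _ => univ.filter A := by ext; simp
    rw [this, Fintype.card_piFinset]
    simp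
  rw [unifProb_eq_card_div, unifProb_eq_card_div, div_pow, ← h, Fintype.card_fun, Nat.cast_pow]
  congr!

end Uniform

/-- `1` and `-1` each at one index, `0` at all others: under the uniform law on `Fin N`
this is a lazy random sign. -/
def lazyVal (R : Type*) [Ring R] {N : ℕ} (j : Fin N) : R :=
  if (j : ℕ) = 0 then 1 else if (j : ℕ) = 1 then -1 else 0

/-- The vector of lazy random signs attached to `y`. -/
def lazyVec (R : Type*) [Ring R] {ι : Type*} {N : ℕ} (y : ι → Fin N) : ι → R :=
  fun i => lazyVal R (y i)

section Field

variable {F : Type*} [Field F]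

lemma unifProb_lazyVal_eq_le {N : ℕ} (hN : 4 ≤ N) (a : F) :
    unifProb (fun j : Fin N => lazyVal F j = a) ≤ 1 - 2 / N := by
  classical
  have hN0 : (0 : ℝ) < N := by positivity
  rw [unifProb_eq_card_div, Fintype.card_fin, div_le_iff₀ hN0, sub_mul, one_mul,
    div_mul_cancel₀ _ hN0.ne', le_sub_iff_add_le]
  set i0 : Fin N := ⟨0, by omega⟩
  set i1 : Fin N := ⟨1, by omega⟩
  have h01 : #({i0, i1} : Finset (Fin N)) = 2 := card_pair (by simp [i0, i1])
  suffices h : #(univ.filter fun j : Fin N => lazyVal F j = a) + 2 ≤ N by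
    have : ((#(univ.filter fun j : Fin N => lazyVal F j = a) + 2 : ℕ) : ℝ) ≤ N := by
      exact_mod_cast h
    push_cast at this
    convert this
  by_cases ha : a = 0
  · subst ha
    rw [← h01, ← card_union_of_disjoint]
    · exact (card_le_univ _).trans_eq (Fintype.card_fin N)
    · rw [disjoint_left]
      intro j hj hj'
      simp only [mem_insert, mem_singleton] at hj'
      have hj := (mem_filter.1 hj).2
      rcases hj' with rfl | rfl <;> simp [lazyVal, i0, i1] at hj
  · have : #(univ.filter fun j : Fin N => lazyVal F j = a) ≤ 2 := by
      rw [← h01]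
      refine card_le_card fun j hj => ?_
      have hj := (mem_filter.1 hj).2
      simp only [mem_insert, mem_singleton, i0, i1, Fin.ext_iff]
      by_contra! hc
      rw [lazyVal, if_neg hc.1, if_neg hc.2] at hj
      exact ha hj.symm
    omega

/-- Odlyzko's bound for the probability of hitting a subspace. -/
lemma unifProb_lazyVec_mem_le {N : ℕ} (hN : 4 ≤ N) {n : ℕ} (V : Submodule F (Fin n → F)) :
    unifProb (fun y : Fin n → Fin N => lazyVec F y ∈ V)
      ≤ (1 - 2 / N : ℝ) ^ (n - Module.finrank F V) := by
  classical
  have hN0 : (4 : ℝ) ≤ N := by exact_mod_cast hN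
  have hα0 : (0 : ℝ) ≤ 1 - 2 / N := by
    rw [sub_nonneg, div_le_one (by linarith)]; linarith
  have hα1 : (1 - 2 / N : ℝ) ≤ 1 := by
    have : (0 : ℝ) ≤ 2 / N := by positivity
    linarith
  induction n with
  | zero => simpa using unifProb_le_one _
  | succ n ih =>
    set T : (Fin (n + 1) → F) →ₗ[F] (Fin n → F) := LinearMap.funLeft F F Fin.succ with hT
    have hTc : ∀ (s : Fin N) (x : Fin n → Fin N),
        T (lazyVec F (Fin.cons s x : Fin (n + 1) → Fin N)) = lazyVec F x := fun s x => by
      ext i; simp [hT, LinearMap.funLeft, lazyVec]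
    have hmem : ∀ (s : Fin N) (x : Fin n → Fin N),
        lazyVec F (Fin.cons s x : Fin (n + 1) → Fin N) ∈ V → lazyVec F x ∈ V.map T :=
      fun s x h => ⟨_, h, hTc s x⟩
    rw [unifProb_finCons]
    by_cases he : (Pi.single 0 1 : Fin (n + 1) → F) ∈ V
    · have hdim : Module.finrank F (V.map T) + 1 ≤ Module.finrank F V := by
        have h1 := LinearMap.finrank_range_add_finrank_ker (T.domRestrict V)
        rw [LinearMap.range_domRestrict] at h1
        have h2 : 0 < Module.finrank F (LinearMap.ker (T.domRestrict V)) := by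
          refine Nat.pos_of_ne_zero fun h0 => ?_
          have hbot := Submodule.finrank_eq_zero.1 h0
          have hz : (⟨Pi.single 0 1, he⟩ : V) ∈ LinearMap.ker (T.domRestrict V) := by
            rw [LinearMap.mem_ker]
            ext i
            simp [hT, LinearMap.funLeft]
          rw [hbot, Submodule.mem_bot] at hz
          have := congrFun (congrArg (fun z => ((z : V) : Fin (n + 1) → F)) hz) 0
          simp at this
        omega
      calc _ ≤ 𝔼 x : Fin n → Fin N, (if lazyVec F x ∈ V.map T then (1 : ℝ) else 0) := by
            refine expect_le_expect fun x _ => ?_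
            split_ifs with h
            · exact unifProb_le_one _
            · refine (unifProb_mono (B := fun _ => False) fun s hs => h (hmem s x hs)).trans ?_
              simp [unifProb]
        _ ≤ (1 - 2 / N : ℝ) ^ (n - Module.finrank F (V.map T)) := ih _
        _ ≤ _ := pow_le_pow_of_le_one hα0 hα1 (by omega)
    · calc _ ≤ 𝔼 x : Fin n → Fin N,
              (if lazyVec F x ∈ V.map T then (1 : ℝ) else 0) * (1 - 2 / N) := by
            refine expect_le_expect fun x _ => ?_
            split_ifs with h
            · obtain ⟨v, hv, hvx⟩ := h
              rw [one_mul]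
              refine (unifProb_mono fun s hs => ?_).trans (unifProb_lazyVal_eq_le (F := F) hN (v 0))
              by_contra hne
              apply he
              have h1 := V.sub_mem hs hv
              have h2 : lazyVec F (Fin.cons s x : Fin (n + 1) → Fin N) - v =
                  (lazyVal F s - v 0) • (Pi.single 0 1 : Fin (n + 1) → F) := by
                ext i
                refine Fin.cases ?_ (fun i => ?_) i
                · simp [lazyVec]
                · have := congrFun (hvx.trans (hTc s x).symm) i
                  simp only [hT, LinearMap.funLeft_apply] at this
                  simp [this]
              rw [h2] at h1
              exact (V.smul_mem_iff (sub_ne_zero.2 hne)).1 h1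
            · refine (unifProb_mono (B := fun _ => False) fun s hs => h (hmem s x hs)).trans ?_
              simp [unifProb]
        _ ≤ (1 - 2 / N : ℝ) ^ (n - Module.finrank F (V.map T)) * (1 - 2 / N) := by
            rw [← expect_mul]
            exact mul_le_mul_of_nonneg_right (ih _) hα0
        _ = (1 - 2 / N : ℝ) ^ (n - Module.finrank F (V.map T) + 1) := (pow_succ _ _).symm
        _ ≤ _ := by
            have := Submodule.finrank_map_le T V
            exact pow_le_pow_of_le_one hα0 hα1 (by omega)

variable {E : Type*} [AddCommGroup E] [Module F E]
  {S T : Type*} [Fintype S] [Fintype T]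

lemma le_unifProb_linearIndependent_and_mem (b : T → E) (V : Submodule F E) {q : ℝ} {R : ℕ}
    (hq : ∀ W : Submodule F E, Module.finrank F W < R → unifProb (fun t => b t ∈ W) ≤ q)
    (hV : q ≤ unifProb fun t => b t ∈ V) (r : ℕ) (hr : r ≤ R) :
    (unifProb (fun t => b t ∈ V) - q) ^ r ≤
      unifProb fun y : Fin r → T => LinearIndependent F (b ∘ y) ∧ ∀ i, b (y i) ∈ V := by
  classical
  induction r with
  | zero =>
    rw [pow_zero, unifProb_true]
    exact fun y => ⟨linearIndependent_empty_type, fun i => i.elim0⟩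
  | succ r ih =>
    rw [unifProb_finCons, pow_succ]
    refine (mul_le_mul_of_nonneg_right (ih (by omega)) (sub_nonneg.2 hV)).trans ?_
    rw [unifProb_def, expect_mul]
    refine expect_le_expect fun x _ => ?_
    split_ifs with h
    · rw [one_mul, sub_le_iff_le_add]
      set W := Submodule.span F (Set.range (b ∘ x))
      have hW : Module.finrank F W < R :=
        (finrank_range_le_card (R := F) (b ∘ x)).trans_lt (by simpa using hr)
      refine le_trans ?_ (add_le_add le_rfl (hq W hW))
      refine le_trans (unifProb_mono fun t ht => ?_) (unifProb_or_le _ _)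
      by_cases htW : b t ∈ W
      · exact Or.inr htW
      · refine Or.inl ⟨?_, fun i => ?_⟩
        · have : b ∘ (Fin.cons t x : Fin (r + 1) → T) = Fin.cons (b t) (b ∘ x) := by
            ext i; refine Fin.cases ?_ (fun i => ?_) i <;> simp
          rw [this, linearIndependent_finCons]
          exact ⟨h.1, htW⟩
        · refine Fin.cases ?_ (fun i => ?_) i
          · simpa using ht
          · simpa using h.2 i
    · rw [zero_mul]; exact unifProb_nonneg _

/-- Steinitz exchange, for families. -/
lemma exists_card_eq_span_union_eq {n r : ℕ} {V : Submodule F E} (hV : Module.finrank F V = n)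
    {u : Fin n → E} (hu : Submodule.span F (Set.range u) = V) {w : Fin r → E}
    (hw : LinearIndependent F w) (hwV : ∀ i, w i ∈ V) :
    ∃ I : Finset (Fin n), #I + r = n ∧ Submodule.span F (u '' I ∪ Set.range w) = V := by
  classical
  set v : Fin r ⊕ Fin n → E := Sum.elim w u
  have hs : LinearIndepOn F v (Set.range Sum.inl) := by
    rw [linearIndepOn_range_iff Sum.inl_injective]
    simpa [v] using hw
  obtain ⟨c, -, hsc, hspan, hc⟩ := exists_linearIndepOn_extension hs (Set.subset_univ _)
  set I : Finset (Fin n) := univ.filter fun i => Sum.inr i ∈ c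
  have hcI : v '' c = u '' I ∪ Set.range w := by
    ext e
    constructor
    · rintro ⟨i | i, hi, rfl⟩
      · exact Or.inr ⟨i, rfl⟩
      · exact Or.inl ⟨i, by simpa [I] using hi, rfl⟩
    · rintro (⟨i, hi, rfl⟩ | ⟨i, rfl⟩)
      · exact ⟨Sum.inr i, by simpa [I] using hi, rfl⟩
      · exact ⟨Sum.inl i, hsc ⟨i, rfl⟩, rfl⟩
  have hspanV : Submodule.span F (v '' c) = V := by
    apply le_antisymm
    · rw [Submodule.span_le]
      rintro _ ⟨i | i, -, rfl⟩
      · exact hwV i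
      · rw [← hu]; exact Submodule.subset_span ⟨i, rfl⟩
    · rw [← hu, Submodule.span_le]
      rintro _ ⟨i, rfl⟩
      exact hspan ⟨Sum.inr i, Set.mem_univ _, rfl⟩
  refine ⟨I, ?_, by rw [← hcI, hspanV]⟩
  have hcard : Module.finrank F (Submodule.span F (v '' c)) = Fintype.card c := by
    have := finrank_span_eq_card (R := F) (b := fun i : c => v i) hc
    rwa [Set.image_eq_range]
  rw [hspanV, hV] at hcard
  have hc' : c.toFinset = (univ : Finset (Fin r)).disjSum I := by
    ext (i | i)
    · simpa using hsc ⟨i, rfl⟩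
    · simp [I]
  rw [← Set.toFinset_card, hc', card_disjSum, card_univ, Fintype.card_fin] at hcard
  omega

/-- Swapping `r` of the `n` samples spanning `V` for samples of another law. -/
lemma unifProb_span_eq_mul_le (a : S → E) (b : T → E) {n r : ℕ} {V : Submodule F E}
    (hV : Module.finrank F V = n) :
    (unifProb fun x : Fin n → S => Submodule.span F (Set.range (a ∘ x)) = V) *
        (unifProb fun y : Fin r → T => LinearIndependent F (b ∘ y) ∧ ∀ i, b (y i) ∈ V) ≤
      unifProb (fun s => a s ∈ V) ^ r *
        ∑ I : Finset (Fin n), unifProb fun w : ({i // i ∈ I} → S) × (Fin r → T) =>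
          Submodule.span F (Set.range (a ∘ w.1) ∪ Set.range (b ∘ w.2)) = V := by
  classical
  rw [← unifProb_and_prod]
  set h := unifProb fun s => a s ∈ V with hh
  have key : ∀ I : Finset (Fin n), #I + r = n →
      (unifProb fun z : (Fin n → S) × (Fin r → T) =>
        Submodule.span F (Set.range (fun i : {i // i ∈ I} => a (z.1 i)) ∪ Set.range (b ∘ z.2)) = V
          ∧ ∀ i : {i // i ∉ I}, a (z.1 i) ∈ V) =
      h ^ r * unifProb fun w : ({i // i ∈ I} → S) × (Fin r → T) =>
          Submodule.span F (Set.range (a ∘ w.1) ∪ Set.range (b ∘ w.2)) = V := by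
    intro I hI
    have hcard : Fintype.card {i // i ∉ I} = r := by
      rw [Fintype.card_subtype_compl]
      simp
      omega
    have hrhs := unifProb_and_prod (fun w : ({i // i ∈ I} → S) × (Fin r → T) =>
          Submodule.span F (Set.range (a ∘ w.1) ∪ Set.range (b ∘ w.2)) = V)
        (fun x : {i // i ∉ I} → S => ∀ i, a (x i) ∈ V)
    rw [unifProb_forall (fun s => a s ∈ V), hcard] at hrhs
    rw [mul_comm, ← hrhs]
    refine unifProb_equiv
      (((Equiv.piEquivPiSubtypeProd (fun i => i ∈ I) fun _ => S).prodCongr (Equiv.refl _)).trans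
        (((Equiv.prodAssoc _ _ _).trans ((Equiv.refl _).prodCongr (Equiv.prodComm _ _))).trans
          (Equiv.prodAssoc _ _ _).symm)) _ _ ?_
    rintro ⟨x, y⟩
    rfl
  calc _ ≤ unifProb fun z : (Fin n → S) × (Fin r → T) =>
        ∃ I ∈ univ.filter (fun I : Finset (Fin n) => #I + r = n),
        Submodule.span F (Set.range (fun i : {i // i ∈ I} => a (z.1 i)) ∪ Set.range (b ∘ z.2)) = V
          ∧ ∀ i : {i // i ∉ I}, a (z.1 i) ∈ V := by
        refine unifProb_mono ?_
        rintro ⟨x, y⟩ ⟨hx, hy, hyV⟩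
        obtain ⟨I, hI, hIV⟩ := exists_card_eq_span_union_eq hV hx hy hyV
        refine ⟨I, by simpa using hI, ?_, fun i => ?_⟩
        · rw [Set.image_eq_range] at hIV
          exact hIV
        · rw [← hx]; exact Submodule.subset_span ⟨i, rfl⟩
    _ ≤ _ := unifProb_exists_le _ _
    _ = ∑ I ∈ univ.filter (fun I : Finset (Fin n) => #I + r = n),
        h ^ r * unifProb fun w : ({i // i ∈ I} → S) × (Fin r → T) =>
          Submodule.span F (Set.range (a ∘ w.1) ∪ Set.range (b ∘ w.2)) = V :=
        sum_congr rfl fun I hI => key I (by simpa using hI)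
    _ ≤ _ := by
        rw [mul_sum]
        exact sum_le_sum_of_subset_of_nonneg (filter_subset _ _) fun I _ _ =>
          mul_nonneg (pow_nonneg (unifProb_nonneg _) _) (unifProb_nonneg _)

lemma sum_unifProb_span_eq_le (a : S → E) (b : T → E) {n r : ℕ} (𝓑 : Finset (Submodule F E))
    (hdim : ∀ V ∈ 𝓑, Module.finrank F V = n) {q l : ℝ} (hl : 0 ≤ l)
    (hq : ∀ W : Submodule F E, Module.finrank F W < r → unifProb (fun t => b t ∈ W) ≤ q)
    (hqV : ∀ V ∈ 𝓑, 2 * q ≤ unifProb fun t => b t ∈ V)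
    (hpos : ∀ V ∈ 𝓑, 0 < unifProb fun t => b t ∈ V)
    (hab : ∀ V ∈ 𝓑, unifProb (fun s => a s ∈ V) ≤ l * unifProb fun t => b t ∈ V) :
    ∑ V ∈ 𝓑, (unifProb fun x : Fin n → S => Submodule.span F (Set.range (a ∘ x)) = V) ≤
      2 ^ n * (2 * l) ^ r := by
  classical
  have key : ∀ V ∈ 𝓑,
      (unifProb fun x : Fin n → S => Submodule.span F (Set.range (a ∘ x)) = V) ≤
      (2 * l) ^ r * ∑ I : Finset (Fin n), unifProb fun w : ({i // i ∈ I} → S) × (Fin r → T) =>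
          Submodule.span F (Set.range (a ∘ w.1) ∪ Set.range (b ∘ w.2)) = V := by
    intro V hV
    have h0 := hpos V hV
    set h := unifProb fun t => b t ∈ V
    have h1 := le_unifProb_linearIndependent_and_mem b V hq (by linarith [hqV V hV]) r le_rfl
    have h2 : (h / 2) ^ r ≤ (h - q) ^ r :=
      pow_le_pow_left₀ (by linarith) (by linarith [hqV V hV]) r
    have h3 := unifProb_span_eq_mul_le (r := r) a b (hdim V hV)
    have hr : 0 < (h / 2) ^ r := by positivity
    refine le_of_mul_le_mul_right ?_ hr
    calc _ ≤ _ := mul_le_mul_of_nonneg_left (h2.trans h1) (unifProb_nonneg _)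
      _ ≤ _ := h3
      _ ≤ (l * h) ^ r * _ := mul_le_mul_of_nonneg_right
          (pow_le_pow_left₀ (unifProb_nonneg _) (hab V hV) r)
          (sum_nonneg fun I _ => unifProb_nonneg _)
      _ = _ := by
          have : l * h = 2 * l * (h / 2) := by ring
          rw [this, mul_pow]; ring
  calc _ ≤ _ := sum_le_sum key
    _ = (2 * l) ^ r * ∑ I : Finset (Fin n), ∑ V ∈ 𝓑,
          unifProb fun w : ({i // i ∈ I} → S) × (Fin r → T) =>
          Submodule.span F (Set.range (a ∘ w.1) ∪ Set.range (b ∘ w.2)) = V := by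
        rw [← mul_sum, sum_comm]
    _ ≤ (2 * l) ^ r * ∑ I : Finset (Fin n), 1 := by
        gcongr
        exact sum_unifProb_eq_le _ _
    _ = _ := by simp [mul_comm]

end Field

lemma expect_prod_apply {ι S : Type*} [Fintype ι] [DecidableEq ι] [Fintype S] (f : ι → S → ℂ) :
    𝔼 y : ι → S, ∏ i, f i (y i) = ∏ i, 𝔼 s, f i s := by
  simp only [Fintype.expect_eq_sum_div_card, prod_div_distrib]
  rw [Finset.prod_univ_sum]
  simp

/-- Comparison of averages from a comparison of the sizes of superlevel sets. -/
lemma mul_sum_le_of_card_superlevel_le {T : Type*} [Fintype T] [Nonempty T] (h H : T → ℝ)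
    (h1 : ∀ t, h t ≤ 1) (H0 : ∀ t, 0 ≤ H t) (k : ℕ) {δ : ℝ} (hδ : 0 ≤ δ)
    (hk : ∀ ε, δ < ε → ε ≤ 1 →
      k * #(univ.filter fun t => ε ≤ h t) ≤ #(univ.filter fun t => ε ≤ H t) + k) :
    k * ∑ t, h t ≤ ∑ t, H t + 2 * k + k * δ * Fintype.card T := by
  classical
  set m := Fintype.card T with hm
  have hm0 : 0 < m := Fintype.card_pos
  have hmR : (0 : ℝ) < m := by exact_mod_cast hm0
  have hIcc : ∀ x : ℕ, #(Icc 1 x) = x := fun x => by simp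
  have hcount_le : ∀ x : ℝ, 0 ≤ x →
      (#((Icc 1 m).filter fun j : ℕ => (j : ℝ) ≤ m * x) : ℝ) ≤ m * x := by
    intro x hx
    have hmx : 0 ≤ m * x := by positivity
    have : #((Icc 1 m).filter fun j : ℕ => (j : ℝ) ≤ m * x) ≤ ⌊m * x⌋₊ := by
      refine (card_le_card fun j hj => ?_).trans_eq (hIcc _)
      rw [mem_filter, mem_Icc] at hj
      exact mem_Icc.2 ⟨hj.1.1, Nat.le_floor hj.2⟩
    exact le_trans (by exact_mod_cast this) (Nat.floor_le hmx)
  have hle_count : ∀ x : ℝ, x ≤ 1 →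
      m * x - 1 ≤ (#((Icc 1 m).filter fun j : ℕ => (j : ℝ) ≤ m * x) : ℝ) := by
    intro x hx
    have : ⌊m * x⌋₊ ≤ #((Icc 1 m).filter fun j : ℕ => (j : ℝ) ≤ m * x) := by
      refine (hIcc _).symm.trans_le (card_le_card fun j hj => ?_)
      rw [mem_Icc] at hj
      have hjx : (j : ℝ) ≤ m * x := (Nat.le_floor_iff' (by omega)).1 hj.2
      refine mem_filter.2 ⟨mem_Icc.2 ⟨hj.1, ?_⟩, hjx⟩
      have : (j : ℝ) ≤ m := hjx.trans (mul_le_of_le_one_right hmR.le hx)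
      exact_mod_cast this
    have h2 : (⌊m * x⌋₊ : ℝ) ≤ _ := Nat.cast_le.2 this
    linarith [Nat.lt_floor_add_one (m * x)]
  have hswap : ∀ f : T → ℝ,
      ∑ t, (#((Icc 1 m).filter fun j : ℕ => (j : ℝ) ≤ m * f t) : ℝ) =
      ∑ j ∈ Icc 1 m, (#(univ.filter fun t => (j : ℝ) / m ≤ f t) : ℝ) := by
    intro f
    simp only [← sum_boole]
    rw [sum_comm]
    refine sum_congr rfl fun j _ => sum_congr rfl fun t _ => ?_
    simp only [div_le_iff₀' hmR]
  have hj : ∀ j ∈ Icc 1 m, (k : ℝ) * #(univ.filter fun t => (j : ℝ) / m ≤ h t) ≤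
      #(univ.filter fun t => (j : ℝ) / m ≤ H t) + k +
        (if (j : ℝ) ≤ m * δ then (k * m : ℝ) else 0) := by
    intro j hjm
    rw [mem_Icc] at hjm
    split_ifs with hjδ
    · have : (#(univ.filter fun t => (j : ℝ) / m ≤ h t) : ℝ) ≤ m := by
        exact_mod_cast card_le_univ _
      have := mul_le_mul_of_nonneg_left this (Nat.cast_nonneg (α := ℝ) k)
      have h3 : (0 : ℝ) ≤ #(univ.filter fun t => (j : ℝ) / m ≤ H t) := Nat.cast_nonneg _
      linarith [Nat.cast_nonneg (α := ℝ) k]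
    · rw [add_zero]
      push Not at hjδ
      exact_mod_cast hk ((j : ℝ) / m) (by rwa [lt_div_iff₀' hmR])
        (by rw [div_le_one hmR]; exact_mod_cast hjm.2)
  have hsum := sum_le_sum hj
  rw [← mul_sum, ← hswap, sum_add_distrib, sum_add_distrib, ← hswap, ← sum_filter, sum_const,
    sum_const, nsmul_eq_mul, nsmul_eq_mul, Nat.card_Icc, Nat.add_sub_cancel] at hsum
  have hl : m * ∑ t, h t - m ≤
      ∑ t, (#((Icc 1 m).filter fun j : ℕ => (j : ℝ) ≤ m * h t) : ℝ) := by
    refine le_trans (le_of_eq ?_) (sum_le_sum fun t _ => hle_count (h t) (h1 t))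
    rw [sum_sub_distrib, ← mul_sum]
    simp [hm]
  have hr : ∑ t, (#((Icc 1 m).filter fun j : ℕ => (j : ℝ) ≤ m * H t) : ℝ) ≤ m * ∑ t, H t := by
    rw [mul_sum]
    exact sum_le_sum fun t _ => hcount_le (H t) (H0 t)
  have hd := mul_le_mul_of_nonneg_right (hcount_le δ hδ)
    (by positivity : (0 : ℝ) ≤ k * m)
  have hl' := mul_le_mul_of_nonneg_left hl (Nat.cast_nonneg (α := ℝ) k)
  refine le_of_mul_le_mul_left ?_ hmR
  nlinarith

section ZMod

variable {p : ℕ} [Fact p.Prime]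

/-- `1 - cos (2πx/p)`. -/
noncomputable def cosDefect (x : ZMod p) : ℝ := 1 - (ZMod.stdAddChar x).re

lemma normSq_stdAddChar (x : ZMod p) :
    (ZMod.stdAddChar x).re ^ 2 + (ZMod.stdAddChar x).im ^ 2 = 1 := by
  have h := AddChar.norm_apply (ZMod.stdAddChar (N := p)) x
  have h2 := Complex.normSq_eq_norm_sq (ZMod.stdAddChar x)
  rw [h, Complex.normSq_apply] at h2
  linarith

lemma cosDefect_zero : cosDefect (0 : ZMod p) = 0 := by simp [cosDefect]

lemma cosDefect_nonneg (x : ZMod p) : 0 ≤ cosDefect x := by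
  have := normSq_stdAddChar x
  unfold cosDefect
  nlinarith

lemma cosDefect_le_two (x : ZMod p) : cosDefect x ≤ 2 := by
  have := normSq_stdAddChar x
  unfold cosDefect
  nlinarith

lemma cosDefect_add_le (x y : ZMod p) :
    cosDefect (x + y) ≤ 2 * cosDefect x + 2 * cosDefect y := by
  have hx := normSq_stdAddChar x
  have hy := normSq_stdAddChar y
  unfold cosDefect
  rw [AddChar.map_add_eq_mul, Complex.mul_re]
  set a := (ZMod.stdAddChar x).re
  set b := (ZMod.stdAddChar x).im
  set c := (ZMod.stdAddChar y).re
  set d := (ZMod.stdAddChar y).im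
  nlinarith [sq_nonneg (1 - 2 * a + (a * c - b * d)), sq_nonneg (-2 * b + (a * d + b * c)),
    sq_nonneg (a + c - 2), sq_nonneg (b - d), sq_nonneg (b + d), sq_nonneg (a - c)]

lemma expect_stdAddChar_mul (b : ZMod p) :
    𝔼 t : ZMod p, ZMod.stdAddChar (t * b) = if b = 0 then 1 else 0 := by
  rw [Fintype.expect_eq_sum_div_card,
    AddChar.sum_mulShift b (ZMod.isPrimitive_stdAddChar p)]
  split_ifs
  · rw [div_self]; simpa using (Fact.out : p.Prime).ne_zero
  · simp

lemma expect_cosDefect_mul {b : ZMod p} (hb : b ≠ 0) : 𝔼 t : ZMod p, cosDefect (t * b) = 1 := by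
  have h := congrArg Complex.re (expect_stdAddChar_mul b)
  rw [if_neg hb, Fintype.expect_eq_sum_div_card, ← Complex.ofReal_natCast, Complex.div_ofReal_re,
    Complex.re_sum, Complex.zero_re] at h
  simp only [cosDefect]
  rw [expect_sub_distrib, Fintype.expect_one, Fintype.expect_eq_sum_div_card, h, sub_zero]

lemma expect_stdAddChar_lazyVal {N : ℕ} (hN : 2 ≤ N) (s : ZMod p) :
    𝔼 j : Fin N, ZMod.stdAddChar (lazyVal (ZMod p) j * s) =
      ((1 - 2 / N * cosDefect s : ℝ) : ℂ) := by
  obtain ⟨m, rfl⟩ := Nat.exists_eq_add_of_le' hN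
  rw [Fintype.expect_eq_sum_div_card, Fin.sum_univ_succ, Fin.sum_univ_succ]
  have hconj : (ZMod.stdAddChar (-s) : ℂ) = (starRingEnd ℂ) (ZMod.stdAddChar s) :=
    AddChar.map_neg_eq_conj _ _
  have hm : ((m : ℂ) + 2) ≠ 0 := by
    have : ((m + 2 : ℕ) : ℂ) ≠ 0 := Nat.cast_ne_zero.2 (by omega)
    push_cast at this; exact this
  have hre : (ZMod.stdAddChar s : ℂ) + (starRingEnd ℂ) (ZMod.stdAddChar s) =
      2 * ((ZMod.stdAddChar s).re : ℂ) := by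
    rw [Complex.add_conj]; push_cast; ring
  simp only [lazyVal, Fin.val_zero, Fin.val_succ, cosDefect]
  simp [hconj]
  field_simp
  linear_combination hre

/-- The probability that a lazy random sign vector is orthogonal to `ξ`. -/
noncomputable def orthProb (N : ℕ) {n : ℕ} (ξ : Fin n → ZMod p) : ℝ :=
  unifProb fun y : Fin n → Fin N => lazyVec (ZMod p) y ⬝ᵥ ξ = 0

lemma addChar_map_sum {ι A M : Type*} [AddCommMonoid A] [CommMonoid M] (ψ : AddChar A M)
    (s : Finset ι) (f : ι → A) : ψ (∑ i ∈ s, f i) = ∏ i ∈ s, ψ (f i) := by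
  classical
  induction s using Finset.induction_on with
  | empty => simp
  | insert i s hi ih => rw [sum_insert hi, prod_insert hi, AddChar.map_add_eq_mul, ih]

lemma orthProb_eq {N : ℕ} (hN : 2 ≤ N) {n : ℕ} (ξ : Fin n → ZMod p) :
    orthProb N ξ = 𝔼 t : ZMod p, ∏ i, (1 - 2 / N * cosDefect (t * ξ i)) := by
  classical
  apply Complex.ofReal_injective
  have h1 : ((orthProb N ξ : ℝ) : ℂ) = 𝔼 y : Fin n → Fin N, 𝔼 t : ZMod p,
      ZMod.stdAddChar (t * (lazyVec (ZMod p) y ⬝ᵥ ξ)) := by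
    simp only [expect_stdAddChar_mul, orthProb, unifProb]
    rw [Fintype.expect_eq_sum_div_card, Fintype.expect_eq_sum_div_card]
    push_cast
    congr 1
    refine sum_congr rfl fun y _ => ?_
    split_ifs <;> simp
  rw [h1, expect_comm]
  have h2 : ∀ t : ZMod p, 𝔼 y : Fin n → Fin N,
      ZMod.stdAddChar (t * (lazyVec (ZMod p) y ⬝ᵥ ξ)) =
      ((∏ i, (1 - 2 / N * cosDefect (t * ξ i)) : ℝ) : ℂ) := by
    intro t
    rw [Complex.ofReal_prod]
    simp only [← expect_stdAddChar_lazyVal hN]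
    rw [← expect_prod_apply]
    refine expect_congr rfl fun y _ => ?_
    rw [dotProduct, mul_sum, addChar_map_sum]
    refine prod_congr rfl fun i _ => ?_
    congr 1
    simp only [lazyVec]
    ring
  simp only [h2]
  rw [Fintype.expect_eq_sum_div_card, Fintype.expect_eq_sum_div_card]
  push_cast
  rfl

lemma one_div_le_orthProb {N : ℕ} (hN : 4 ≤ N) {n : ℕ} (ξ : Fin n → ZMod p) :
    1 / (p : ℝ) ≤ orthProb N ξ := by
  have hN' : (4 : ℝ) ≤ N := by exact_mod_cast hN
  rw [orthProb_eq (by omega), Fintype.expect_eq_sum_div_card, ZMod.card]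
  gcongr
  refine le_trans ?_ (single_le_sum (f := fun t : ZMod p =>
    ∏ i, (1 - 2 / N * cosDefect (t * ξ i))) (fun t _ => ?_) (mem_univ 0))
  · simp [cosDefect_zero]
  · refine prod_nonneg fun i _ => ?_
    rw [sub_nonneg, div_mul_eq_mul_div, div_le_one (by linarith)]
    linarith [cosDefect_le_two (t * ξ i)]

/-- Total defect of the dilate `t • ξ`. -/
noncomputable def defectSum {n : ℕ} (ξ : Fin n → ZMod p) (t : ZMod p) : ℝ :=
  ∑ i, cosDefect (t * ξ i)

lemma defectSum_nonneg {n : ℕ} (ξ : Fin n → ZMod p) (t : ZMod p) : 0 ≤ defectSum ξ t :=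
  sum_nonneg fun _ _ => cosDefect_nonneg _

lemma defectSum_add_le {n : ℕ} (ξ : Fin n → ZMod p) (s t : ZMod p) :
    defectSum ξ (s + t) ≤ 2 * defectSum ξ s + 2 * defectSum ξ t := by
  simp only [defectSum]
  rw [mul_sum, mul_sum, ← sum_add_distrib]
  refine sum_le_sum fun i _ => ?_
  rw [add_mul]
  exact cosDefect_add_le _ _

lemma expect_defectSum {n : ℕ} (ξ : Fin n → ZMod p) :
    𝔼 t, defectSum ξ t = #(univ.filter fun i => ξ i ≠ 0) := by
  classical
  simp only [defectSum]
  rw [expect_sum_comm, ← sum_boole]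
  refine sum_congr rfl fun i _ => ?_
  split_ifs with h
  · exact expect_cosDefect_mul h
  · push Not at h
    simp [h, cosDefect_zero]

open Classical in
/-- Sublevel sets of the defect grow by the Cauchy-Davenport theorem. -/
lemma card_defectSum_le_growth {n : ℕ} (ξ : Fin n → ZMod p) {M : ℝ} (hM : 0 ≤ M) (a : ℕ) :
    min p (2 ^ a * (#(univ.filter fun t => defectSum ξ t ≤ M) - 1) + 1) ≤
      #(univ.filter fun t => defectSum ξ t ≤ 4 ^ a * M) := by
  have hne : ∀ {L : ℝ}, 0 ≤ L → (univ.filter fun t => defectSum ξ t ≤ L).Nonempty :=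
    fun {L} hL => ⟨0, mem_filter.2 ⟨mem_univ _, by simpa [defectSum, cosDefect_zero] using hL⟩⟩
  induction a with
  | zero =>
    have := (hne hM).card_pos
    simp only [pow_zero, one_mul]
    omega
  | succ a ih =>
    have hL : (0 : ℝ) ≤ 4 ^ a * M := by positivity
    have hcd := ZMod.cauchy_davenport (Fact.out : p.Prime) (hne hL) (hne hL)
    have hsub : (univ.filter fun t => defectSum ξ t ≤ 4 ^ a * M) +
        (univ.filter fun t => defectSum ξ t ≤ 4 ^ a * M) ⊆
        univ.filter fun t => defectSum ξ t ≤ 4 ^ (a + 1) * M := by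
      intro u hu
      obtain ⟨s, hs, t, ht, rfl⟩ := mem_add.1 hu
      have hs := (mem_filter.1 hs).2
      have ht := (mem_filter.1 ht).2
      refine mem_filter.2 ⟨mem_univ _, ?_⟩
      have := defectSum_add_le ξ s t
      rw [pow_succ]
      linarith
    have hc := card_le_card hsub
    have h1 := (hne hM).card_pos
    rw [pow_succ, mul_assoc, mul_comm (2 ^ a), mul_assoc]
    rw [mul_comm (2 ^ a)] at ih
    omega

lemma orthProb_four_le {n : ℕ} (ξ : Fin n → ZMod p) (a : ℕ) :
    orthProb 4 ξ ≤ orthProb (8 * 4 ^ a) ξ / 2 ^ a + 2 / p +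
      Real.exp (-(#(univ.filter fun i => ξ i ≠ 0) / (2 * 4 ^ a))) := by
  classical
  have hp : (0 : ℝ) < p := by exact_mod_cast (Fact.out : p.Prime).pos
  set w : ℝ := (#(univ.filter fun i => ξ i ≠ 0) : ℝ)
  set h : ZMod p → ℝ := fun t => Real.exp (-(defectSum ξ t / 2)) with hh
  set H : ZMod p → ℝ := fun t => Real.exp (-(defectSum ξ t / (2 * 4 ^ a))) with hH
  have h4a : (1 : ℝ) ≤ 4 ^ a := one_le_pow₀ (by norm_num)
  have hX : orthProb 4 ξ ≤ 𝔼 t, h t := by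
    rw [orthProb_eq (by norm_num)]
    refine expect_le_expect fun t _ => ?_
    simp only [hh, defectSum]
    rw [sum_div, ← sum_neg_distrib, Real.exp_sum]
    refine prod_le_prod (fun i _ => ?_) fun i _ => ?_
    · push_cast; linarith [cosDefect_le_two (t * ξ i)]
    · have := Real.add_one_le_exp (-(cosDefect (t * ξ i) / 2))
      push_cast; linarith
  have hY : 𝔼 t, H t ≤ orthProb (8 * 4 ^ a) ξ := by
    rw [orthProb_eq (by have : 0 < 4 ^ a := by positivity
                        omega)]
    refine expect_le_expect fun t _ => ?_
    simp only [hH, defectSum]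
    rw [sum_div, ← sum_neg_distrib, Real.exp_sum]
    refine prod_le_prod (fun i _ => (Real.exp_pos _).le) fun i _ => ?_
    set c := cosDefect (t * ξ i)
    have hc0 : 0 ≤ c := cosDefect_nonneg _
    have hc2 : c ≤ 2 := cosDefect_le_two _
    set x := c / (4 * 4 ^ a) with hx
    have hx0 : 0 ≤ x := by positivity
    have hx1 : x ≤ 1 / 2 := by
      rw [hx, div_le_iff₀ (by positivity)]; linarith
    have e1 : 2 / ((8 * 4 ^ a : ℕ) : ℝ) * c = x := by
      rw [hx]; push_cast; field_simp; ring
    have e2 : c / (2 * 4 ^ a) = 2 * x := by rw [hx]; field_simp; ring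
    rw [e1, e2, Real.exp_neg, inv_le_comm₀ (Real.exp_pos _) (by linarith)]
    refine le_trans ?_ (Real.add_one_le_exp (2 * x))
    rw [inv_le_iff_one_le_mul₀ (by linarith)]
    nlinarith
  have hmain := mul_sum_le_of_card_superlevel_le h H
    (fun t => by
      rw [hh, Real.exp_le_one_iff]
      linarith [defectSum_nonneg ξ t]) (fun t => (Real.exp_pos _).le) (2 ^ a)
    (Real.exp_pos (-(w / (2 * 4 ^ a)))).le (by
      intro ε hε hε1
      have hε0 : 0 < ε := (Real.exp_pos _).trans hε
      set M := -2 * Real.log ε with hMdef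
      have hM : 0 ≤ M := by
        have := Real.log_nonpos hε0.le hε1
        linarith
      have e1 : (univ.filter fun t => ε ≤ h t) = univ.filter fun t => defectSum ξ t ≤ M := by
        refine filter_congr fun t _ => ?_
        rw [hh, ← Real.log_le_iff_le_exp hε0, hMdef]
        constructor <;> intro <;> linarith
      have e2 : (univ.filter fun t => ε ≤ H t) =
          univ.filter fun t => defectSum ξ t ≤ 4 ^ a * M := by
        refine filter_congr fun t _ => ?_
        rw [hH, ← Real.log_le_iff_le_exp hε0, hMdef, le_neg, div_le_iff₀ (by positivity)]
        constructor <;> intro <;> linarith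
      rw [e1, e2]
      have hg := card_defectSum_le_growth ξ hM a
      have hlt : #(univ.filter fun t => defectSum ξ t ≤ 4 ^ a * M) < p := by
        by_contra! hge
        have hall : ∀ t, defectSum ξ t ≤ 4 ^ a * M := by
          have : (univ.filter fun t => defectSum ξ t ≤ 4 ^ a * M) = univ :=
            (card_eq_iff_eq_univ _).1 (le_antisymm (card_le_univ _) (by rwa [ZMod.card]))
          intro t
          have ht := mem_univ t
          rw [← this] at ht
          exact (mem_filter.1 ht).2
        have hw : w ≤ 4 ^ a * M :=
          (expect_defectSum ξ).symm.le.trans (expect_le univ_nonempty fun t _ => hall t)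
        rw [← Real.lt_log_iff_exp_lt hε0, neg_lt, lt_div_iff₀ (by positivity)] at hε
        rw [hMdef] at hw
        linarith
      have hA : 2 ^ a * #(univ.filter fun t => defectSum ξ t ≤ M) ≤
          2 ^ a * (#(univ.filter fun t => defectSum ξ t ≤ M) - 1) + 2 ^ a := by
        rw [← Nat.mul_succ]
        exact Nat.mul_le_mul_left _ (by omega)
      omega)
  rw [ZMod.card] at hmain
  have e : ∀ f : ZMod p → ℝ, ∑ t, f t = p * 𝔼 t, f t := by
    intro f
    rw [Fintype.expect_eq_sum_div_card, ZMod.card]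
    field_simp
  rw [e, e] at hmain
  refine hX.trans ?_
  push_cast at hmain
  have h2a : (0 : ℝ) < 2 ^ a := by positivity
  have : 𝔼 t, h t ≤ (𝔼 t, H t) / 2 ^ a + 2 / p + Real.exp (-(w / (2 * 4 ^ a))) := by
    refine le_of_mul_le_mul_left ?_ (mul_pos h2a hp)
    have : 2 ^ a * p * ((𝔼 t, H t) / 2 ^ a + 2 / p + Real.exp (-(w / (2 * 4 ^ a)))) =
        p * 𝔼 t, H t + 2 * 2 ^ a + 2 ^ a * Real.exp (-(w / (2 * 4 ^ a))) * p := by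
      field_simp
    rw [this]
    linarith
  refine this.trans ?_
  gcongr

end ZMod

section Field

variable {F : Type*} [Field F]

lemma unifProb_not_linearIndependent_le (n w : ℕ) :
    unifProb (fun c : Fin w → Fin n → Fin 4 => ¬ LinearIndependent F fun j => lazyVec F (c j)) ≤
      2 ^ w / 2 ^ n := by
  classical
  suffices h : unifProb (fun c : Fin w → Fin n → Fin 4 =>
      ¬ LinearIndependent F fun j => lazyVec F (c j)) ≤ (2 ^ w - 1) / 2 ^ n by
    refine h.trans ?_
    gcongr
    linarith
  induction w with
  | zero =>
    have : unifProb (fun c : Fin 0 → Fin n → Fin 4 =>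
        ¬ LinearIndependent F fun j => lazyVec F (c j)) = 0 := by
      rw [unifProb_not, unifProb_true, sub_self]
      exact fun c => linearIndependent_empty_type
    rw [this]
    simp
  | succ w ih =>
    have hspan : ∀ c : Fin w → Fin n → Fin 4, unifProb (fun x : Fin n → Fin 4 =>
        lazyVec F x ∈ Submodule.span F (Set.range fun j => lazyVec F (c j))) ≤
        2 ^ w / 2 ^ n := by
      intro c
      refine (unifProb_lazyVec_mem_le le_rfl _).trans ?_
      set d := Module.finrank F (Submodule.span F (Set.range fun j => lazyVec F (c j)))
      have hd : d ≤ w := (finrank_range_le_card _).trans (by simp)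
      have hdn : d ≤ n := (Submodule.finrank_le _).trans (by simp)
      have h1 : (1 - 2 / (4 : ℕ) : ℝ) = 1 / 2 := by norm_num
      rw [h1, one_div, inv_pow, inv_eq_one_div, div_le_div_iff₀ (by positivity) (by positivity),
        one_mul, ← pow_add]
      exact pow_le_pow_right₀ (by norm_num) (by omega)
    calc _ = unifProb (fun z : (Fin w → Fin n → Fin 4) × (Fin n → Fin 4) =>
            ¬ LinearIndependent F fun j => lazyVec F ((Fin.cons z.2 z.1 : Fin (w + 1) → _) j)) := by
          rw [unifProb_finCons, unifProb_prod]
      _ ≤ unifProb (fun z : (Fin w → Fin n → Fin 4) × (Fin n → Fin 4) =>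
            ¬ (LinearIndependent F fun j => lazyVec F (z.1 j)) ∨
            lazyVec F z.2 ∈ Submodule.span F (Set.range fun j => lazyVec F (z.1 j))) := by
          refine unifProb_mono fun z hz => ?_
          by_contra! hcon
          refine hz ?_
          have := (linearIndependent_finCons (K := F) (x := lazyVec F z.2)
            (v := fun j => lazyVec F (z.1 j))).2 hcon
          have hfun : (fun j => lazyVec F ((Fin.cons z.2 z.1 : Fin (w + 1) → _) j)) =
              Fin.cons (lazyVec F z.2) fun j => lazyVec F (z.1 j) := by
            funext j
            refine Fin.cases ?_ (fun j => ?_) j <;> simp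
          rw [hfun]
          exact this
      _ ≤ (2 ^ w - 1) / 2 ^ n + 2 ^ w / 2 ^ n := by
          refine (unifProb_or_le _ _).trans (add_le_add ?_ ?_)
          · rw [unifProb_prod]
            simp only [unifProb_def, Fintype.expect_const]
            refine le_trans (le_of_eq ?_) ih
            rw [unifProb_def]
          · rw [unifProb_prod]
            exact expect_le univ_nonempty fun c _ => hspan c
      _ = _ := by rw [pow_succ]; ring

lemma unifProb_not_linearIndepOn_le {n N : ℕ} (s : Finset (Fin N)) :
    unifProb (fun c : Fin N → Fin n → Fin 4 => ¬ LinearIndepOn F (fun j => lazyVec F (c j)) s) ≤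
      2 ^ #s / 2 ^ n := by
  classical
  refine le_trans (le_of_eq ?_) (unifProb_not_linearIndependent_le (F := F) n #s)
  set e : s ≃ Fin #s := s.equivFin
  rw [unifProb_equiv (Equiv.piEquivPiSubtypeProd (fun j => j ∈ s) fun _ => Fin n → Fin 4) _
    (fun z => (¬ LinearIndependent F fun j : s => lazyVec F (z.1 j)) ∧ True)
    (fun c => by rw [and_true]; rfl)]
  rw [unifProb_and_prod
    (fun z : s → Fin n → Fin 4 => ¬ LinearIndependent F fun j : s => lazyVec F (z j))
    (fun _ => True), unifProb_true (fun _ => trivial), mul_one]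
  refine unifProb_equiv (e.arrowCongr (Equiv.refl _)) _ _ fun c => not_congr ?_
  rw [← linearIndependent_equiv e.symm]
  rfl

/-- It is unlikely that a tall random matrix kills a nonzero vector of small support. -/
lemma unifProb_exists_sparse_le [DecidableEq F] (n : ℕ) :
    unifProb (fun A : Fin n → Fin (n + 1) → Fin 4 => ∃ ξ : Fin (n + 1) → F, ξ ≠ 0 ∧
      10 * #{i | ξ i ≠ 0} ≤ n ∧ ∀ i, lazyVec F (A i) ⬝ᵥ ξ = 0) ≤ 5 / 4 * (25 / 32) ^ n := by
  classical
  set P : Finset (Finset (Fin (n + 1))) := univ.filter fun s => 10 * #s ≤ n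
  have h1 : unifProb (fun A : Fin n → Fin (n + 1) → Fin 4 => ∃ ξ : Fin (n + 1) → F, ξ ≠ 0 ∧
      10 * #{i | ξ i ≠ 0} ≤ n ∧ ∀ i, lazyVec F (A i) ⬝ᵥ ξ = 0) ≤
      unifProb (fun c : Fin (n + 1) → Fin n → Fin 4 =>
        ∃ s ∈ P, ¬ LinearIndepOn F (fun j => lazyVec F (c j)) s) := by
    rw [unifProb_equiv (Equiv.piComm fun (_ : Fin n) (_ : Fin (n + 1)) => Fin 4) _
      (fun c : Fin (n + 1) → Fin n → Fin 4 => ∃ ξ : Fin (n + 1) → F, ξ ≠ 0 ∧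
      10 * #{i | ξ i ≠ 0} ≤ n ∧ ∀ i, lazyVec F (fun j => c j i) ⬝ᵥ ξ = 0) fun A => by rfl]
    refine unifProb_mono fun c ⟨ξ, hξ, hs, hc⟩ => ⟨univ.filter fun i => ξ i ≠ 0, ?_, ?_⟩
    · exact mem_filter.2 ⟨mem_univ _, by convert hs⟩
    · rw [linearIndepOn_finset_iff]
      intro hli
      obtain ⟨j, hj⟩ := Function.ne_iff.1 hξ
      refine hj (hli ξ ?_ j (mem_filter.2 ⟨mem_univ _, hj⟩))
      rw [sum_filter_of_ne (p := fun i => ξ i ≠ 0)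
        fun j _ h0 h1 => h0 (by rw [h1, zero_smul])]
      funext i
      rw [Finset.sum_apply, Pi.zero_apply, ← hc i, dotProduct]
      exact sum_congr rfl fun j _ => mul_comm _ _
  refine h1.trans ((unifProb_exists_le _ _).trans ?_)
  calc ∑ s ∈ P, _ ≤ ∑ s ∈ P, (2 : ℝ) ^ #s / 2 ^ n :=
        sum_le_sum fun s _ => unifProb_not_linearIndepOn_le s
    _ ≤ ∑ s ∈ P, (5 / 4 : ℝ) ^ n / 2 ^ n *
          ((1 / 4) ^ #s * 1 ^ (Fintype.card (Fin (n + 1)) - #s)) := by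
        refine sum_le_sum fun s hs => ?_
        have hs := (mem_filter.1 hs).2
        rw [div_mul_eq_mul_div]
        gcongr
        rw [one_pow, mul_one, one_div, inv_pow, ← div_eq_mul_inv, le_div_iff₀ (by positivity),
          ← mul_pow]
        calc (2 * 4 : ℝ) ^ #s ≤ ((5 / 4) ^ 10) ^ #s := by gcongr; norm_num
          _ ≤ _ := by
            rw [← pow_mul]
            exact pow_le_pow_right₀ (by norm_num) hs
    _ ≤ ∑ s : Finset (Fin (n + 1)), (5 / 4 : ℝ) ^ n / 2 ^ n *
          ((1 / 4) ^ #s * 1 ^ (Fintype.card (Fin (n + 1)) - #s)) :=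
        sum_le_sum_of_subset_of_nonneg (subset_univ _) fun _ _ _ => by positivity
    _ = _ := by
        rw [← mul_sum, Fintype.card_fin, Fin.sum_pow_mul_eq_add_pow, pow_succ,
          show (25 / 32 : ℝ) = 5 / 4 / 2 * (5 / 4) by norm_num, mul_pow (5 / 4 / 2 : ℝ),
          div_pow (5 / 4 : ℝ) 2, show (1 / 4 + 1 : ℝ) = 5 / 4 by norm_num]
        ring

/-- The space of vectors orthogonal to `ξ`. -/
def orthTo {N : ℕ} (ξ : Fin N → F) : Submodule F (Fin N → F) :=
  LinearMap.ker (Fintype.linearCombination F ξ)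

lemma mem_orthTo {N : ℕ} {ξ v : Fin N → F} : v ∈ orthTo ξ ↔ v ⬝ᵥ ξ = 0 := Iff.rfl

lemma finrank_orthTo {n : ℕ} {ξ : Fin (n + 1) → F} (hξ : ξ ≠ 0) :
    Module.finrank F (orthTo ξ) = n := by
  classical
  have h := Module.Dual.finrank_ker_add_one_of_ne_zero (f := Fintype.linearCombination F ξ) (by
    intro h0
    refine hξ (funext fun i => ?_)
    have := LinearMap.congr_fun h0 (Pi.single i 1)
    simpa using this)
  rw [Module.finrank_fin_fun] at h
  exact Nat.succ_injective h

end Field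

section ZMod

variable {p : ℕ} [Fact p.Prime]

/-- The rows are unlikely to span the orthogonal space of a vector `ξ` of large support whose
orthogonality probability is much larger than `1 / p`. -/
lemma unifProb_exists_dense_le {n : ℕ} (hp : (p : ℝ) ≤ Real.exp (n / 81920)) :
    unifProb (fun A : Fin n → Fin (n + 1) → Fin 4 =>
      (LinearIndependent (ZMod p) fun i => lazyVec (ZMod p) (A i)) ∧
      ∃ ξ : Fin (n + 1) → ZMod p, ξ ≠ 0 ∧ n < 10 * #{i | ξ i ≠ 0} ∧ 6 / p < orthProb 4 ξ ∧
        ∀ i, lazyVec (ZMod p) (A i) ⬝ᵥ ξ = 0) ≤ 4 * (1 / 2) ^ n := by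
  classical
  have hp2 : (2 : ℝ) ≤ p := by exact_mod_cast (Fact.out : p.Prime).two_le
  have hp0 : (0 : ℝ) < p := by linarith
  obtain ⟨N, hN⟩ : ∃ N : ℕ, N = 8 * 4 ^ 6 := ⟨_, rfl⟩
  have hNr : (N : ℝ) = 32768 := by rw [hN]; norm_num
  have hN4 : 4 ≤ N := by omega
  set 𝓑 : Finset (Submodule (ZMod p) (Fin (n + 1) → ZMod p)) :=
    (univ.filter fun ξ : Fin (n + 1) → ZMod p =>
      ξ ≠ 0 ∧ n < 10 * #{i | ξ i ≠ 0} ∧ 6 / p < orthProb 4 ξ).image orthTo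
  have h𝓑 : ∀ V, V ∈ 𝓑 ↔ ∃ ξ : Fin (n + 1) → ZMod p, (ξ ≠ 0 ∧ n < 10 * #{i | ξ i ≠ 0} ∧
      6 / p < orthProb 4 ξ) ∧ orthTo ξ = V := by
    intro V
    simp only [𝓑, mem_image, mem_filter, mem_univ, true_and]
  have hmem : ∀ (k : ℕ) (ξ : Fin (n + 1) → ZMod p),
      (unifProb fun y : Fin (n + 1) → Fin k => lazyVec (ZMod p) y ∈ orthTo ξ) = orthProb k ξ :=
    fun k ξ => rfl
  have hdim : ∀ V ∈ 𝓑, Module.finrank (ZMod p) V = n := by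
    intro V hV
    obtain ⟨ξ, ⟨hξ, -⟩, rfl⟩ := (h𝓑 V).1 hV
    exact finrank_orthTo hξ
  set q : ℝ := (1 - 2 / N) ^ (n - n / 2) with hq
  have hqp : 2 * q ≤ 1 / p := by
    have h1 : q ≤ Real.exp (-(n / 81920)) ^ 2 := by
      have h0 : (1 - 2 / N : ℝ) ≤ Real.exp (-(1 / 16384)) := by
        rw [hNr]
        refine le_trans (le_of_eq ?_) (Real.add_one_le_exp _)
        norm_num
      refine (pow_le_pow_left₀ (by rw [hNr]; norm_num) h0 _).trans ?_
      rw [← Real.exp_nat_mul, ← Real.exp_nat_mul, Real.exp_le_exp]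
      have : (n : ℝ) ≤ 2 * ((n - n / 2 : ℕ) : ℝ) := by
        have : n ≤ 2 * (n - n / 2) := by omega
        exact_mod_cast this
      push_cast
      linarith [(Nat.cast_nonneg n : (0 : ℝ) ≤ n)]
    have h2 : Real.exp (-(n / 81920)) ≤ 1 / p := by
      rw [Real.exp_neg, ← one_div]
      exact one_div_le_one_div_of_le hp0 hp
    have h3 : q ≤ (1 / p) ^ 2 := h1.trans (pow_le_pow_left₀ (Real.exp_pos _).le h2 2)
    have h4 : (1 / p : ℝ) ≤ 1 / 2 := one_div_le_one_div_of_le (by norm_num) hp2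
    have h5 : (0 : ℝ) < 1 / p := by positivity
    nlinarith
  have hmain := sum_unifProb_span_eq_le (lazyVec (ZMod p) : (Fin (n + 1) → Fin 4) → _)
    (lazyVec (ZMod p) : (Fin (n + 1) → Fin N) → _) (r := n / 2) 𝓑 hdim (q := q) (l := 1 / 32)
    (by norm_num)
    (fun W hW => by
      refine (unifProb_lazyVec_mem_le hN4 W).trans ?_
      refine pow_le_pow_of_le_one ?_ ?_ ?_
      · rw [hNr]; norm_num
      · rw [hNr]; norm_num
      · omega)
    (fun V hV => by
      obtain ⟨ξ, -, rfl⟩ := (h𝓑 V).1 hV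
      exact hqp.trans (one_div_le_orthProb hN4 ξ))
    (fun V hV => by
      obtain ⟨ξ, -, rfl⟩ := (h𝓑 V).1 hV
      exact lt_of_lt_of_le (by positivity) (one_div_le_orthProb hN4 ξ))
    (fun V hV => by
      obtain ⟨ξ, ⟨-, hs, hbad⟩, rfl⟩ := (h𝓑 V).1 hV
      rw [hmem, hmem]
      have h := orthProb_four_le ξ 6
      rw [← hN] at h
      have hexp : Real.exp (-(#(univ.filter fun i => ξ i ≠ 0) / (2 * 4 ^ 6))) ≤ 1 / p := by
        rw [Real.exp_neg, ← one_div]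
        refine one_div_le_one_div_of_le hp0 (hp.trans (Real.exp_le_exp.2 ?_))
        have : (n : ℝ) ≤ 10 * (#(univ.filter fun i => ξ i ≠ 0) : ℝ) := by exact_mod_cast hs.le
        rw [div_le_div_iff₀ (by norm_num) (by norm_num)]
        linarith
      have e1 : (6 / p : ℝ) = 6 * (1 / p) := by ring
      have e2 : (2 / p : ℝ) = 2 * (1 / p) := by ring
      rw [e1] at hbad
      rw [e2] at h
      linarith)
  calc _ ≤ unifProb (fun A : Fin n → Fin (n + 1) → Fin 4 =>
        ∃ V ∈ 𝓑, Submodule.span (ZMod p) (Set.range (lazyVec (ZMod p) ∘ A)) = V) := by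
        refine unifProb_mono fun A ⟨hli, ξ, h0, h1, h2, h3⟩ =>
          ⟨orthTo ξ, (h𝓑 _).2 ⟨ξ, ⟨h0, h1, h2⟩, rfl⟩, ?_⟩
        refine Submodule.eq_of_le_of_finrank_eq ?_ ?_
        · rw [Submodule.span_le]
          rintro _ ⟨i, rfl⟩
          exact mem_orthTo.2 (h3 i)
        · rw [finrank_orthTo h0]
          exact (finrank_span_eq_card hli).trans (by simp)
    _ ≤ _ := unifProb_exists_le _ _
    _ ≤ 2 ^ n * (2 * (1 / 32)) ^ (n / 2) := hmain
    _ ≤ _ := by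
        have h1 : (2 * (1 / 32) : ℝ) ^ (n / 2) ≤ 4 * (1 / 4) ^ n := by
          have e : (2 * (1 / 32) : ℝ) = (1 / 4) ^ 2 := by norm_num
          rw [e, ← pow_mul]
          obtain h | h : 2 * (n / 2) = n ∨ 2 * (n / 2) + 1 = n := by omega
          · rw [h]
            have : (0 : ℝ) ≤ (1 / 4) ^ n := by positivity
            linarith
          · conv_rhs => rw [← h, pow_succ]
            linarith
        calc _ ≤ (2 : ℝ) ^ n * (4 * (1 / 4) ^ n) := by gcongr
          _ = _ := by
            rw [mul_left_comm, ← mul_pow]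
            norm_num

/-- The rows of a random matrix with one more column than rows are unlikely to be independent
and orthogonal to a vector whose orthogonality probability is much larger than `1 / p`. -/
lemma unifProb_exists_unbalanced_le {n : ℕ} (hp : (p : ℝ) ≤ Real.exp (n / 81920)) :
    unifProb (fun A : Fin n → Fin (n + 1) → Fin 4 =>
      (LinearIndependent (ZMod p) fun i => lazyVec (ZMod p) (A i)) ∧
      ∃ ξ : Fin (n + 1) → ZMod p, ξ ≠ 0 ∧ 6 / p < orthProb 4 ξ ∧
        ∀ i, lazyVec (ZMod p) (A i) ⬝ᵥ ξ = 0) ≤ 6 / p := by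
  have hp0 : (0 : ℝ) < p := by exact_mod_cast (Fact.out : p.Prime).pos
  refine (unifProb_mono fun A ⟨hli, ξ, h0, h1, h2⟩ =>
    (le_or_gt (10 * #{i | ξ i ≠ 0}) n).imp (fun h => ⟨ξ, h0, h, h2⟩)
      fun h => ⟨hli, ξ, h0, h, h1, h2⟩).trans
    ((unifProb_or_le _ _).trans ((add_le_add (unifProb_exists_sparse_le (F := ZMod p) n)
      (unifProb_exists_dense_le hp)).trans ?_))
  have h1 : (1 / 2 : ℝ) ^ n ≤ (25 / 32) ^ n :=
    pow_le_pow_left₀ (by norm_num) (by norm_num) n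
  have h2 : (25 / 32 : ℝ) ^ n ≤ 1 / p := by
    calc (25 / 32 : ℝ) ^ n ≤ Real.exp (-(7 / 32)) ^ n := by
          gcongr
          refine le_trans (le_of_eq ?_) (Real.add_one_le_exp _)
          norm_num
      _ ≤ Real.exp (-(n / 81920)) := by
          rw [← Real.exp_nat_mul, Real.exp_le_exp]
          linarith [(Nat.cast_nonneg n : (0 : ℝ) ≤ n)]
      _ ≤ 1 / p := by
          rw [Real.exp_neg, ← one_div]
          exact one_div_le_one_div_of_le hp0 hp
  have e1 : (6 / p : ℝ) = 6 * (1 / p) := by ring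
  have h3 : (0 : ℝ) < 1 / p := by positivity
  rw [e1]
  linarith

end ZMod

section Field

variable {F : Type*} [Field F]

/-- The span of the rows of the matrix of lazy random signs attached to `A`. -/
def rowSpan (F : Type*) [Field F] {m N : ℕ} (A : Fin m → Fin N → Fin 4) :
    Submodule F (Fin N → F) :=
  Submodule.span F (Set.range fun i => lazyVec F (A i))

/-- The rank of the matrix of lazy random signs attached to `A`. -/
noncomputable def signRank (F : Type*) [Field F] {m N : ℕ} (A : Fin m → Fin N → Fin 4) : ℕ :=
  Module.finrank F (rowSpan F A)

lemma signRank_swap {m N : ℕ} (A : Fin m → Fin N → Fin 4) :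
    signRank F (fun j i => A i j) = signRank F A := by
  have h := (Matrix.of fun i => lazyVec F (A i)).rank_transpose
  rw [Matrix.rank_eq_finrank_span_row, Matrix.rank_eq_finrank_span_row] at h
  exact h

lemma signRank_le_left {m N : ℕ} (A : Fin m → Fin N → Fin 4) : signRank F A ≤ m :=
  (finrank_range_le_card _).trans (by simp)

lemma linearIndependent_iff_signRank_eq {m N : ℕ} (A : Fin m → Fin N → Fin 4) :
    (LinearIndependent F fun i => lazyVec F (A i)) ↔ signRank F A = m := by
  rw [linearIndependent_iff_card_eq_finrank_span, Fintype.card_fin, eq_comm]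
  rfl

lemma rowSpan_cons {m N : ℕ} (A : Fin m → Fin N → Fin 4) (x : Fin N → Fin 4) :
    rowSpan F (Fin.cons x A : Fin (m + 1) → Fin N → Fin 4) =
      rowSpan F A ⊔ Submodule.span F {lazyVec F x} := by
  have hfun : (fun j => lazyVec F ((Fin.cons x A : Fin (m + 1) → Fin N → Fin 4) j)) =
      Fin.cons (lazyVec F x) fun j => lazyVec F (A j) := by
    funext j
    refine Fin.cases ?_ (fun j => ?_) j <;> simp
  rw [rowSpan, hfun, Fin.range_cons, Submodule.span_insert, sup_comm, rowSpan]

open Classical in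
lemma signRank_cons {m N : ℕ} (A : Fin m → Fin N → Fin 4) (x : Fin N → Fin 4) :
    signRank F (Fin.cons x A : Fin (m + 1) → Fin N → Fin 4) =
      if lazyVec F x ∈ rowSpan F A then signRank F A else signRank F A + 1 := by
  rw [signRank, rowSpan_cons]
  split_ifs with h
  · rw [sup_eq_left.2 (by simpa using h), signRank]
  · rw [Submodule.finrank_sup_span_singleton h, signRank]

/-- The probability that a new row lies in the span of the rows of `A`. -/
noncomputable def spanProb (F : Type*) [Field F] {m N : ℕ} (A : Fin m → Fin N → Fin 4) : ℝ :=
  unifProb fun x : Fin N → Fin 4 => lazyVec F x ∈ rowSpan F A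

lemma spanProb_le {m N : ℕ} (A : Fin m → Fin N → Fin 4) :
    spanProb F A ≤ 1 / 2 ^ (N - signRank F A) := by
  refine (unifProb_lazyVec_mem_le le_rfl _).trans (le_of_eq ?_)
  rw [signRank, ← one_div_pow]
  norm_num

lemma expect_signRank_cons {m N : ℕ} (A : Fin m → Fin N → Fin 4) (g : ℕ → ℝ) :
    𝔼 x, g (signRank F (Fin.cons x A : Fin (m + 1) → Fin N → Fin 4)) =
      g (signRank F A + 1) + spanProb F A * (g (signRank F A) - g (signRank F A + 1)) := by
  classical
  rw [spanProb, unifProb_def, expect_mul, ← Fintype.expect_const (ι := Fin N → Fin 4)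
    (g (signRank F A + 1)), ← expect_add_distrib]
  refine expect_congr rfl fun x _ => ?_
  rw [signRank_cons, Fintype.expect_const]
  split_ifs <;> ring

/-- The expected value of `2 ^ k - 1`, where `k` is the row deficiency. -/
noncomputable def defect (F : Type*) [Field F] (m N : ℕ) : ℝ :=
  𝔼 A : Fin m → Fin N → Fin 4, ((2 : ℝ) ^ (m - signRank F A) - 1)

lemma defect_succ_right_le (n : ℕ) : defect F n (n + 1) ≤ defect F n n / 2 := by
  classical
  have h1 : defect F n (n + 1) =
      𝔼 B : Fin (n + 1) → Fin n → Fin 4, ((2 : ℝ) ^ (n - signRank F B) - 1) :=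
    Fintype.expect_equiv (Equiv.piComm fun _ _ => Fin 4) _ _ fun A => by
      rw [← signRank_swap]
      rfl
  rw [h1, expect_finCons, defect, expect_div]
  refine expect_le_expect fun A _ => ?_
  rw [expect_signRank_cons A fun r => (2 : ℝ) ^ (n - r) - 1]
  have hρ := spanProb_le (F := F) A
  obtain h | h := (signRank_le_left (F := F) A).eq_or_lt
  · simp [h]
  · obtain ⟨k, hk⟩ : ∃ k, n - signRank F A = k + 1 := ⟨n - signRank F A - 1, by omega⟩
    rw [hk] at hρ ⊢
    rw [show n - (signRank F A + 1) = k by omega]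
    rw [le_div_iff₀ (by positivity), pow_succ] at hρ
    rw [pow_succ]
    linarith

lemma defect_succ_le (n : ℕ) : defect F (n + 1) (n + 1) ≤ 3 / 2 * defect F n (n + 1) +
    𝔼 A : Fin n → Fin (n + 1) → Fin 4, (if signRank F A = n then spanProb F A else 0) := by
  classical
  rw [defect, expect_finCons, defect, mul_expect, ← expect_add_distrib]
  refine expect_le_expect fun A _ => ?_
  rw [expect_signRank_cons A fun r => (2 : ℝ) ^ (n + 1 - r) - 1]
  have hρ := spanProb_le (F := F) A
  obtain h | h := (signRank_le_left (F := F) A).eq_or_lt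
  · simp [h]
    norm_num
  · obtain ⟨k, hk⟩ : ∃ k, n - signRank F A = k + 1 := ⟨n - signRank F A - 1, by omega⟩
    rw [if_neg h.ne]
    rw [show n + 1 - signRank F A = k + 1 + 1 by omega] at hρ ⊢
    rw [show n + 1 - (signRank F A + 1) = k + 1 by omega, hk]
    rw [le_div_iff₀ (by positivity), pow_succ] at hρ
    rw [pow_succ _ (k + 1)]
    have : (1 : ℝ) ≤ 2 ^ k := one_le_pow₀ (by norm_num)
    rw [pow_succ] at hρ ⊢
    linarith

lemma expect_spanProb_le_half (n : ℕ) : 𝔼 A : Fin n → Fin (n + 1) → Fin 4,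
    (if signRank F A = n then spanProb F A else 0) ≤ 1 / 2 := by
  refine expect_le univ_nonempty fun A _ => ?_
  split_ifs with h
  · have := spanProb_le (F := F) A
    rwa [h, Nat.add_sub_cancel_left, pow_one] at this
  · norm_num

lemma defect_succ_succ_le (n : ℕ) {ε : ℝ} (hε : 𝔼 A : Fin n → Fin (n + 1) → Fin 4,
    (if signRank F A = n then spanProb F A else 0) ≤ ε) :
    defect F (n + 1) (n + 1) ≤ 3 / 4 * defect F n n + ε := by
  linarith [defect_succ_le (F := F) n, defect_succ_right_le (F := F) n]

lemma defect_le_two (n : ℕ) : defect F n n ≤ 2 := by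
  induction n with
  | zero => simp [defect]
  | succ n ih => linarith [defect_succ_succ_le (F := F) n (expect_spanProb_le_half n)]

lemma defect_add_le {ε : ℝ} (n k : ℕ) (hε : ∀ m, n ≤ m → m < n + k →
    𝔼 A : Fin m → Fin (m + 1) → Fin 4, (if signRank F A = m then spanProb F A else 0) ≤ ε) :
    defect F (n + k) (n + k) ≤ 2 * (3 / 4) ^ k + 4 * ε * (1 - (3 / 4) ^ k) := by
  induction k with
  | zero => simpa using defect_le_two n
  | succ k ih =>
    have h1 := ih fun m hm hmk => hε m hm (by omega)
    have h2 := defect_succ_succ_le (F := F) (n + k) (hε (n + k) (by omega) (by omega))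
    rw [← add_assoc, pow_succ]
    linarith

lemma unifProb_signRank_ne_le (n : ℕ) :
    unifProb (fun A : Fin n → Fin n → Fin 4 => signRank F A ≠ n) ≤ defect F n n := by
  classical
  refine expect_le_expect fun A _ => ?_
  have h2 : (1 : ℝ) ≤ 2 ^ (n - signRank F A) := one_le_pow₀ (by norm_num)
  split_ifs with h
  · have : (2 : ℝ) ^ 1 ≤ 2 ^ (n - signRank F A) :=
      pow_le_pow_right₀ (by norm_num) (by have := signRank_le_left (F := F) A; omega)
    linarith
  · linarith

end Field

section ZMod

variable {p : ℕ} [Fact p.Prime]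

lemma expect_spanProb_le {n : ℕ} (hp : (p : ℝ) ≤ Real.exp (n / 81920)) :
    𝔼 A : Fin n → Fin (n + 1) → Fin 4,
      (if signRank (ZMod p) A = n then spanProb (ZMod p) A else 0) ≤ 12 / p := by
  classical
  have hp0 : (0 : ℝ) < p := by exact_mod_cast (Fact.out : p.Prime).pos
  set bad : (Fin n → Fin (n + 1) → Fin 4) → Prop := fun A =>
      (LinearIndependent (ZMod p) fun i => lazyVec (ZMod p) (A i)) ∧
      ∃ ξ : Fin (n + 1) → ZMod p, ξ ≠ 0 ∧ 6 / p < orthProb 4 ξ ∧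
        ∀ i, lazyVec (ZMod p) (A i) ⬝ᵥ ξ = 0 with hbad
  have hb : unifProb bad ≤ 6 / p := unifProb_exists_unbalanced_le hp
  calc _ ≤ 𝔼 A : Fin n → Fin (n + 1) → Fin 4, ((6 / p : ℝ) + if bad A then 1 else 0) := by
        refine expect_le_expect fun A _ => ?_
        have h0 : (0 : ℝ) < 6 / p := by positivity
        by_cases hA : bad A
        · rw [if_pos hA]
          have : spanProb (ZMod p) A ≤ 1 := unifProb_le_one _
          split_ifs <;> linarith
        · rw [if_neg hA, add_zero]
          split_ifs with hr
          · obtain ⟨ξ, hξ, hξ0⟩ := Submodule.exists_mem_ne_zero_of_ne_bot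
              (LinearMap.ker_ne_bot_of_finrank_lt
                (f := (Matrix.of fun i => lazyVec (ZMod p) (A i)).mulVecLin) (by simp))
            have horth : ∀ i, lazyVec (ZMod p) (A i) ⬝ᵥ ξ = 0 := fun i => congrFun hξ i
            have hle : orthProb 4 ξ ≤ 6 / p := by
              by_contra! hlt
              exact hA ⟨(linearIndependent_iff_signRank_eq A).2 hr, ξ, hξ0, hlt, horth⟩
            refine le_trans (unifProb_mono fun x hx => ?_) hle
            refine mem_orthTo.1 (Submodule.span_le.2 ?_ hx)
            rintro _ ⟨i, rfl⟩
            exact mem_orthTo.2 (horth i)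
          · exact h0.le
    _ = 6 / p + unifProb bad := by
        rw [expect_add_distrib, Fintype.expect_const, unifProb_def]
        congr!
    _ ≤ 12 / p := by
        have : (12 / p : ℝ) = 6 / p + 6 / p := by ring
        linarith

/-- The rank of a random sign matrix modulo a prime `p` that is not too large is rarely
deficient. -/
lemma unifProb_signRank_ne_le_div {n : ℕ} (hp : (p : ℝ) ≤ Real.exp (n / 163840)) :
    unifProb (fun A : Fin n → Fin n → Fin 4 => signRank (ZMod p) A ≠ n) ≤ 50 / p := by
  have hp0 : (0 : ℝ) < p := by exact_mod_cast (Fact.out : p.Prime).pos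
  obtain ⟨k, m, hkm, hk, hm⟩ : ∃ k m, m + k = n ∧ n ≤ 2 * m ∧ n ≤ 2 * k + 1 :=
    ⟨n / 2, n - n / 2, by omega, by omega, by omega⟩
  refine (unifProb_signRank_ne_le n).trans ?_
  have h1 := defect_add_le (F := ZMod p) (ε := 12 / p) m k fun l hl _ =>
    expect_spanProb_le (hp.trans (Real.exp_le_exp.2 (by
      have : (n : ℝ) ≤ 2 * l := by exact_mod_cast hk.trans (by omega)
      linarith)))
  rw [hkm] at h1
  have h2 : (3 / 4 : ℝ) ^ k ≤ 1 / p := by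
    have hp2 : (2 : ℝ) ≤ p := by exact_mod_cast (Fact.out : p.Prime).two_le
    have hn : Real.log 2 ≤ n / 163840 :=
      (Real.log_le_iff_le_exp (by norm_num)).2 (hp2.trans hp)
    have hkn : (n : ℝ) ≤ 2 * k + 1 := by exact_mod_cast hm
    calc (3 / 4 : ℝ) ^ k ≤ Real.exp (-(1 / 4)) ^ k := by
          gcongr
          refine le_trans (le_of_eq ?_) (Real.add_one_le_exp _)
          norm_num
      _ ≤ Real.exp (-(n / 163840)) := by
          rw [← Real.exp_nat_mul, Real.exp_le_exp]
          linarith [Real.log_two_gt_d9]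
      _ ≤ 1 / p := by
          rw [Real.exp_neg, ← one_div]
          exact one_div_le_one_div_of_le hp0 hp
  have e : (12 / p : ℝ) = 12 * (1 / p) := by ring
  have e' : (50 / p : ℝ) = 50 * (1 / p) := by ring
  have h3 : (0 : ℝ) < 1 / p := by positivity
  have h4 : (0 : ℝ) ≤ (3 / 4) ^ k := by positivity
  rw [e] at h1
  rw [e']
  nlinarith [mul_nonneg h3.le h4]

end ZMod

section Primes

lemma mul_card_primes_Ico_le (j : ℕ) :
    j * #{p ∈ Ico (2 ^ j) (2 ^ (j + 1)) | p.Prime} ≤ 4 * 2 ^ j := by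
  have h : (2 : ℕ) ^ (j * #{p ∈ Ico (2 ^ j) (2 ^ (j + 1)) | p.Prime}) ≤ 2 ^ (4 * 2 ^ j) := by
    calc _ = (2 ^ j) ^ #{p ∈ Ico (2 ^ j) (2 ^ (j + 1)) | p.Prime} := by rw [pow_mul]
      _ ≤ ∏ p ∈ Ico (2 ^ j) (2 ^ (j + 1)) with p.Prime, p :=
          pow_card_le_prod _ _ _ fun p hp => (mem_Ico.1 (mem_filter.1 hp).1).1
      _ ≤ primorial (2 ^ (j + 1)) := by
          refine prod_le_prod_of_subset_of_one_le' (fun p hp => ?_) fun p hp _ =>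
            (mem_filter.1 hp).2.one_lt.le
          simp only [mem_filter, mem_Ico, mem_range] at hp ⊢
          exact ⟨by omega, hp.2⟩
      _ ≤ 4 ^ 2 ^ (j + 1) := primorial_le_four_pow _
      _ = 2 ^ (4 * 2 ^ j) := by
          rw [show 4 * 2 ^ j = 2 * 2 ^ (j + 1) by ring, pow_mul]
          norm_num
  exact (Nat.pow_le_pow_iff_right (by norm_num)).1 h

lemma sum_primes_inv_le_harmonic (n : ℕ) :
    ∑ p ∈ range (2 ^ (n + 1)) with p.Prime, (1 / p : ℝ) ≤ 4 * harmonic n := by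
  induction n with
  | zero =>
    have : (range (2 ^ (0 + 1))).filter Nat.Prime = ∅ := by decide
    rw [this]
    simp
  | succ n ih =>
    have hblock : ∑ p ∈ (Ico (2 ^ (n + 1)) (2 ^ (n + 1 + 1))).filter Nat.Prime, (1 / p : ℝ) ≤
        4 * (n + 1 : ℝ)⁻¹ := by
      calc _ ≤ #{p ∈ Ico (2 ^ (n + 1)) (2 ^ (n + 1 + 1)) | p.Prime} • (1 / 2 ^ (n + 1) : ℝ) := by
            refine sum_le_card_nsmul _ _ _ fun p hp => ?_
            have := (mem_Ico.1 (mem_filter.1 hp).1).1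
            exact one_div_le_one_div_of_le (by positivity) (by exact_mod_cast this)
        _ ≤ _ := by
            have h : ((n + 1 : ℕ) : ℝ) * #{p ∈ Ico (2 ^ (n + 1)) (2 ^ (n + 1 + 1)) | p.Prime} ≤
                4 * 2 ^ (n + 1) := by exact_mod_cast mul_card_primes_Ico_le (n + 1)
            rw [nsmul_eq_mul, mul_one_div, ← div_eq_mul_inv,
              div_le_div_iff₀ (by positivity) (by positivity)]
            push_cast at h
            linarith
    rw [sum_filter, ← sum_range_add_sum_Ico _ (Nat.pow_le_pow_right two_pos (Nat.le_succ (n + 1))),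
      ← sum_filter, ← sum_filter, harmonic_succ]
    push_cast
    linarith

lemma sum_primes_inv_le_log {n : ℕ} (hn : 2 ≤ n) :
    ∑ p ∈ range (2 ^ n) with p.Prime, (1 / p : ℝ) ≤ 10 * Real.log n := by
  have h1 : Real.log 2 ≤ Real.log n :=
    Real.log_le_log (by norm_num) (by exact_mod_cast hn)
  have h2 := Real.log_two_gt_d9
  calc _ ≤ ∑ p ∈ range (2 ^ (n + 1)) with p.Prime, (1 / p : ℝ) := by
        refine sum_le_sum_of_subset_of_nonneg (filter_subset_filter _ (range_subset_range.2
          (Nat.pow_le_pow_right (by norm_num) (by omega)))) fun _ _ _ => by positivity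
    _ ≤ 4 * harmonic n := sum_primes_inv_le_harmonic n
    _ ≤ 4 * (1 + Real.log n) := by gcongr; exact harmonic_le_one_add_log n
    _ ≤ _ := by linarith

/-- A number bounded by `n ^ n` has few prime factors larger than `exp (c * n)`. -/
lemma card_large_primeFactors_le {n D : ℕ} (hn : 2 ≤ n) (hD : D ≤ n ^ n) {K : ℝ} (hK : 0 < K) :
    (#{p ∈ D.primeFactors | Real.exp (n / K) < (p : ℕ)} : ℝ) ≤ K * Real.log n := by
  have hn0 : (0 : ℝ) < n := by positivity
  have hlog : 0 ≤ Real.log n := Real.log_natCast_nonneg n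
  obtain rfl | hD0 := eq_or_ne D 0
  · simpa using mul_nonneg hK.le hlog
  set s := {p ∈ D.primeFactors | Real.exp (n / K) < (p : ℕ)}
  have h1 : Real.exp (n / K) ^ #s ≤ (n : ℝ) ^ n := by
    calc _ ≤ ∏ p ∈ s, (p : ℝ) := by
          rw [← prod_const]
          exact prod_le_prod (fun _ _ => (Real.exp_pos _).le) fun p hp => (mem_filter.1 hp).2.le
      _ = ((∏ p ∈ s, p : ℕ) : ℝ) := by push_cast; rfl
      _ ≤ ((∏ p ∈ D.primeFactors, p : ℕ) : ℝ) := by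
          refine Nat.cast_le.2 (prod_le_prod_of_subset_of_one_le' (filter_subset _ _)
            fun p hp _ => (Nat.prime_of_mem_primeFactors hp).one_lt.le)
      _ ≤ ((n ^ n : ℕ) : ℝ) := Nat.cast_le.2
          ((Nat.le_of_dvd (Nat.pos_of_ne_zero hD0) (Nat.prod_primeFactors_dvd D)).trans hD)
      _ = _ := by push_cast; rfl
  have h2 := Real.log_le_log (by positivity) h1
  rw [Real.log_pow, Real.log_pow, Real.log_exp, mul_div_assoc', div_le_iff₀ hK] at h2
  have h3 : (n : ℝ) * #s ≤ n * (K * Real.log n) := by linarith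
  exact le_of_mul_le_mul_left h3 hn0

end Primes

section Determinant

/-- The determinant of the matrix of lazy random signs attached to `A`. -/
def signDet {n : ℕ} (A : Fin n → Fin n → Fin 4) : ℤ :=
  (Matrix.of fun i => lazyVec ℤ (A i)).det

lemma natAbs_signDet_le {n : ℕ} (A : Fin n → Fin n → Fin 4) : (signDet A).natAbs ≤ n ^ n := by
  have h := Matrix.det_le (A := Matrix.of fun i => lazyVec ℤ (A i))
    (abv := AbsoluteValue.abs) (x := 1) fun i j => by
      simp only [Matrix.of_apply, lazyVec, lazyVal, AbsoluteValue.abs_apply]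
      split_ifs <;> simp
  rw [AbsoluteValue.abs_apply, Int.abs_eq_natAbs, one_pow, Fintype.card_fin, nsmul_one] at h
  exact (Int.ofNat_le.1 h).trans (Nat.factorial_le_pow n)

lemma signRank_ne_of_dvd_signDet {p n : ℕ} [Fact p.Prime] {A : Fin n → Fin n → Fin 4}
    (h : (p : ℤ) ∣ signDet A) : signRank (ZMod p) A ≠ n := by
  intro hr
  have hli := (linearIndependent_iff_signRank_eq A).2 hr
  have hunit := (Matrix.linearIndependent_rows_iff_isUnit
    (A := Matrix.of fun i => lazyVec (ZMod p) (A i))).1 hli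
  refine ((Matrix.isUnit_iff_isUnit_det _).1 hunit).ne_zero ?_
  have hmap : Matrix.of (fun i => lazyVec (ZMod p) (A i)) =
      (Int.castRingHom (ZMod p)).mapMatrix (Matrix.of fun i => lazyVec ℤ (A i)) := by
    ext i j
    simp only [Matrix.of_apply, lazyVec, lazyVal, RingHom.mapMatrix_apply, Matrix.map_apply]
    split_ifs <;> simp
  rw [hmap, ← RingHom.map_det]
  exact (ZMod.intCast_zmod_eq_zero_iff_dvd _ p).2 h

lemma expect_card_primeFactors_signDet_le {n : ℕ} (hn : 2 ≤ n) :
    𝔼 A : Fin n → Fin n → Fin 4, (#(signDet A).natAbs.primeFactors : ℝ) ≤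
      164340 * Real.log n := by
  classical
  set P : Finset ℕ := {p ∈ (range (2 ^ n)).filter Nat.Prime | ((p : ℕ) : ℝ) ≤ Real.exp (n / 163840)}
    with hP
  have hpt : ∀ A : Fin n → Fin n → Fin 4, (#(signDet A).natAbs.primeFactors : ℝ) ≤
      ∑ p ∈ P, (if (p : ℤ) ∣ signDet A then 1 else 0 : ℝ) + 163840 * Real.log n := by
    intro A
    set D := (signDet A).natAbs
    have hlarge := card_large_primeFactors_le hn (natAbs_signDet_le A)
      (show (0 : ℝ) < 163840 by norm_num)
    rw [← card_filter_add_card_filter_not (s := D.primeFactors)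
      (fun p : ℕ => Real.exp (n / 163840) < (p : ℕ)), add_comm, Nat.cast_add]
    refine add_le_add ?_ hlarge
    rw [sum_boole]
    refine Nat.cast_le.2 (card_le_card fun p hp => ?_)
    obtain ⟨hp, hle⟩ := mem_filter.1 hp
    have hle := not_lt.1 hle
    refine mem_filter.2 ⟨mem_filter.2 ⟨mem_filter.2 ⟨mem_range.2 ?_,
      Nat.prime_of_mem_primeFactors hp⟩, hle⟩, ?_⟩
    · have h2 : Real.exp (1 / 163840) < 2 := by
        rw [← Real.lt_log_iff_exp_lt (by norm_num)]
        linarith [Real.log_two_gt_d9]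
      have h3 : (p : ℝ) < 2 ^ n := by
        refine hle.trans_lt ?_
        rw [div_eq_mul_one_div, Real.exp_nat_mul]
        exact pow_lt_pow_left₀ h2 (Real.exp_pos _).le (by omega)
      exact_mod_cast h3
    · exact Int.natCast_dvd.2 (Nat.dvd_of_mem_primeFactors hp)
  calc _ ≤ 𝔼 A : Fin n → Fin n → Fin 4,
        (∑ p ∈ P, (if (p : ℤ) ∣ signDet A then 1 else 0 : ℝ) + 163840 * Real.log n) :=
        expect_le_expect fun A _ => hpt A
    _ = ∑ p ∈ P, unifProb (fun A : Fin n → Fin n → Fin 4 => (p : ℤ) ∣ signDet A) +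
          163840 * Real.log n := by
        rw [expect_add_distrib, Fintype.expect_const, expect_sum_comm]
        congr! 1
        refine sum_congr rfl fun p _ => ?_
        rw [unifProb_def]
        congr!
    _ ≤ ∑ p ∈ P, 50 * (1 / p : ℝ) + 163840 * Real.log n := by
        gcongr with p hp
        obtain ⟨hp, hle⟩ := mem_filter.1 hp
        have : Fact p.Prime := ⟨(mem_filter.1 hp).2⟩
        rw [mul_one_div]
        exact (unifProb_mono fun A => signRank_ne_of_dvd_signDet).trans
          (unifProb_signRank_ne_le_div hle)
    _ ≤ 50 * ∑ p ∈ range (2 ^ n) with p.Prime, (1 / p : ℝ) + 163840 * Real.log n := by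
        rw [← mul_sum]
        gcongr
        exact filter_subset _ _
    _ ≤ _ := by linarith [sum_primes_inv_le_log hn]

end Determinant

section Measure

/-- The uniform probability measure on a finite type. -/
noncomputable def unifMeasure (Ω : Type*) [Fintype Ω] [MeasurableSpace Ω] : Measure Ω :=
  (Fintype.card Ω : ENNReal)⁻¹ • Measure.count

instance {Ω : Type*} [Fintype Ω] [Nonempty Ω] [MeasurableSpace Ω] :
    IsProbabilityMeasure (unifMeasure Ω) := by
  constructor
  rw [unifMeasure, Measure.smul_apply, Measure.count_univ, smul_eq_mul,
    ENat.card_eq_coe_fintype_card]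
  exact ENNReal.inv_mul_cancel (by simp) (by simp)

lemma pi_unifMeasure (ι Ω : Type*) [Fintype ι] [DecidableEq ι] [Fintype Ω] [Nonempty Ω]
    [MeasurableSpace Ω] [MeasurableSingletonClass Ω] :
    Measure.pi (fun _ : ι => unifMeasure Ω) = unifMeasure (ι → Ω) := by
  refine Measure.ext_of_singleton fun x => ?_
  rw [Measure.pi_singleton]
  simp [unifMeasure, ENNReal.inv_pow]

lemma integral_unifMeasure {Ω : Type*} [Fintype Ω] [MeasurableSpace Ω]
    [MeasurableSingletonClass Ω] [Nonempty Ω] (f : Ω → ℝ) : ∫ x, f x ∂unifMeasure Ω = 𝔼 x, f x := by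
  rw [integral_fintype (Integrable.of_finite), Fintype.expect_eq_sum_div_card, sum_div]
  refine sum_congr rfl fun x _ => ?_
  simp [unifMeasure, Measure.real, div_eq_inv_mul]

lemma map_lazyVal_unifMeasure :
    (unifMeasure (Fin 4)).map (lazyVal ℤ) = entryMeasure := by
  have h2 : (2⁻¹ : ENNReal) = 4⁻¹ + 4⁻¹ := by
    rw [← two_mul, show (4 : ENNReal) = 2 * 2 by norm_num,
      ENNReal.mul_inv (by norm_num) (by norm_num), ← mul_assoc,
      ENNReal.mul_inv_cancel (by norm_num) (by norm_num), one_mul]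
  have hv : lazyVal ℤ (0 : Fin 4) = 1 ∧ lazyVal ℤ (1 : Fin 4) = -1 ∧
      lazyVal ℤ (2 : Fin 4) = 0 ∧ lazyVal ℤ (3 : Fin 4) = 0 := by decide
  obtain ⟨v0, v1, v2, v3⟩ := hv
  have hm : Measurable (lazyVal ℤ (N := 4)) := measurable_of_finite _
  simp only [unifMeasure, Measure.count, Measure.sum_fintype, Fin.sum_univ_four,
    Measure.map_smul, Measure.map_add _ _ hm, Measure.map_dirac, v0, v1, v2, v3,
    entryMeasure, one_div, h2, add_smul, smul_add, Fintype.card_fin, Nat.cast_ofNat]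
  abel

lemma map_lazyVec_unifMeasure (n : ℕ) :
    (unifMeasure (Fin n → Fin 4)).map (lazyVec ℤ) = vecMeasure n := by
  rw [← pi_unifMeasure, vecMeasure, ← map_lazyVal_unifMeasure,
    ← Measure.pi_map_pi fun _ => (measurable_of_finite _).aemeasurable]
  rfl

lemma map_lazyMat_unifMeasure (n : ℕ) :
    (unifMeasure (Fin n → Fin n → Fin 4)).map (fun A i => lazyVec ℤ (A i)) = matMeasure n := by
  rw [← pi_unifMeasure, matMeasure, ← map_lazyVec_unifMeasure,
    ← Measure.pi_map_pi fun _ => (measurable_of_finite _).aemeasurable]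

end Measure

end UniformMatrix

/-- The expected number of distinct primes dividing `det M` (counted as `0`
when `det M = 0`; note `Nat.primeFactors 0 = ∅`, so the indicator is built into
the integrand) is at most `C * log n` for an absolute constant `C > 0`. -/
theorem expected_card_primeFactors_det_le :
    ∃ C : ℝ, 0 < C ∧ ∀ n : ℕ, 2 ≤ n →
      (∫ M, ((Matrix.of M).det.natAbs.primeFactors.card : ℝ)
          ∂(matMeasure n)) ≤ C * Real.log n := by
  refine ⟨164340, by norm_num, fun n hn => ?_⟩
  rw [← UniformMatrix.map_lazyMat_unifMeasure, integral_map
    (measurable_of_finite _).aemeasurable .of_discrete, UniformMatrix.integral_unifMeasure]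
  exact UniformMatrix.expect_card_primeFactors_signDet_le hn
end
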